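/- Infinitely many degenerate magic angles for the Bistritzer–MacDonald potential: For the chiral model with the Bistritzer–MacDonald potential U_BM, the set of non-simple magic parameters {α ∈ ℂ : dim_ℂ Ker(α,k) ≥ 2 for every k ∈ ℂ} is infinite. -/

import Mathlib

noncomputable section

open Complex MeasureTheory

namespace TBG

/-- `ω = exp(2πi/3)`. -/
def ω : ℂ := Complex.exp (2 * Real.pi * Complex.I / 3)

/-- The moiré lattice `Λ = ℤω + ℤ ⊂ ℂ`. -/
def Λ : Set ℂ := {z : ℂ | ∃ m n : ℤ, z = m * ω + n}

/-- The dual lattice `Λ* = (4πi/√3)·Λ`. -/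
def Λdual : Set ℂ := {p : ℂ | ∃ m n : ℤ, p = 4 * Real.pi * Complex.I / Real.sqrt 3 * (m * ω + n)}

/-- The high symmetry point `K = 4π/3`. -/
def K : ℂ := 4 * Real.pi / 3

/-- `⟨z,w⟩ = Re (z · conj w)`. -/
def pair (z w : ℂ) : ℝ := (z * (starRingEnd ℂ) w).re

/-- `2 D_z̄ f = (1/i)(∂_x f + i ∂_y f)`. -/
def Dbar (f : ℂ → ℂ) (z : ℂ) : ℂ :=
  1 / Complex.I * (fderiv ℝ f z 1 + Complex.I * fderiv ℝ f z Complex.I)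

/-- A tunnelling potential: smooth, with the translational and rotational symmetries. -/
def IsTunnelling (U : ℂ → ℂ) : Prop :=
  ContDiff ℝ (⊤ : ℕ∞) U ∧
    (∀ γ ∈ Λ, ∀ z : ℂ, U (z + γ) = Complex.exp (Complex.I * (pair γ K : ℂ)) * U z) ∧
    ∀ z : ℂ, U (ω * z) = ω * U z

/-- Membership in `ker_{L²₀}(D(α)+k)` for the chiral model with tunnelling
potentials `U₊ = Up`, `U₋ = Um`: smooth solutions of `(D(α)+k)u = 0` with the
Floquet boundary conditions. -/
def InKer (Up Um : ℂ → ℂ) (α k : ℂ) (u : ℂ → ℂ × ℂ) : Prop :=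
  ContDiff ℝ (⊤ : ℕ∞) u ∧
    (∀ z : ℂ, Dbar (fun w => (u w).1) z + k * (u z).1 + α * Up z * (u z).2 = 0) ∧
    (∀ z : ℂ, Dbar (fun w => (u w).2) z + k * (u z).2 + α * Um z * (u z).1 = 0) ∧
    (∀ γ ∈ Λ, ∀ z : ℂ, (u (z + γ)).1 = Complex.exp (-Complex.I * (pair γ K : ℂ)) * (u z).1) ∧
    (∀ γ ∈ Λ, ∀ z : ℂ, (u (z + γ)).2 = Complex.exp (Complex.I * (pair γ K : ℂ)) * (u z).2)

/-- `Ker(α,k)` as a set of functions. -/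
def kerSet (Up Um : ℂ → ℂ) (α k : ℂ) : Set (ℂ → ℂ × ℂ) := {u | InKer Up Um α k u}

/-- `dim_ℂ Ker(α,k)` (the set `Ker(α,k)` is a linear subspace, so the finrank of its span
is its dimension). -/
def kerDim (Up Um : ℂ → ℂ) (α k : ℂ) : ℕ :=
  Module.finrank ℂ ↥(Submodule.span ℂ (kerSet Up Um α k))

/-- `Ker_p(α) = {u ∈ Ker(α,0) : u(ωz) = ω^(−p)·u(z)}`. -/
def kerPSet (Up Um : ℂ → ℂ) (α : ℂ) (p : ℕ) : Set (ℂ → ℂ × ℂ) :=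
  {u | u ∈ kerSet Up Um α 0 ∧ ∀ z : ℂ, u (ω * z) = (ω ^ (-(p : ℤ))) • u z}

/-- `dim_ℂ Ker_p(α)`. -/
def kerPDim (Up Um : ℂ → ℂ) (α : ℂ) (p : ℕ) : ℕ :=
  Module.finrank ℂ ↥(Submodule.span ℂ (kerPSet Up Um α p))

/-- `α` is magic: the flat band condition `Ker(α,k) ≠ {0}` for every `k`. -/
def IsMagic (Up Um : ℂ → ℂ) (α : ℂ) : Prop :=
  ∀ k : ℂ, ∃ u ∈ kerSet Up Um α k, u ≠ 0


/-- The (rescaled) Bistritzer–MacDonald potential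
`U_BM(z) = −(4π/3)·i·Σ_{ℓ=0}^{2} ω^ℓ·exp((4π/3)·i·⟨z,ω^ℓ⟩)`. -/
def UBM (z : ℂ) : ℂ :=
  -(4 * Real.pi / 3) * Complex.I *
    ∑ l ∈ Finset.range 3, ω ^ l * Complex.exp (4 * Real.pi / 3 * Complex.I * (pair z (ω ^ l) : ℂ))

section PiTranscendental

open Polynomial

variable {L : Type*} [Field L] [Algebra ℚ L]

/-- The sums over nonempty-sum subsets of the roots of a rational polynomial are permuted by
automorphisms, so symmetric expressions in them are fixed. -/
lemma sum_subset_sums_fixed [DecidableEq L] (p : ℚ[X]) (hp : p ≠ 0) (f : L ≃ₐ[ℚ] L)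
    {M : Type*} [AddCommMonoid M] (F : L → M) :
    ∑ t ∈ (p.rootSet_finite L).toFinset.powerset with ∑ i ∈ t, i ≠ 0, F (f (∑ i ∈ t, i)) =
      ∑ t ∈ (p.rootSet_finite L).toFinset.powerset with ∑ i ∈ t, i ≠ 0, F (∑ i ∈ t, i) := by
  have key : ∀ (g : L ≃ₐ[ℚ] L) (t : Finset L), t ⊆ (p.rootSet_finite L).toFinset →
      t.map g.toEquiv.toEmbedding ⊆ (p.rootSet_finite L).toFinset := by
    intro g t ht x hx
    simp only [Finset.mem_map] at hx
    obtain ⟨y, hy, rfl⟩ := hx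
    have := ht hy
    simp only [Set.Finite.mem_toFinset, mem_rootSet] at this ⊢
    refine ⟨hp, ?_⟩
    have h2 := Polynomial.aeval_algHom_apply (g : L →ₐ[ℚ] L) y p
    simp only [this.2, map_zero] at h2
    exact h2
  have hs : ∀ (g : L ≃ₐ[ℚ] L) (t : Finset L),
      ∑ i ∈ t.map g.toEquiv.toEmbedding, i = g (∑ i ∈ t, i) := by
    intro g t
    simp [Finset.sum_map]
  refine Finset.sum_bij' (fun t _ => t.map f.toEquiv.toEmbedding)
    (fun t _ => t.map f.symm.toEquiv.toEmbedding) ?_ ?_ ?_ ?_ ?_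
  · intro t ht
    simp only [Finset.mem_filter, Finset.mem_powerset] at ht ⊢
    exact ⟨key f t ht.1, by rw [hs]; exact (map_ne_zero f).2 ht.2⟩
  · intro t ht
    simp only [Finset.mem_filter, Finset.mem_powerset] at ht ⊢
    exact ⟨key f.symm t ht.1, by rw [hs]; exact (map_ne_zero f.symm).2 ht.2⟩
  · intro t _
    ext x
    simp
  · intro t _
    ext x
    simp
  · intro t _
    rw [hs]

theorem transcendental_pi : Transcendental ℚ (Real.pi : ℂ) := by
  classical
  intro halg
  have hI : IsAlgebraic ℚ (Complex.I) :=
    ⟨X ^ 2 + 1, by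
      intro h
      have := congrArg (fun q => q.coeff 0) h
      simp at this, by simp⟩
  have hx : IsAlgebraic ℚ (Real.pi * Complex.I : ℂ) := halg.mul hI
  have hxi : IsIntegral ℚ (Real.pi * Complex.I : ℂ) := hx.isIntegral
  set p := minpoly ℚ (Real.pi * Complex.I : ℂ) with hpdef
  have hp0 : p ≠ 0 := minpoly.ne_zero hxi
  have : IsSplittingField ℚ p.SplittingField p := by
    convert IsSplittingField.splittingField p
    exact Subsingleton.elim _ _
  have : FiniteDimensional ℚ p.SplittingField := IsSplittingField.finiteDimensional _ p
  have : IsGalois ℚ p.SplittingField :=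
    IsGalois.of_separable_splitting_field (p := p) (minpoly.irreducible hxi).separable
  let φ : p.SplittingField →ₐ[ℚ] ℂ := IsAlgClosed.lift
  have hφ : Function.Injective φ := φ.toRingHom.injective
  obtain ⟨θ, hθr, hθ⟩ : ∃ θ : p.SplittingField, θ ∈ p.rootSet p.SplittingField ∧
      φ θ = Real.pi * Complex.I := by
    have h1 := (SplittingField.splits p).image_rootSet φ
    have h2 : (Real.pi * Complex.I : ℂ) ∈ p.rootSet ℂ := by
      rw [mem_rootSet]; exact ⟨hp0, minpoly.aeval _ _⟩
    rw [← h1] at h2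
    exact h2
  set S := (p.rootSet_finite p.SplittingField).toFinset with hS
  set T := S.powerset.filter (fun t => ∑ i ∈ t, i ≠ 0) with hT
  have hprod : ∏ i ∈ S, (1 + Complex.exp (φ i)) = 0 := by
    refine Finset.prod_eq_zero (i := θ) (by simpa [hS] using hθr) ?_
    rw [hθ, Complex.exp_pi_mul_I]; simp
  obtain ⟨k0, hk0, hsum⟩ : ∃ k0 : ℕ, 0 < k0 ∧
      (k0 : ℂ) + ∑ t ∈ T, Complex.exp (φ (∑ i ∈ t, i)) = 0 := by
    refine ⟨(S.powerset.filter (fun t => ¬ (∑ i ∈ t, i ≠ 0))).card, ?_, ?_⟩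
    · refine Finset.card_pos.2 ⟨∅, by simp⟩
    · rw [Finset.prod_one_add, ← Finset.sum_filter_add_sum_filter_not _ (fun t => ∑ i ∈ t, i ≠ 0)]
        at hprod
      rw [← hprod, add_comm]
      congr 1
      · refine Finset.sum_congr rfl fun t _ => ?_
        rw [map_sum, Complex.exp_sum]
      · rw [Finset.card_eq_sum_ones]
        push_cast
        refine Finset.sum_congr rfl fun t ht => ?_
        rw [← Complex.exp_sum, ← map_sum]
        have : ∑ i ∈ t, i = 0 := by simpa using (Finset.mem_filter.1 ht).2
        rw [this]; simp
  -- the polynomial whose roots are the nonzero subset sums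
  obtain ⟨q, hq⟩ : ∃ q : ℚ[X], q.map (algebraMap ℚ p.SplittingField) =
      ∏ t ∈ T, (X - C (∑ i ∈ t, i)) := by
    have : (∏ t ∈ T, (X - C (∑ i ∈ t, i))) ∈ Polynomial.lifts (algebraMap ℚ p.SplittingField) := by
      rw [Polynomial.lifts_iff_coeff_lifts]
      intro n
      have hfix : ∀ f : p.SplittingField ≃ₐ[ℚ] p.SplittingField,
          f ((∏ t ∈ T, (X - C (∑ i ∈ t, i))).coeff n) =
            (∏ t ∈ T, (X - C (∑ i ∈ t, i))).coeff n := by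
        intro f
        have h1 := sum_subset_sums_fixed p hp0 f
          (fun x => Additive.ofMul (X - C x : p.SplittingField[X]))
        rw [← ofMul_prod, ← ofMul_prod] at h1
        have h2 : ∏ t ∈ T, (X - C (f (∑ i ∈ t, i))) = ∏ t ∈ T, (X - C (∑ i ∈ t, i)) :=
          Additive.ofMul.injective h1
        conv_rhs => rw [← h2]
        have h3 := Polynomial.coeff_map (p := ∏ t ∈ T, (X - C (∑ i ∈ t, i)))
          (f : p.SplittingField →+* p.SplittingField) n
        rw [Polynomial.map_prod] at h3
        simp only [Polynomial.map_sub, Polynomial.map_X, Polynomial.map_C] at h3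
        exact h3.symm
      have := (IsGalois.mem_bot_iff_fixed _).2 hfix
      rw [IntermediateField.mem_bot] at this
      exact this
    simpa [Polynomial.mem_lifts] using this
  obtain ⟨b, hb, hbq⟩ := IsLocalization.integerNormalization_spec (nonZeroDivisors ℤ) q
  set f := IsLocalization.integerNormalization (nonZeroDivisors ℤ) q with hf
  have hb0 : b ≠ 0 := nonZeroDivisors.ne_zero hb
  have hfmap : f.map (algebraMap ℤ p.SplittingField) = C (b : p.SplittingField) *
      ∏ t ∈ T, (X - C (∑ i ∈ t, i)) := by
    rw [IsScalarTower.algebraMap_eq ℤ ℚ p.SplittingField, ← Polynomial.map_map, hbq, ← hq,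
      zsmul_eq_mul, Polynomial.map_mul]
    simp
  have hq0 : q ≠ 0 := by
    rintro rfl
    rw [Polynomial.map_zero] at hq
    exact (Finset.prod_ne_zero_iff.2 fun t _ => X_sub_C_ne_zero (∑ i ∈ t, i)) hq.symm
  have hf0 : f ≠ 0 := by
    intro h
    rw [h, Polynomial.map_zero] at hfmap
    have : C (b : p.SplittingField) ≠ 0 := by simpa using hb0
    exact mul_ne_zero this
      (Finset.prod_ne_zero_iff.2 fun t _ => X_sub_C_ne_zero (∑ i ∈ t, i)) hfmap.symm
  have hroot : ∀ t ∈ T, aeval (∑ i ∈ t, i) f = 0 := by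
    intro t ht
    rw [aeval_def, ← eval_map, hfmap, eval_mul, eval_prod, Finset.prod_eq_zero ht, mul_zero]
    rw [eval_sub, eval_X, eval_C, sub_self]
  have hf00 : f.eval 0 ≠ 0 := by
    intro h
    have h2 : (f.map (algebraMap ℤ p.SplittingField)).eval 0 = 0 := by
      rw [← Polynomial.coeff_zero_eq_eval_zero] at h ⊢
      rw [Polynomial.coeff_map, h, map_zero]
    rw [hfmap, eval_mul, eval_prod] at h2
    simp only [eval_C, eval_sub, eval_X, zero_sub, mul_eq_zero, Int.cast_eq_zero, hb0, false_or]
      at h2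
    rw [Finset.prod_eq_zero_iff] at h2
    obtain ⟨t, ht, h0⟩ := h2
    exact (Finset.mem_filter.1 ht).2 (by simpa using h0)
  obtain ⟨c, hc⟩ := LindemannWeierstrass.exp_polynomial_approx f hf00
  set a := f.leadingCoeff with ha
  have ha0 : a ≠ 0 := leadingCoeff_ne_zero.2 hf0
  set d := f.natDegree with hd
  have hT0 : T.Nonempty := by
    rw [Finset.nonempty_iff_ne_empty]
    intro h
    rw [h] at hsum
    simp at hsum
    omega
  -- integrality of the symmetric sums
  have h_int : ∀ (g : ℤ[X]) (m : ℕ), g.natDegree ≤ m →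
      ∃ N : ℤ, (N : ℂ) = (a : ℂ) ^ m * ∑ t ∈ T, aeval (φ (∑ i ∈ t, i)) g := by
    intro g m hgm
    have h1 : IsIntegral ℤ ((a : p.SplittingField) ^ m * ∑ t ∈ T, aeval (∑ i ∈ t, i) g) := by
      rw [Finset.mul_sum]
      refine IsIntegral.sum _ fun t ht => ?_
      rw [aeval_eq_sum_range' (Nat.lt_succ_of_le hgm), Finset.mul_sum]
      refine IsIntegral.sum _ fun j hj => ?_
      have hj' : j ≤ m := Nat.lt_succ_iff.1 (Finset.mem_range.1 hj)
      have h2 : IsIntegral ℤ (a • (∑ i ∈ t, i)) := isIntegral_leadingCoeff_smul f _ (hroot t ht)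
      have h3 : (a : p.SplittingField) ^ m * g.coeff j • (∑ i ∈ t, i) ^ j =
          ((g.coeff j * a ^ (m - j) : ℤ) : p.SplittingField) * (a • (∑ i ∈ t, i)) ^ j := by
        rw [zsmul_eq_mul, zsmul_eq_mul, mul_pow]
        push_cast
        conv_lhs => rw [← Nat.sub_add_cancel hj', pow_add]
        ring
      rw [h3]
      refine IsIntegral.mul ?_ (h2.pow _)
      simpa using (isIntegral_algebraMap (R := ℤ) (A := p.SplittingField)
        (x := g.coeff j * a ^ (m - j)))
    have h2 : (∑ t ∈ T, aeval (∑ i ∈ t, i) g : p.SplittingField) ∈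
        (⊥ : IntermediateField ℚ p.SplittingField) := by
      rw [IsGalois.mem_bot_iff_fixed]
      intro σ
      rw [map_sum]
      have h3 := sum_subset_sums_fixed p hp0 σ (fun x => aeval x g)
      rw [← hS, ← hT] at h3
      rw [← h3]
      refine Finset.sum_congr rfl fun t _ => ?_
      exact (Polynomial.aeval_algHom_apply
        ((σ : p.SplittingField →ₐ[ℚ] p.SplittingField).restrictScalars ℤ) _ g).symm
    rw [IntermediateField.mem_bot] at h2
    obtain ⟨r, hr⟩ := h2
    have h4 : IsIntegral ℤ ((a : ℚ) ^ m * r) := by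
      rw [← hr] at h1
      have : (a : p.SplittingField) ^ m * algebraMap ℚ p.SplittingField r =
          algebraMap ℚ p.SplittingField ((a : ℚ) ^ m * r) := by simp
      rw [this] at h1
      exact (isIntegral_algebraMap_iff (algebraMap ℚ p.SplittingField).injective).1 h1
    obtain ⟨N, hN⟩ := IsIntegrallyClosed.isIntegral_iff.1 h4
    refine ⟨N, ?_⟩
    have h5 : (algebraMap ℚ p.SplittingField) ((algebraMap ℤ ℚ) N) =
        (a : p.SplittingField) ^ m * ∑ t ∈ T, aeval (∑ i ∈ t, i) g := by
      rw [hN, map_mul, hr]; simp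
    have h6 := congrArg φ h5
    rw [map_mul, map_sum] at h6
    have h7 : ∀ t ∈ T, φ (aeval (∑ i ∈ t, i) g) = aeval (φ (∑ i ∈ t, i)) g := fun t _ =>
      (Polynomial.aeval_algHom_apply (φ.restrictScalars ℤ) _ g).symm
    rw [Finset.sum_congr rfl h7] at h6
    simpa using h6
  -- choose a large prime
  have hlim : Filter.Tendsto (fun n : ℕ => |(a : ℝ)| ^ d * |c| * (T.card : ℝ) *
      ((|(a : ℝ)| ^ d * |c|) ^ n / (n.factorial : ℝ))) Filter.atTop (nhds 0) := by
    have := (FloorSemiring.tendsto_pow_div_factorial_atTop (|(a : ℝ)| ^ d * |c|)).const_mul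
      (|(a : ℝ)| ^ d * |c| * (T.card : ℝ))
    simpa using this
  have hev := (hlim.eventually (gt_mem_nhds (zero_lt_one))).exists_forall_of_atTop
  obtain ⟨n0, hn0⟩ := hev
  obtain ⟨P, hPge, hPp⟩ := Nat.exists_infinite_primes
    (n0 + 1 + (eval 0 f).natAbs + 1 + a.natAbs + k0 + 1)
  obtain ⟨n, hnP, g, hgdeg, happ⟩ := hc P (by omega) hPp
  obtain ⟨N, hN⟩ := h_int g (P * d) (hgdeg.trans (Nat.sub_le _ _))
  have hmemroot : ∀ t ∈ T, φ (∑ i ∈ t, i) ∈ f.aroots ℂ := by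
    intro t ht
    rw [mem_aroots]
    refine ⟨hf0, ?_⟩
    rw [← AlgHom.restrictScalars_apply ℤ φ, Polynomial.aeval_algHom_apply, hroot t ht, map_zero]
  have hM : ((a ^ (P * d) * n * k0 + P * N : ℤ) : ℂ) =
      -((a : ℂ) ^ (P * d) * ∑ t ∈ T, (n • Complex.exp (φ (∑ i ∈ t, i)) -
        P • aeval (φ (∑ i ∈ t, i)) g)) := by
    have h1 : (k0 : ℂ) = - ∑ t ∈ T, Complex.exp (φ (∑ i ∈ t, i)) := by
      linear_combination hsum
    push_cast
    rw [hN, Finset.sum_sub_distrib, ← Finset.smul_sum, ← Finset.smul_sum, h1]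
    simp only [zsmul_eq_mul, nsmul_eq_mul]
    ring
  have hMlt : |a ^ (P * d) * n * k0 + P * N| < 1 := by
    have h1 : ‖((a ^ (P * d) * n * k0 + P * N : ℤ) : ℂ)‖ < 1 := by
      rw [hM, norm_neg, norm_mul, norm_pow]
      have h2 : ‖∑ t ∈ T, (n • Complex.exp (φ (∑ i ∈ t, i)) -
          P • aeval (φ (∑ i ∈ t, i)) g)‖ ≤ T.card * (|c| ^ P / (P - 1).factorial) := by
        refine (norm_sum_le _ _).trans ?_
        rw [← nsmul_eq_mul]
        refine Finset.sum_le_card_nsmul _ _ _ fun t ht => ?_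
        refine (happ (hmemroot t ht)).trans ?_
        exact div_le_div_of_nonneg_right ((le_abs_self _).trans (abs_pow c P).le) (by positivity)
      have h3 : ‖(a : ℂ)‖ = |(a : ℝ)| := by
        rw [Complex.norm_intCast]
      rw [h3]
      have h4 := hn0 (P - 1) (by omega)
      calc _ ≤ |(a : ℝ)| ^ (P * d) * (T.card * (|c| ^ P / (P - 1).factorial)) := by gcongr
        _ = |(a : ℝ)| ^ d * |c| * (T.card : ℝ) *
            ((|(a : ℝ)| ^ d * |c|) ^ (P - 1) / ((P - 1).factorial : ℝ)) := by
          have hP1 : P = (P - 1) + 1 := by omega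
          generalize P - 1 = Q at hP1
          subst hP1
          rw [mul_comm (Q + 1) d, pow_mul]
          ring
        _ < 1 := h4
    rw [Complex.norm_intCast] at h1
    exact_mod_cast h1
  have hM0 : a ^ (P * d) * n * k0 + P * N = 0 := Int.abs_lt_one_iff.1 hMlt
  have hdvd : (P : ℤ) ∣ a ^ (P * d) * n * k0 := ⟨-N, by linarith⟩
  have hPi : Prime (P : ℤ) := Nat.prime_iff_prime_int.1 hPp
  rcases hPi.dvd_or_dvd hdvd with h | h
  · rcases hPi.dvd_or_dvd h with h | h
    · have h := hPi.dvd_of_dvd_pow h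
      have := Int.le_of_dvd (by positivity) ((dvd_abs _ _).2 h)
      have h9 := Int.natCast_natAbs a
      omega
    · exact hnP h
  · have := Nat.le_of_dvd hk0 (Int.natCast_dvd_natCast.1 h)
    omega

/-- A complex polynomial with algebraic coefficients does not vanish at `π`. -/
theorem aeval_pi_ne_zero (p : (algebraicClosure ℚ ℂ)[X]) (hp : p ≠ 0) :
    aeval (Real.pi : ℂ) p ≠ 0 := by
  intro h
  have h1 : IsAlgebraic (algebraicClosure ℚ ℂ) (Real.pi : ℂ) := ⟨p, hp, h⟩
  have : Algebra.IsAlgebraic ℚ (algebraicClosure ℚ ℂ) := algebraicClosure.isAlgebraic ℚ ℂ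
  exact transcendental_pi (h1.restrictScalars ℚ)

end PiTranscendental

section EntireFunctions

open Filter Topology Metric

/-- Uniqueness of power series coefficients. -/
lemma coeff_eq_zero_of_hasSum_zero (a : ℕ → ℂ)
    (h : ∀ z : ℂ, HasSum (fun n => a n * z ^ n) 0) : a = 0 := by
  have h1 : HasFPowerSeriesAt (0 : ℂ → ℂ) (FormalMultilinearSeries.ofScalars ℂ a) 0 := by
    rw [hasFPowerSeriesAt_iff]
    refine Eventually.of_forall fun z => ?_
    simp only [FormalMultilinearSeries.coeff_ofScalars, smul_eq_mul, Pi.zero_apply]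
    simpa [mul_comm] using h z
  have h2 := h1.eq_zero
  funext n
  have h3 := congrArg (fun p => FormalMultilinearSeries.coeff p n) h2
  simp only [FormalMultilinearSeries.coeff_ofScalars] at h3
  simpa [FormalMultilinearSeries.coeff] using h3

/-- Coefficients decaying faster than any geometric sequence. -/
lemma summable_coeff_mul_pow {a : ℕ → ℂ}
    (h : ∀ R > 0, ∃ B : ℝ, ∀ n, ‖a n‖ * R ^ n ≤ B) (z : ℂ) :
    Summable fun n => ‖a n * z ^ n‖ := by
  obtain ⟨B, hB⟩ := h (2 * (‖z‖ + 1)) (by positivity)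
  refine Summable.of_nonneg_of_le (fun _ => norm_nonneg _) (fun n => ?_)
    (summable_geometric_two.mul_left B)
  have h1 := hB n
  rw [norm_mul, norm_pow]
  have h2 : ‖z‖ ^ n ≤ (‖z‖ + 1) ^ n := by gcongr; linarith
  rw [mul_pow] at h1
  have h3 : ‖a n‖ * (‖z‖ + 1) ^ n ≤ B * (1 / 2) ^ n := by
    rw [one_div, inv_pow, ← div_eq_mul_inv, le_div_iff₀ (by positivity)]
    linarith
  exact (mul_le_mul_of_nonneg_left h2 (norm_nonneg _)).trans h3

lemma differentiable_tsum_coeff {a : ℕ → ℂ}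
    (h : ∀ R > 0, ∃ B : ℝ, ∀ n, ‖a n‖ * R ^ n ≤ B) :
    Differentiable ℂ fun z => ∑' n, a n * z ^ n := by
  intro z
  have h1 := summable_coeff_mul_pow h ((‖z‖ + 1 : ℝ) : ℂ)
  have h2 : DifferentiableOn ℂ (fun w => ∑' n, a n * w ^ n) (ball 0 (‖z‖ + 1)) := by
    refine differentiableOn_tsum_of_summable_norm h1 (fun n => by fun_prop) isOpen_ball ?_
    intro n w hw
    rw [mem_ball_zero_iff] at hw
    rw [norm_mul, norm_mul, norm_pow, norm_pow, Complex.norm_real, Real.norm_eq_abs,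
      abs_of_pos (by positivity)]
    gcongr
  exact h2.differentiableAt (isOpen_ball.mem_nhds (by simp))

/-- An entire function with finitely many zeros is a polynomial times a zero-free function. -/
lemma exists_polynomial_mul_of_finite_zeros (Z : Finset ℂ) :
    ∀ f : ℂ → ℂ, Differentiable ℂ f → f ≠ 0 → (∀ z, f z = 0 → z ∈ Z) →
      ∃ (p : Polynomial ℂ) (g : ℂ → ℂ), p ≠ 0 ∧ Differentiable ℂ g ∧ (∀ z, g z ≠ 0) ∧
        ∀ z, f z = p.eval z * g z := by
  classical
  induction Z using Finset.induction_on with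
  | empty =>
    intro f hf _ hz
    exact ⟨1, f, one_ne_zero, hf, fun z h => by simpa using hz z h, fun z => by simp⟩
  | insert z0 Z _ ih =>
    intro f hf hf0 hz
    have hfa : AnalyticOnNhd ℂ f Set.univ := fun z _ => hf.analyticAt z
    have hnot : ¬ ∀ᶠ z in 𝓝 z0, f z = 0 := by
      intro h
      apply hf0
      funext z
      exact hfa.eqOn_zero_of_preconnected_of_eventuallyEq_zero isPreconnected_univ
        (Set.mem_univ z0) h (Set.mem_univ z)
    obtain ⟨n, g0, hg0, hg00, hfg⟩ :=
      ((hf.analyticAt z0).exists_eventuallyEq_pow_smul_nonzero_iff).2 hnot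
    simp only [smul_eq_mul] at hfg
    set g : ℂ → ℂ := fun z => if z = z0 then g0 z0 else f z / (z - z0) ^ n with hg
    have hgz : ∀ z, z ≠ z0 → g z = f z / (z - z0) ^ n := fun z h => by simp [hg, h]
    have hfg' : ∀ z, f z = (z - z0) ^ n * g z := by
      intro z
      by_cases h : z = z0
      · subst h
        rw [hfg.self_of_nhds]; simp [hg]
      · rw [hgz z h, mul_div_cancel₀ _ (pow_ne_zero _ (sub_ne_zero.2 h))]
    have hgg0 : g =ᶠ[𝓝 z0] g0 := by
      filter_upwards [hfg] with z h
      by_cases hzz : z = z0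
      · subst hzz; simp [hg]
      · rw [hgz z hzz, h, mul_div_cancel_left₀ _ (pow_ne_zero _ (sub_ne_zero.2 hzz))]
    have hgd : Differentiable ℂ g := by
      intro z
      by_cases h : z = z0
      · subst h
        exact hgg0.symm.differentiableAt_iff.1 hg0.differentiableAt
      · have h1 : g =ᶠ[𝓝 z] fun z => f z / (z - z0) ^ n := by
          filter_upwards [isOpen_ne.mem_nhds h] with w hw
          exact hgz w hw
        rw [h1.differentiableAt_iff]
        exact (hf z).div (by fun_prop) (pow_ne_zero _ (sub_ne_zero.2 h))
    obtain ⟨p, k, hp, hk, hk0, hpk⟩ := ih g hgd (by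
      intro h
      apply hf0
      funext z
      rw [hfg' z, h]; simp) (by
      intro z h
      have h1 : f z = 0 := by rw [hfg' z, h, mul_zero]
      rcases Finset.mem_insert.1 (hz z h1) with h2 | h2
      · subst h2
        exact absurd (by simpa [hg] using h) hg00
      · exact h2)
    refine ⟨(Polynomial.X - Polynomial.C z0) ^ n * p, k, ?_, hk, hk0, fun z => ?_⟩
    · exact mul_ne_zero (pow_ne_zero _ (Polynomial.X_sub_C_ne_zero z0)) hp
    · rw [hfg' z, hpk z]; simp [mul_assoc]

/-- A zero-free entire function has an entire logarithm. -/
lemma exists_entire_log {g : ℂ → ℂ} (hg : Differentiable ℂ g) (h0 : ∀ z, g z ≠ 0) :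
    ∃ h : ℂ → ℂ, Differentiable ℂ h ∧ ∀ z, g z = Complex.exp (h z) := by
  have hd : Differentiable ℂ (deriv g) := fun z => ((hg.analyticAt z).deriv).differentiableAt
  obtain ⟨k, hk⟩ := (hd.div hg h0).isExactOn_univ
  have hk' : ∀ z, HasDerivAt k (deriv g z / g z) z := fun z => hk z (Set.mem_univ z)
  have hconst : ∀ z, g z * Complex.exp (-k z) = g 0 * Complex.exp (-k 0) := by
    intro z
    refine is_const_of_deriv_eq_zero (f := fun z => g z * Complex.exp (-k z)) ?_ ?_ z 0
    · intro z
      exact ((hg z).mul ((hk' z).neg.cexp).differentiableAt)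
    · intro z
      have h1 := ((hg z).hasDerivAt.mul ((hk' z).neg.cexp)).deriv
      refine Eq.trans h1 ?_
      have := h0 z
      field_simp
      ring
  refine ⟨fun z => k z + (Complex.log (g 0) - k 0), fun z =>
    ((hk' z).differentiableAt).add_const _, fun z => ?_⟩
  have h1 := hconst z
  have h2 : g z = g 0 * Complex.exp (-k 0) * Complex.exp (k z) := by
    rw [← h1, mul_assoc, ← Complex.exp_add]; simp
  rw [h2]
  rw [sub_eq_add_neg, Complex.exp_add, Complex.exp_add, Complex.exp_log (h0 0)]
  ring

/-- An entire function whose real part grows slower than linearly is constant. -/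
lemma entire_const_of_re_le {h : ℂ → ℂ} (hh : Differentiable ℂ h) {C s : ℝ} (hC : 0 < C)
    (hs : s < 1) (hre : ∀ R ≥ 1, ∀ z, ‖z‖ ≤ R → (h z).re ≤ C * R ^ s) (z : ℂ) : h z = h 0 := by
  refine is_const_of_deriv_eq_zero hh (fun w => ?_) z 0
  have hb : ∀ᶠ R : ℝ in atTop, ‖deriv h w‖ ≤
      (2 * (C * (3 * R) ^ s) * 2 + ‖h 0‖ * 5) / R := by
    filter_upwards [eventually_ge_atTop (max 1 (‖w‖ + 1))] with R hR
    have hR1 : 1 ≤ R := (le_max_left _ _).trans hR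
    have hRw : ‖w‖ + 1 ≤ R := (le_max_right _ _).trans hR
    refine norm_deriv_le_of_forall_mem_sphere_norm_le (by linarith) hh.diffContOnCl
      fun z hz => ?_
    have hz2 : ‖z‖ ≤ 2 * R := by
      have : ‖z - w‖ = R := by simpa [dist_eq_norm] using hz
      calc ‖z‖ = ‖(z - w) + w‖ := by ring_nf
        _ ≤ _ := norm_add_le _ _
        _ ≤ 2 * R := by linarith
    have hM : 0 < C * (3 * R) ^ s := by positivity
    refine (Complex.borelCaratheodory hM (f := h) (R := 3 * R) hh.differentiableOn ?_
      (by linarith) (by rw [mem_ball_zero_iff]; linarith)).trans ?_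
    · intro x hx
      rw [mem_ball_zero_iff] at hx
      exact hre (3 * R) (by linarith) x hx.le
    · have h1 : R ≤ 3 * R - ‖z‖ := by linarith
      have h3 : 2 * (C * (3 * R) ^ s) * ‖z‖ / (3 * R - ‖z‖) ≤ 2 * (C * (3 * R) ^ s) * 2 := by
        rw [div_le_iff₀ (by linarith)]
        have : ‖z‖ ≤ 2 * (3 * R - ‖z‖) := by linarith
        rw [mul_assoc (2 * (C * (3 * R) ^ s))]
        gcongr
      have h4 : ‖h 0‖ * (3 * R + ‖z‖) / (3 * R - ‖z‖) ≤ ‖h 0‖ * 5 := by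
        rw [div_le_iff₀ (by linarith), mul_assoc]
        gcongr
        linarith
      linarith
  have hlim : Tendsto (fun R : ℝ => (2 * (C * (3 * R) ^ s) * 2 + ‖h 0‖ * 5) / R) atTop (𝓝 0) := by
    have h1 : Tendsto (fun R : ℝ => 4 * C * 3 ^ s * R ^ (-(1 - s)) + ‖h 0‖ * 5 * R⁻¹)
        atTop (𝓝 (4 * C * 3 ^ s * 0 + ‖h 0‖ * 5 * 0)) :=
      ((tendsto_rpow_neg_atTop (by linarith)).const_mul _).add
        (tendsto_inv_atTop_zero.const_mul _)
    simp only [mul_zero, add_zero] at h1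
    refine h1.congr' ?_
    filter_upwards [eventually_gt_atTop 0] with R hR
    rw [Real.mul_rpow (by norm_num) hR.le, show -(1 - s) = s - 1 by ring,
      Real.rpow_sub_one hR.ne']
    field_simp
    ring
  exact norm_le_zero_iff.1 (ge_of_tendsto hlim hb)

/-- A power series of growth order less than one with only finitely many zeros terminates. -/
theorem exists_coeff_eq_zero {a : ℕ → ℂ} (ha0 : a 0 = 1) {C s : ℝ} (hC : 0 ≤ C) (hs0 : 0 < s)
    (hs : s < 1) (hb : ∀ n, ∀ R > 0, ‖a n‖ * R ^ n ≤ Real.exp (C * R ^ s))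
    (hfin : {z : ℂ | ∑' n, a n * z ^ n = 0}.Finite) : ∃ n, a n = 0 := by
  by_contra! hne
  have hb' : ∀ R > 0, ∃ B : ℝ, ∀ n, ‖a n‖ * R ^ n ≤ B := fun R hR => ⟨_, fun n => hb n R hR⟩
  set f : ℂ → ℂ := fun z => ∑' n, a n * z ^ n with hf
  have hfd : Differentiable ℂ f := differentiable_tsum_coeff hb'
  have hf0 : f ≠ 0 := by
    intro h
    have h1 : f 0 = 1 := by
      rw [hf]
      simp only
      rw [tsum_eq_single 0 (fun n hn => by simp [hn])]
      simp [ha0]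
    rw [h] at h1
    simp at h1
  obtain ⟨p, g, hp, hg, hg0, hfg⟩ := exists_polynomial_mul_of_finite_zeros hfin.toFinset f hfd hf0
    (fun z hz => by simpa using hz)
  obtain ⟨h, hh, hgh⟩ := exists_entire_log hg hg0
  have hfb : ∀ R ≥ 1, ∀ z : ℂ, ‖z‖ ≤ R → ‖f z‖ ≤ 2 * Real.exp (C * (2 * R) ^ s) := by
    intro R hR z hz
    have h1 : ∀ n, ‖a n * z ^ n‖ ≤ Real.exp (C * (2 * R) ^ s) * (1 / 2) ^ n := by
      intro n
      have h2 := hb n (2 * R) (by linarith)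
      rw [norm_mul, norm_pow]
      have h3 : ‖z‖ ^ n ≤ R ^ n := by gcongr
      rw [mul_pow] at h2
      have h4 : ‖a n‖ * R ^ n ≤ Real.exp (C * (2 * R) ^ s) * (1 / 2) ^ n := by
        rw [one_div, inv_pow, ← div_eq_mul_inv, le_div_iff₀ (by positivity)]
        linarith
      exact (mul_le_mul_of_nonneg_left h3 (norm_nonneg _)).trans h4
    have h5 := tsum_of_norm_bounded (summable_geometric_two.hasSum.mul_left
      (Real.exp (C * (2 * R) ^ s))) h1
    rw [tsum_geometric_two] at h5
    linarith
  -- the zero-free factor is bounded on large circles, hence everywhere by the maximum principle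
  have hpl : ∃ (c R0 : ℝ), 0 < c ∧ 1 ≤ R0 ∧ ∀ z : ℂ, R0 ≤ ‖z‖ → c ≤ ‖p.eval z‖ := by
    by_cases hdeg : 0 < p.degree
    · have h1 := p.tendsto_norm_atTop hdeg (l := comap norm atTop) (z := id) tendsto_comap
      have h2 := h1.eventually (eventually_ge_atTop 1)
      rw [eventually_comap] at h2
      obtain ⟨R0, hR0⟩ := h2.exists_forall_of_atTop
      exact ⟨1, max R0 1, one_pos, le_max_right _ _, fun z hz =>
        hR0 ‖z‖ ((le_max_left _ _).trans hz) z rfl⟩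
    · have h1 := Polynomial.eq_C_of_degree_le_zero (not_lt.1 hdeg)
      refine ⟨‖p.coeff 0‖, 1, ?_, le_rfl, fun z _ => ?_⟩
      · rw [norm_pos_iff]
        intro h0
        rw [h0] at h1
        exact hp (by simpa using h1)
      · rw [h1]; simp
  obtain ⟨c, R0, hc, hR0, hcp⟩ := hpl
  have hgb : ∀ R ≥ R0, ∀ z : ℂ, ‖z‖ ≤ R → ‖g z‖ ≤ 2 * Real.exp (C * (2 * R) ^ s) / c := by
    intro R hR z hz
    have hRpos : 0 < R := by linarith
    refine Complex.norm_le_of_forall_mem_frontier_norm_le (U := ball 0 R) isBounded_ball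
      hg.diffContOnCl (fun w hw => ?_) (by rw [closure_ball _ hRpos.ne']; simpa using hz)
    rw [frontier_ball _ hRpos.ne', mem_sphere_zero_iff_norm] at hw
    rw [le_div_iff₀ hc]
    have h1 := hfb R (by linarith) w hw.le
    rw [hfg w, norm_mul] at h1
    have h2 := hcp w (by linarith)
    calc ‖g w‖ * c ≤ ‖g w‖ * ‖p.eval w‖ := by gcongr
      _ ≤ _ := by linarith
  set C1 : ℝ := C * (2 * R0) ^ s + |Real.log (2 / c)| + 1 with hC1
  have hR0pos : 0 < R0 := by linarith
  have hC1pos : 0 < C1 := by positivity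
  have hconst := entire_const_of_re_le hh hC1pos hs (fun R hR z hz => by
    have h1 := hgb (R0 * R) (by nlinarith) z (by nlinarith)
    rw [hgh z, Complex.norm_exp] at h1
    have h2 : 2 * Real.exp (C * (2 * (R0 * R)) ^ s) / c =
        Real.exp (Real.log (2 / c) + C * (2 * (R0 * R)) ^ s) := by
      rw [Real.exp_add, Real.exp_log (by positivity)]; ring
    rw [h2, Real.exp_le_exp] at h1
    have h3 : (2 * (R0 * R)) ^ s = (2 * R0) ^ s * R ^ s := by
      rw [← mul_assoc, Real.mul_rpow (by positivity) (by positivity)]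
    have h4 : 1 ≤ R ^ s := Real.one_le_rpow hR hs0.le
    rw [h3] at h1
    have h5 := le_abs_self (Real.log (2 / c))
    have h6 := abs_nonneg (Real.log (2 / c))
    rw [hC1]
    nlinarith)
  -- `f` is a polynomial
  have hfp : ∀ z, f z = (Polynomial.C (g 0) * p).eval z := by
    intro z
    rw [hfg z, hgh z, hconst z, ← hgh 0]; simp [mul_comm]
  set P := Polynomial.C (g 0) * p with hP
  have hz := coeff_eq_zero_of_hasSum_zero (fun n => a n - P.coeff n) (fun z => by
    have h1 : HasSum (fun n => a n * z ^ n) (f z) :=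
      (summable_coeff_mul_pow hb' z).of_norm.hasSum
    have h2 : HasSum (fun n => P.coeff n * z ^ n) (P.eval z) := by
      rw [Polynomial.eval_eq_sum_range]
      refine hasSum_sum_of_ne_finset_zero fun n hn => ?_
      rw [Polynomial.coeff_eq_zero_of_natDegree_lt (by simpa [Nat.lt_succ_iff] using hn), zero_mul]
    have h3 := h1.sub h2
    rw [hfp z, sub_self] at h3
    simpa [sub_mul] using h3)
  have h1 := congrFun hz (P.natDegree + 1)
  simp only [Pi.zero_apply] at h1
  rw [Polynomial.coeff_eq_zero_of_natDegree_lt (Nat.lt_succ_self _), sub_zero] at h1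
  exact hne _ h1

end EntireFunctions

/-- The power series coefficients `e n` determined by `e 0 = 1` and Newton's recursion
`(n+1) e (n+1) = -∑ e i τ (n+1-i)`. -/
def fredCoeff (τ : ℕ → ℂ) : ℕ → ℂ
  | 0 => 1
  | n + 1 => -(∑ i : Fin (n + 1), fredCoeff τ i * τ (n + 1 - i)) / (n + 1)

lemma fredCoeff_zero (τ : ℕ → ℂ) : fredCoeff τ 0 = 1 := by rw [fredCoeff]

lemma fredCoeff_succ (τ : ℕ → ℂ) (n : ℕ) :
    ((n : ℂ) + 1) * fredCoeff τ (n + 1) =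
      -∑ i ∈ Finset.range (n + 1), fredCoeff τ i * τ (n + 1 - i) := by
  rw [fredCoeff, ← Finset.sum_range (fun i => fredCoeff τ i * τ (n + 1 - i))]
  have : (n : ℂ) + 1 ≠ 0 := by exact_mod_cast Nat.succ_ne_zero n
  field_simp

lemma eq_fredCoeff {e τ : ℕ → ℂ} (h0 : e 0 = 1) (h : ∀ n : ℕ, ((n : ℂ) + 1) * e (n + 1) =
    -∑ i ∈ Finset.range (n + 1), e i * τ (n + 1 - i)) : e = fredCoeff τ := by
  funext n
  induction n using Nat.strong_induction_on with
  | _ n ih =>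
    cases n with
    | zero => rw [h0, fredCoeff_zero]
    | succ n =>
      have hn : (n : ℂ) + 1 ≠ 0 := by exact_mod_cast Nat.succ_ne_zero n
      apply mul_left_cancel₀ hn
      rw [h, fredCoeff_succ]
      congr 1
      exact Finset.sum_congr rfl fun i hi => by rw [ih i (Finset.mem_range.1 hi)]

section FiniteMatrices

open Polynomial Matrix

variable {m : Type*} [Fintype m] [DecidableEq m]

/-- The determinant is bounded by the product of the row sums. -/
lemma norm_det_le_prod (N : Matrix m m ℂ) : ‖N.det‖ ≤ ∏ i, ∑ j, ‖N i j‖ := by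
  rw [← Matrix.det_transpose, Matrix.det_apply, Finset.prod_univ_sum]
  refine (norm_sum_le _ _).trans ?_
  have h1 : ∀ σ : Equiv.Perm m, ‖Equiv.Perm.sign σ • ∏ i, Nᵀ (σ i) i‖ = ∏ i, ‖N i (σ i)‖ := by
    intro σ
    rcases Int.units_eq_one_or (Equiv.Perm.sign σ) with h | h <;> simp [h, norm_prod]
  rw [Finset.sum_congr rfl fun σ _ => h1 σ]
  rw [← Finset.sum_image (f := fun g : m → m => ∏ i, ‖N i (g i)‖)
    (g := fun σ : Equiv.Perm m => (σ : m → m)) (fun a _ b _ h => DFunLike.coe_injective h)]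
  refine Finset.sum_le_sum_of_subset_of_nonneg (fun g _ => by simp) fun g _ _ => ?_
  positivity

/-- Cauchy's estimate for the coefficients of a polynomial. -/
lemma norm_coeff_mul_pow_le (p : ℂ[X]) {R B : ℝ} (hR : 0 < R)
    (h : ∀ z : ℂ, ‖z‖ = R → ‖p.eval z‖ ≤ B) (n : ℕ) : ‖p.coeff n‖ * R ^ n ≤ B := by
  have h1 : ∀ k (q : ℂ[X]), iteratedDeriv k (fun z => q.eval z) =
      fun z => (derivative^[k] q).eval z := by
    intro k
    induction k with
    | zero => intro q; simp
    | succ k ih =>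
      intro q
      rw [iteratedDeriv_succ']
      have : deriv (fun z => q.eval z) = fun z => (derivative q).eval z := by
        funext z; exact q.deriv
      rw [this, ih, Function.iterate_succ_apply]
  have h2 := Complex.norm_iteratedDeriv_le_of_forall_mem_sphere_norm_le (f := fun z => p.eval z)
    (c := 0) n hR (p.differentiable.diffContOnCl) (C := B) (fun z hz => h z (by simpa using hz))
  rw [h1 n p] at h2
  simp only [← coeff_zero_eq_eval_zero, coeff_iterate_derivative, zero_add,
    Nat.descFactorial_self, nsmul_eq_mul, norm_mul, Complex.norm_natCast] at h2
  rw [mul_div_assoc] at h2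
  have h3 := le_of_mul_le_mul_left h2 (by positivity)
  rwa [le_div_iff₀ (by positivity)] at h3

/-- The polynomial matrix `1 - X M`. -/
def oneSubX (M : Matrix m m ℂ) : Matrix m m ℂ[X] := 1 - (X : ℂ[X]) • M.map C

lemma map_eval_oneSubX (M : Matrix m m ℂ) (z : ℂ) :
    (oneSubX M).map (eval z) = 1 - z • M := by
  ext i j
  simp [oneSubX, Matrix.one_apply, apply_ite, mul_comm (M i j)]

lemma eval_det_oneSubX (M : Matrix m m ℂ) (z : ℂ) :
    (oneSubX M).det.eval z = (1 - z • M).det := by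
  rw [← map_eval_oneSubX, ← coe_evalRingHom, RingHom.map_det]
  rfl

lemma eval_adjugate_oneSubX (M : Matrix m m ℂ) (z : ℂ) (i j : m) :
    ((oneSubX M).adjugate i j).eval z = (1 - z • M).adjugate i j := by
  rw [← map_eval_oneSubX, ← coe_evalRingHom]
  have := (evalRingHom z).map_adjugate (oneSubX M)
  exact congrFun (congrFun this i) j

/-- Jacobi's formula for `det (1 - X M)`. -/
lemma derivative_det_oneSubX (M : Matrix m m ℂ) :
    derivative (oneSubX M).det = -((oneSubX M).adjugate * M.map C).trace := by
  have hf0 : (oneSubX M).det ≠ 0 := by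
    intro h
    have := eval_det_oneSubX M 0
    rw [h] at this
    simp at this
  have key : (oneSubX M).det *
      (derivative (oneSubX M).det + ((oneSubX M).adjugate * M.map C).trace) = 0 := by
    apply Polynomial.funext
    intro z
    rw [eval_mul, eval_zero, mul_eq_zero]
    by_cases hz : (oneSubX M).det.eval z = 0
    · exact Or.inl hz
    right
    have hz' : (1 - z • M).det ≠ 0 := by rwa [← eval_det_oneSubX]
    have hu : IsUnit (1 - z • M).det := isUnit_iff_ne_zero.2 hz'
    set N := (1 - z • M)⁻¹ * M with hN
    have h1 : (oneSubX M).det.comp (X + C z) =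
        C ((1 - z • M).det) * (1 + (X : ℂ[X]) • (-N).map C).det := by
      apply Polynomial.funext
      intro y
      rw [eval_comp, eval_det_oneSubX, eval_mul, eval_C]
      have h2 : (1 + (X : ℂ[X]) • (-N).map C).det.eval y = (1 + y • (-N)).det := by
        rw [← coe_evalRingHom, RingHom.map_det]
        congr 1
        ext i j
        simp [Matrix.one_apply, apply_ite, mul_comm (N i j)]
      rw [h2, ← det_mul]
      congr 1
      rw [mul_add, mul_one, smul_neg, mul_neg, mul_smul_comm, hN, ← mul_assoc, mul_nonsing_inv _ hu,
        one_mul]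
      simp only [eval_add, eval_X, eval_C, add_smul]
      abel
    have h2 := congrArg (fun p => eval 0 (derivative p)) h1
    simp only [derivative_comp, derivative_add, derivative_X, derivative_C, add_zero, one_mul,
      eval_comp, eval_add, eval_X, eval_C, zero_add, derivative_C_mul, eval_mul] at h2
    rw [derivative_det_one_add_X_smul] at h2
    rw [eval_add, h2]
    have h3 : ((oneSubX M).adjugate * M.map C).trace.eval z =
        ((1 - z • M).adjugate * M).trace := by
      simp only [trace, diag_apply, mul_apply, eval_finsetSum, eval_mul, eval_adjugate_oneSubX,
        map_apply, eval_C]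
    rw [h3, trace_neg, hN, Matrix.inv_def, smul_mul_assoc, trace_smul, Ring.inverse_eq_inv', smul_eq_mul]
    field_simp
    simp
  have := (mul_eq_zero.1 key).resolve_left hf0
  exact eq_neg_of_add_eq_zero_left this

/-- Coefficients of the characteristic series of a finite matrix. -/
def detCoeff (M : Matrix m m ℂ) (n : ℕ) : ℂ := (oneSubX M).det.coeff n

lemma detCoeff_zero (M : Matrix m m ℂ) : detCoeff M 0 = 1 := by
  rw [detCoeff, coeff_zero_eq_eval_zero, eval_det_oneSubX]; simp

lemma coeff_adjugate_oneSubX (M : Matrix m m ℂ) (n : ℕ) :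
    (Matrix.of fun i j => ((oneSubX M).adjugate i j).coeff n) =
      ∑ k ∈ Finset.range (n + 1), detCoeff M k • M ^ (n - k) := by
  have h := adjugate_mul (oneSubX M)
  have hc : ∀ n i j, (((oneSubX M).adjugate i j).coeff (n + 1)) =
      ∑ l, ((oneSubX M).adjugate i l).coeff n * M l j + detCoeff M (n + 1) * (1 : Matrix m m ℂ) i j := by
    intro n i j
    have h1 := congrArg (fun p => p.coeff (n + 1)) (congrFun (congrFun h i) j)
    rw [oneSubX, mul_sub, mul_one] at h1
    simp only [Matrix.sub_apply, Matrix.mul_smul, Matrix.smul_apply, smul_eq_mul, coeff_sub, coeff_X_mul, mul_apply,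
      finsetSum_coeff, map_apply, coeff_mul_C] at h1
    have h2 : (((1 - (X : ℂ[X]) • M.map C).det * (1 : Matrix m m ℂ[X]) i j).coeff (n + 1)) =
        detCoeff M (n + 1) * (1 : Matrix m m ℂ) i j := by
      by_cases hij : i = j
      · subst hij; simp [detCoeff, oneSubX]
      · simp [hij]
    rw [h2] at h1
    rw [← h1, oneSubX]; ring
  induction n with
  | zero =>
    ext i j
    have h1 := eval_adjugate_oneSubX M 0 i j
    simp only [zero_smul, sub_zero, adjugate_one] at h1
    simp [coeff_zero_eq_eval_zero, h1, detCoeff_zero]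
  | succ n ih =>
    ext i j
    rw [of_apply, hc, Finset.sum_range_succ]
    simp only [Nat.sub_self, pow_zero, Matrix.add_apply, Matrix.smul_apply, smul_eq_mul]
    congr 1
    have h1 : ∑ l, ((oneSubX M).adjugate i l).coeff n * M l j =
        ((Matrix.of fun i j => ((oneSubX M).adjugate i j).coeff n) * M) i j := by
      simp [mul_apply]
    have h2 : (∑ k ∈ Finset.range (n + 1), detCoeff M k • M ^ (n - k)) * M =
        ∑ k ∈ Finset.range (n + 1), detCoeff M k • M ^ (n + 1 - k) := by
      rw [Finset.sum_mul]
      refine Finset.sum_congr rfl fun k hk => ?_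
      have : n + 1 - k = (n - k) + 1 := by
        have := Finset.mem_range.1 hk; omega
      rw [this, pow_succ, smul_mul_assoc]
    rw [h1, ih, h2]

/-- Newton's identities for a finite matrix. -/
lemma detCoeff_eq_fredCoeff (M : Matrix m m ℂ) :
    detCoeff M = fredCoeff fun k => (M ^ k).trace := by
  refine eq_fredCoeff (detCoeff_zero M) fun n => ?_
  have h := congrArg (fun p => p.coeff n) (derivative_det_oneSubX M)
  simp only [coeff_derivative, coeff_neg] at h
  rw [detCoeff, mul_comm, h]
  congr 1
  have h1 : ((oneSubX M).adjugate * M.map C).trace.coeff n =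
      ((Matrix.of fun i j => ((oneSubX M).adjugate i j).coeff n) * M).trace := by
    simp [trace, mul_apply, finsetSum_coeff, coeff_mul_C]
  rw [h1, coeff_adjugate_oneSubX, Finset.sum_mul, trace_sum]
  refine Finset.sum_congr rfl fun k hk => ?_
  have : n + 1 - k = (n - k) + 1 := by
    have := Finset.mem_range.1 hk; omega
  rw [smul_mul_assoc, trace_smul, ← pow_succ, this, smul_eq_mul]

lemma norm_detCoeff_le (M : Matrix m m ℂ) {ρ : m → ℝ} (hρ : ∀ i, ∑ j, ‖M i j‖ ≤ ρ i)
    {R : ℝ} (hR : 0 < R) (n : ℕ) : ‖detCoeff M n‖ * R ^ n ≤ ∏ i, (1 + R * ρ i) := by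
  refine norm_coeff_mul_pow_le _ hR (fun z hz => ?_) n
  rw [eval_det_oneSubX]
  refine (norm_det_le_prod _).trans ?_
  refine Finset.prod_le_prod (fun i _ => Finset.sum_nonneg fun j _ => norm_nonneg _) fun i _ => ?_
  calc ∑ j, ‖(1 - z • M) i j‖ ≤ ∑ j, (‖(1 : Matrix m m ℂ) i j‖ + R * ‖M i j‖) := by
        refine Finset.sum_le_sum fun j _ => ?_
        refine (norm_sub_le _ _).trans ?_
        rw [Matrix.smul_apply, smul_eq_mul, norm_mul, hz]
    _ = 1 + R * ∑ j, ‖M i j‖ := by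
        rw [Finset.sum_add_distrib, ← Finset.mul_sum]
        congr 1
        rw [Finset.sum_eq_single i (fun j _ h => by simp [h.symm]) (by simp)]
        simp
    _ ≤ _ := by gcongr; exact hρ i

lemma norm_adjCoeff_le (M : Matrix m m ℂ) {ρ : m → ℝ} (hρ : ∀ i, ∑ j, ‖M i j‖ ≤ ρ i)
    {R : ℝ} (hR : 0 < R) (n : ℕ) (i j : m) :
    ‖(∑ k ∈ Finset.range (n + 1), detCoeff M k • M ^ (n - k)) i j‖ * R ^ n ≤
      ∏ i, (1 + R * ρ i) := by
  rw [← coeff_adjugate_oneSubX, of_apply]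
  refine norm_coeff_mul_pow_le _ hR (fun z hz => ?_) n
  rw [eval_adjugate_oneSubX, adjugate_apply]
  refine (norm_det_le_prod _).trans ?_
  refine Finset.prod_le_prod (fun i _ => Finset.sum_nonneg fun j _ => norm_nonneg _) fun l _ => ?_
  have hρ0 : 0 ≤ ρ l := (Finset.sum_nonneg fun j _ => norm_nonneg _).trans (hρ l)
  by_cases hl : l = j
  · subst hl
    simp only [updateRow_self]
    rw [Finset.sum_eq_single i (fun j _ h => by simp [h]) (by simp)]
    simp
    positivity
  · simp only [updateRow_ne hl]
    calc ∑ j, ‖(1 - z • M) l j‖ ≤ ∑ j, (‖(1 : Matrix m m ℂ) l j‖ + R * ‖M l j‖) := by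
          refine Finset.sum_le_sum fun j _ => ?_
          refine (norm_sub_le _ _).trans ?_
          rw [Matrix.smul_apply, smul_eq_mul, norm_mul, hz]
      _ = 1 + R * ∑ j, ‖M l j‖ := by
          rw [Finset.sum_add_distrib, ← Finset.mul_sum]
          congr 1
          rw [Finset.sum_eq_single l (fun j _ h => by simp [h.symm]) (by simp)]
          simp
      _ ≤ _ := by gcongr; exact hρ l

end FiniteMatrices

section Fredholm

open Filter Topology

variable {ι : Type*} [DecidableEq ι]

/-- Entries of the powers of a row-finite infinite matrix. -/
def kpow (a : ι → ι → ℂ) (S : ι → Finset ι) : ℕ → ι → ι → ℂ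
  | 0 => fun i j => if i = j then 1 else 0
  | k + 1 => fun i j => ∑ l ∈ S i, a i l * kpow a S k l j

/-- A row-finite matrix whose row sums are bounded by a summable sequence. -/
structure IsFredKernel (a : ι → ι → ℂ) (S : ι → Finset ι) (ρ : ι → ℝ) (s : ℝ) : Prop where
  supp : ∀ i j, a i j ≠ 0 → j ∈ S i
  row : ∀ i, ∑ j ∈ S i, ‖a i j‖ ≤ ρ i
  summable : Summable ρ
  s_pos : 0 < s
  s_lt : s < 1
  summable_rpow : Summable fun i => ρ i ^ s

/-- The trace of the `k`-th power. -/
def ktr (a : ι → ι → ℂ) (S : ι → Finset ι) (k : ℕ) : ℂ := ∑' i, kpow a S k i i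

/-- The coefficients of the Fredholm determinant. -/
def kdet (a : ι → ι → ℂ) (S : ι → Finset ι) : ℕ → ℂ := fredCoeff (ktr a S)

/-- The coefficients of the Fredholm adjugate. -/
def kadj (a : ι → ι → ℂ) (S : ι → Finset ι) (n : ℕ) (i j : ι) : ℂ :=
  ∑ k ∈ Finset.range (n + 1), kdet a S k * kpow a S (n - k) i j

/-- Restriction of an infinite matrix to a finite set. -/
def ktrunc (a : ι → ι → ℂ) (F : Finset ι) : Matrix F F ℂ := Matrix.of fun i j => a i j

lemma one_add_le_exp_rpow {x s : ℝ} (hx : 0 ≤ x) (hs : 0 < s) (hs1 : s < 1) :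
    1 + x ≤ Real.exp (x ^ s / s) := by
  have h1 : (1 + x) ^ s ≤ 1 + x ^ s := by
    simpa using Real.rpow_add_le_add_rpow (zero_le_one) hx hs.le hs1.le
  have h2 : (1 + x) ^ s ≤ Real.exp (x ^ s) :=
    h1.trans (by rw [add_comm]; exact Real.add_one_le_exp _)
  have h3 : ((1 + x) ^ s) ^ s⁻¹ ≤ (Real.exp (x ^ s)) ^ s⁻¹ :=
    Real.rpow_le_rpow (by positivity) h2 (by positivity)
  rwa [← Real.rpow_mul (by positivity), mul_inv_cancel₀ hs.ne', Real.rpow_one, ← Real.exp_mul,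
    ← div_eq_mul_inv] at h3

lemma tendsto_fredCoeff {β : Type*} {l : Filter β} {τ' : β → ℕ → ℂ} {τ : ℕ → ℂ}
    (h : ∀ k, 0 < k → Tendsto (fun b => τ' b k) l (𝓝 (τ k))) (n : ℕ) :
    Tendsto (fun b => fredCoeff (τ' b) n) l (𝓝 (fredCoeff τ n)) := by
  induction n using Nat.strong_induction_on with
  | _ n ih =>
    cases n with
    | zero => simp only [fredCoeff_zero]; exact tendsto_const_nhds
    | succ n =>
      simp only [fredCoeff]
      refine Tendsto.div_const (Tendsto.neg ?_) _
      refine tendsto_finsetSum _ fun i _ => (ih i i.2).mul (h _ ?_)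
      have := i.2; omega

namespace IsFredKernel

variable {a : ι → ι → ℂ} {S : ι → Finset ι} {ρ : ι → ℝ} {s : ℝ}

lemma nonneg (h : IsFredKernel a S ρ s) (i : ι) : 0 ≤ ρ i :=
  (Finset.sum_nonneg fun _ _ => norm_nonneg _).trans (h.row i)

lemma le_tsum (h : IsFredKernel a S ρ s) (i : ι) : ρ i ≤ ∑' j, ρ j :=
  h.summable.le_tsum i fun j _ => h.nonneg j

lemma row_trunc (h : IsFredKernel a S ρ s) (F : Finset ι) (i : F) :
    ∑ j, ‖ktrunc a F i j‖ ≤ ρ i := by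
  refine le_trans ?_ (h.row i)
  rw [show ∑ j, ‖ktrunc a F i j‖ = ∑ j ∈ F, ‖a i j‖ from
    (Finset.sum_coe_sort F fun j => ‖a i j‖)]
  calc ∑ j ∈ F, ‖a i j‖ = ∑ j ∈ F ∩ S i, ‖a i j‖ := by
        symm
        refine Finset.sum_subset Finset.inter_subset_left fun j hj hj' => ?_
        by_contra hne
        exact hj' (Finset.mem_inter.2 ⟨hj, h.supp i j (by simpa using hne)⟩)
    _ ≤ _ := Finset.sum_le_sum_of_subset_of_nonneg Finset.inter_subset_right
        fun _ _ _ => norm_nonneg _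

lemma norm_trunc_pow_le (h : IsFredKernel a S ρ s) (F : Finset ι) (k : ℕ) (i j : F) :
    ‖(ktrunc a F ^ k) i j‖ ≤ (∑' l, ρ l) ^ k := by
  induction k generalizing i with
  | zero => by_cases hij : i = j <;> simp [hij]
  | succ k ih =>
    rw [pow_succ', Matrix.mul_apply]
    calc _ ≤ ∑ l, ‖ktrunc a F i l‖ * (∑' l, ρ l) ^ k := by
          refine (norm_sum_le _ _).trans (Finset.sum_le_sum fun l _ => ?_)
          rw [norm_mul]
          gcongr
          exact ih l
      _ = (∑ l, ‖ktrunc a F i l‖) * (∑' l, ρ l) ^ k := by rw [Finset.sum_mul]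
      _ ≤ (∑' l, ρ l) * (∑' l, ρ l) ^ k := by
          have : 0 ≤ ∑' l, ρ l := tsum_nonneg h.nonneg
          gcongr
          exact (h.row_trunc F i).trans (h.le_tsum i)
      _ = _ := by rw [pow_succ']

lemma norm_trunc_pow_succ_le (h : IsFredKernel a S ρ s) (F : Finset ι) (k : ℕ) (i j : F) :
    ‖(ktrunc a F ^ (k + 1)) i j‖ ≤ ρ i * (∑' l, ρ l) ^ k := by
  rw [pow_succ', Matrix.mul_apply]
  calc _ ≤ ∑ l, ‖ktrunc a F i l‖ * (∑' l, ρ l) ^ k := by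
        refine (norm_sum_le _ _).trans (Finset.sum_le_sum fun l _ => ?_)
        rw [norm_mul]
        gcongr
        exact h.norm_trunc_pow_le F k l j
    _ = (∑ l, ‖ktrunc a F i l‖) * (∑' l, ρ l) ^ k := by rw [Finset.sum_mul]
    _ ≤ _ := by
        have : 0 ≤ ∑' l, ρ l := tsum_nonneg h.nonneg
        gcongr
        exact h.row_trunc F i

lemma eventually_trunc_pow (h : IsFredKernel a S ρ s) (k : ℕ) (i : ι) :
    ∀ᶠ F : Finset ι in atTop, ∀ (hi : i ∈ F) (j : ι) (hj : j ∈ F),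
      (ktrunc a F ^ k) ⟨i, hi⟩ ⟨j, hj⟩ = kpow a S k i j := by
  induction k generalizing i with
  | zero =>
    refine Eventually.of_forall fun F hi j hj => ?_
    simp [kpow, Matrix.one_apply]
  | succ k ih =>
    have h1 : ∀ᶠ F : Finset ι in atTop, ∀ l ∈ S i, ∀ (hi : l ∈ F) (j : ι) (hj : j ∈ F),
      (ktrunc a F ^ k) ⟨l, hi⟩ ⟨j, hj⟩ = kpow a S k l j :=
      (eventually_all_finset (S i)).2 fun l _ => ih l
    filter_upwards [h1, eventually_ge_atTop (S i)] with F hF hS hi j hj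
    rw [pow_succ', Matrix.mul_apply, kpow]
    symm
    refine Finset.sum_bij_ne_zero (fun l hl _ => (⟨l, hS hl⟩ : F)) (fun _ _ _ => Finset.mem_univ _)
      (fun x _ _ y _ _ hxy => by simpa using hxy) ?_ ?_
    · rintro ⟨l, hl⟩ - hne
      have hal : a i l ≠ 0 := by
        intro h0
        apply hne
        simp [ktrunc, h0]
      have hlS := h.supp i l hal
      refine ⟨l, hlS, ?_, rfl⟩
      rw [← hF l hlS hl j hj]
      exact hne
    · intro l hl _
      rw [hF l hl (hS hl) j hj]
      rfl

lemma tendsto_trace (h : IsFredKernel a S ρ s) (k : ℕ) (hk : 0 < k) :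
    Tendsto (fun F : Finset ι => (ktrunc a F ^ k).trace) atTop (𝓝 (ktr a S k)) := by
  classical
  obtain ⟨k, rfl⟩ : ∃ k', k = k' + 1 := ⟨k - 1, by omega⟩
  have h1 : ∀ F : Finset ι, (ktrunc a F ^ (k + 1)).trace =
      ∑' i, if hi : i ∈ F then (ktrunc a F ^ (k + 1)) ⟨i, hi⟩ ⟨i, hi⟩ else 0 := by
    intro F
    rw [tsum_eq_sum (s := F) (fun i hi => by simp [hi]), ← Finset.sum_coe_sort]
    simp [Matrix.trace]
  simp only [h1]
  refine tendsto_tsum_of_dominated_convergence (bound := fun i => ρ i * (∑' l, ρ l) ^ k)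
    (h.summable.mul_right _) ?_ ?_
  · intro i
    refine tendsto_const_nhds.congr' ?_
    filter_upwards [h.eventually_trunc_pow (k + 1) i, eventually_ge_atTop {i}] with F hF hi
    have hi' : i ∈ F := by simpa using hi
    rw [dif_pos hi', hF hi' i hi']
  · refine Eventually.of_forall fun F i => ?_
    split_ifs with hi
    · exact h.norm_trunc_pow_succ_le F k ⟨i, hi⟩ ⟨i, hi⟩
    · rw [norm_zero]
      exact mul_nonneg (h.nonneg i) (pow_nonneg (tsum_nonneg h.nonneg) _)

lemma tendsto_detCoeff (h : IsFredKernel a S ρ s) (n : ℕ) :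
    Tendsto (fun F : Finset ι => detCoeff (ktrunc a F) n) atTop (𝓝 (kdet a S n)) := by
  simp only [detCoeff_eq_fredCoeff]
  exact tendsto_fredCoeff (fun k hk => h.tendsto_trace k hk) n

lemma prod_le (h : IsFredKernel a S ρ s) {R : ℝ} (hR : 0 < R) (F : Finset ι) :
    ∏ i : F, (1 + R * ρ i) ≤ Real.exp ((∑' i, ρ i ^ s) / s * R ^ s) := by
  calc ∏ i : F, (1 + R * ρ i) ≤ ∏ i : F, Real.exp ((R * ρ i) ^ s / s) := by
        refine Finset.prod_le_prod (fun i _ => ?_) fun i _ =>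
          one_add_le_exp_rpow (mul_nonneg hR.le (h.nonneg i)) h.s_pos h.s_lt
        have := mul_nonneg hR.le (h.nonneg i)
        positivity
    _ = Real.exp ((∑ i ∈ F, ρ i ^ s) / s * R ^ s) := by
        rw [← Real.exp_sum, ← Finset.sum_coe_sort F, Finset.sum_div, Finset.sum_mul]
        congr 1
        refine Finset.sum_congr rfl fun i _ => ?_
        rw [Real.mul_rpow hR.le (h.nonneg i)]
        ring
    _ ≤ _ := by
        have := h.s_pos
        gcongr
        exact h.summable_rpow.sum_le_tsum _ fun i _ => Real.rpow_nonneg (h.nonneg i) _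

lemma norm_kdet_le (h : IsFredKernel a S ρ s) {R : ℝ} (hR : 0 < R) (n : ℕ) :
    ‖kdet a S n‖ * R ^ n ≤ Real.exp ((∑' i, ρ i ^ s) / s * R ^ s) := by
  have := ((h.tendsto_detCoeff n).norm.mul_const (R ^ n))
  refine le_of_tendsto this (Eventually.of_forall fun F => ?_)
  exact (norm_detCoeff_le _ (h.row_trunc F) hR n).trans (h.prod_le hR F)

lemma norm_kadj_le (h : IsFredKernel a S ρ s) {R : ℝ} (hR : 0 < R) (n : ℕ) (i j : ι) :
    ‖kadj a S n i j‖ * R ^ n ≤ Real.exp ((∑' i, ρ i ^ s) / s * R ^ s) := by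
  have h1 : Tendsto (fun F : Finset ι => ∑ k ∈ Finset.range (n + 1),
      detCoeff (ktrunc a F) k * kpow a S (n - k) i j) atTop (𝓝 (kadj a S n i j)) :=
    tendsto_finsetSum _ fun k _ => (h.tendsto_detCoeff k).mul_const _
  refine le_of_tendsto (h1.norm.mul_const (R ^ n)) ?_
  have h2 : ∀ᶠ F : Finset ι in atTop, ∀ k ∈ Finset.range (n + 1), ∀ (hi : i ∈ F) (j : ι)
      (hj : j ∈ F), (ktrunc a F ^ (n - k)) ⟨i, hi⟩ ⟨j, hj⟩ = kpow a S (n - k) i j :=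
    (eventually_all_finset _).2 fun k _ => h.eventually_trunc_pow (n - k) i
  filter_upwards [h2, eventually_ge_atTop {i, j}] with F hF hij
  have hi : i ∈ F := hij (by simp)
  have hj : j ∈ F := hij (by simp)
  refine le_trans (le_of_eq ?_) ((norm_adjCoeff_le _ (h.row_trunc F) hR n ⟨i, hi⟩ ⟨j, hj⟩).trans
    (h.prod_le hR F))
  congr 2
  rw [Matrix.sum_apply]
  refine Finset.sum_congr rfl fun k hk => ?_
  rw [Matrix.smul_apply, hF k hk hi j hj, smul_eq_mul]

lemma norm_kpow_succ_le (h : IsFredKernel a S ρ s) (k : ℕ) (i j : ι) :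
    ‖kpow a S (k + 1) i j‖ ≤ ρ i * (∑' l, ρ l) ^ k := by
  obtain ⟨F, hF, hij⟩ := ((h.eventually_trunc_pow (k + 1) i).and
    (eventually_ge_atTop {i, j})).exists
  have hi : i ∈ F := hij (by simp)
  have hj : j ∈ F := hij (by simp)
  rw [← hF hi j hj]
  exact h.norm_trunc_pow_succ_le F k ⟨i, hi⟩ ⟨j, hj⟩

lemma summable_kpow (h : IsFredKernel a S ρ s) (k : ℕ) :
    Summable fun i => kpow a S (k + 1) i i :=
  Summable.of_norm_bounded (h.summable.mul_right _) fun i => h.norm_kpow_succ_le k i i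

lemma kadj_zero (i j : ι) : kadj a S 0 i j = if i = j then 1 else 0 := by
  simp [kadj, kdet, fredCoeff_zero, kpow]

lemma sum_mul_kadj (n : ℕ) (i j : ι) : ∑ l ∈ S i, a i l * kadj a S n l j =
    ∑ k ∈ Finset.range (n + 1), kdet a S k * kpow a S (n + 1 - k) i j := by
  simp only [kadj, Finset.mul_sum]
  rw [Finset.sum_comm]
  refine Finset.sum_congr rfl fun k hk => ?_
  have : n + 1 - k = (n - k) + 1 := by
    have := Finset.mem_range.1 hk; omega
  rw [this, kpow, Finset.mul_sum]
  exact Finset.sum_congr rfl fun l _ => by ring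

lemma kadj_succ (n : ℕ) (i j : ι) : kadj a S (n + 1) i j =
    ∑ l ∈ S i, a i l * kadj a S n l j + kdet a S (n + 1) * if i = j then 1 else 0 := by
  rw [sum_mul_kadj, kadj, Finset.sum_range_succ]
  simp [kpow]

lemma succ_mul_kdet (h : IsFredKernel a S ρ s) (n : ℕ) :
    HasSum (fun i => ∑ l ∈ S i, a i l * kadj a S n l i) (-(((n : ℂ) + 1) * kdet a S (n + 1))) := by
  rw [kdet, fredCoeff_succ, neg_neg]
  simp only [sum_mul_kadj]
  refine hasSum_sum fun k hk => ?_
  have : n + 1 - k = (n - k) + 1 := by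
    have := Finset.mem_range.1 hk; omega
  rw [this]
  exact (h.summable_kpow (n - k)).hasSum.mul_left _

end IsFredKernel

end Fredholm

section Hasse

open Filter Topology

/-- Scaled Hasse derivatives of a power series. -/
def hasse (z : ℂ) (k : ℕ) (c : ℕ → ℂ) : ℂ := ∑' n, (n.choose k : ℂ) * z ^ n * c n

variable {z : ℂ} {c : ℕ → ℂ} {E : ℝ}

lemma norm_hasse_term_le (h : ∀ n, ‖c n‖ * (4 * ‖z‖) ^ n ≤ E) (k n : ℕ) :
    ‖(n.choose k : ℂ) * z ^ n * c n‖ ≤ E * (1 / 2) ^ n := by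
  have h1 : (n.choose k : ℝ) ≤ 2 ^ n := by exact_mod_cast Nat.choose_le_two_pow n k
  rw [norm_mul, norm_mul, norm_pow, Complex.norm_natCast]
  calc (n.choose k : ℝ) * ‖z‖ ^ n * ‖c n‖ ≤ 2 ^ n * ‖z‖ ^ n * ‖c n‖ := by gcongr
    _ = (‖c n‖ * (4 * ‖z‖) ^ n) * (1 / 2) ^ n := by
        rw [mul_pow, show (4 : ℝ) = 2 * 2 by norm_num, mul_pow, one_div, inv_pow]
        field_simp
    _ ≤ _ := by gcongr; exact h n

lemma hasSum_hasse (h : ∀ n, ‖c n‖ * (4 * ‖z‖) ^ n ≤ E) (k : ℕ) :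
    HasSum (fun n => (n.choose k : ℂ) * z ^ n * c n) (hasse z k c) :=
  (Summable.of_norm_bounded (summable_geometric_two.mul_left E)
    (norm_hasse_term_le h k)).hasSum

lemma norm_hasse_le (h : ∀ n, ‖c n‖ * (4 * ‖z‖) ^ n ≤ E) (k : ℕ) : ‖hasse z k c‖ ≤ E * 2 :=
  tsum_of_norm_bounded (hasSum_geometric_two.mul_left E) (norm_hasse_term_le h k)

lemma exists_hasse_ne_zero (h : ∀ n, ‖c n‖ * (4 * ‖z‖) ^ n ≤ E) (h0 : c 0 ≠ 0) :
    ∃ k, hasse z k c ≠ 0 := by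
  by_contra! hk
  apply h0
  have hs : Summable (Function.uncurry fun n k : ℕ => (n.choose k : ℂ) * z ^ n * c n * (-1) ^ k) := by
    rw [← summable_norm_iff]
    have hfin : ∀ n : ℕ, ∀ k ∉ Finset.range (n + 1),
        ‖(n.choose k : ℂ) * z ^ n * c n * (-1) ^ k‖ = 0 := by
      intro n k hk
      have : n < k := by simpa [Nat.lt_succ_iff] using hk
      simp [Nat.choose_eq_zero_of_lt this]
    refine (summable_prod_of_nonneg fun p => norm_nonneg _).2 ⟨fun n =>
      summable_of_ne_finset_zero (s := Finset.range (n + 1)) (hfin n), ?_⟩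
    refine Summable.of_nonneg_of_le (fun n => tsum_nonneg fun k => norm_nonneg _) (fun n => ?_)
      (summable_geometric_two.mul_left E)
    refine (tsum_eq_sum (hfin n)).trans_le ?_
    simp only [norm_mul, norm_pow, Complex.norm_natCast, norm_neg, norm_one,
      one_pow, mul_one]
    rw [← Finset.sum_mul, ← Finset.sum_mul, ← Nat.cast_sum, Nat.sum_range_choose]
    calc ((2 ^ n : ℕ) : ℝ) * ‖z‖ ^ n * ‖c n‖ = (‖c n‖ * (4 * ‖z‖) ^ n) * (1 / 2) ^ n := by
          rw [mul_pow, show (4 : ℝ) = 2 * 2 by norm_num, mul_pow, one_div, inv_pow]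
          push_cast
          field_simp
      _ ≤ _ := by gcongr; exact h n
  have h1 := hs.tsum_comm
  have h2 : ∀ n : ℕ, ∑' k : ℕ, (n.choose k : ℂ) * z ^ n * c n * (-1) ^ k =
      if n = 0 then c 0 else 0 := by
    intro n
    rw [tsum_eq_sum (s := Finset.range (n + 1))]
    · have := add_pow (-1 : ℂ) 1 n
      rw [neg_add_cancel] at this
      calc _ = z ^ n * c n * ∑ k ∈ Finset.range (n + 1), (-1 : ℂ) ^ k * 1 ^ (n - k) * n.choose k := by
            rw [Finset.mul_sum]
            exact Finset.sum_congr rfl fun k _ => by rw [one_pow]; ring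
        _ = _ := by
            rw [← this]
            split_ifs with hn
            · subst hn; simp
            · rw [zero_pow hn, mul_zero]
    · intro k hk
      have : n < k := by simpa [Nat.lt_succ_iff] using hk
      simp [Nat.choose_eq_zero_of_lt this]
  have h3 : ∀ k : ℕ, ∑' n : ℕ, (n.choose k : ℂ) * z ^ n * c n * (-1) ^ k = 0 := by
    intro k
    rw [tsum_mul_right, ← hasse, hk, zero_mul]
  rw [tsum_congr h2, tsum_congr h3, tsum_zero, tsum_ite_eq] at h1
  exact h1.symm

lemma eq_add_of_hasSum_succ {f : ℕ → ℂ} {s t : ℂ} (h : HasSum f s) (h' : HasSum (fun n => f (n + 1)) t) :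
    s = f 0 + t := by
  have := (hasSum_nat_add_iff (f := f) 1).1 h'
  rw [h.unique this]
  simp [add_comm]

end Hasse

namespace IsFredKernel

open Filter Topology

variable {ι : Type*} [DecidableEq ι] {a : ι → ι → ℂ} {S : ι → Finset ι} {ρ : ι → ℝ} {s : ℝ}

lemma hasSum_hasse_row (h : IsFredKernel a S ρ s) {z : ℂ} (hz : z ≠ 0) (k : ℕ) (i j : ι) :
    HasSum (fun n => (n.choose k : ℂ) * z ^ n * ∑ l ∈ S i, a i l * kadj a S n l j)
      (∑ l ∈ S i, a i l * hasse z k fun n => kadj a S n l j) := by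
  have hz' : 0 < 4 * ‖z‖ := by positivity
  have h1 := hasSum_sum (s := S i) fun l _ =>
    (hasSum_hasse (z := z) (fun n => h.norm_kadj_le hz' n l j) k).mul_left (a i l)
  refine h1.congr_fun fun n => ?_
  rw [Finset.mul_sum]
  exact Finset.sum_congr rfl fun l _ => by ring

/-- If the Fredholm determinant vanishes at `z`, there is a bounded eigenvector. -/
lemma exists_eigenvector (h : IsFredKernel a S ρ s) {z : ℂ}
    (hz : ∑' n, kdet a S n * z ^ n = 0) :
    ∃ v : ι → ℂ, (∃ C, ∀ i, ‖v i‖ ≤ C) ∧ v ≠ 0 ∧ ∀ i, v i = z * ∑ l ∈ S i, a i l * v l := by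
  by_contra! hno
  have hz0 : z ≠ 0 := by
    rintro rfl
    rw [tsum_eq_single 0 (fun n hn => by simp [hn])] at hz
    simp [kdet, fredCoeff_zero] at hz
  have hz' : 0 < 4 * ‖z‖ := by positivity
  have hE := h.norm_kdet_le hz'
  have hB := fun n l j => h.norm_kadj_le hz' n l j
  have hnoev : ∀ j k, (∀ i, hasse z k (fun n => kadj a S n i j) =
      z * ∑ l ∈ S i, a i l * hasse z k fun n => kadj a S n l j) →
      ∀ i, hasse z k (fun n => kadj a S n i j) = 0 := by
    intro j k hk i
    by_contra hi
    obtain ⟨i', hi'⟩ := hno (fun i => hasse z k fun n => kadj a S n i j)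
      ⟨_, fun i => norm_hasse_le (fun n => hB n i j) k⟩ (fun h0 => hi (congrFun h0 i))
    exact hi' (hk i')
  have key : ∀ k, hasse z k (kdet a S) = 0 ∧ ∀ i j, hasse z k (fun n => kadj a S n i j) = 0 := by
    intro k
    induction k with
    | zero =>
      have h0 : hasse z 0 (kdet a S) = 0 := by
        rw [← hz, hasse]
        exact tsum_congr fun n => by simp [mul_comm]
      refine ⟨h0, fun i j => hnoev j 0 (fun i => ?_) i⟩
      have h1 := (hasSum_hasse (fun n => hB n i j) 0)
      have h2 := (hasSum_hasse hE 0)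
      have h3 := (h.hasSum_hasse_row hz0 0 i j).mul_left z
      have h4 := eq_add_of_hasSum_succ (h1.sub (h2.mul_right (if i = j then 1 else 0)))
        (h3.congr_fun fun n => by rw [kadj_succ]; simp only [Nat.choose_zero_right]; ring)
      rw [h0, zero_mul, sub_zero] at h4
      rw [h4]
      simp [kadj_zero, kdet, fredCoeff_zero]
    | succ k ih =>
      have h0 : hasse z (k + 1) (kdet a S) = 0 := by
        have h1 := hasSum_hasse hE (k + 1)
        have h2 : ∀ n : ℕ, (((n.choose k : ℂ) * z ^ n) * (((n : ℂ) + 1) * kdet a S (n + 1))) =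
            -∑' i, ((n.choose k : ℂ) * z ^ n) * ∑ l ∈ S i, a i l * kadj a S n l i := by
          intro n
          rw [tsum_mul_left, (h.succ_mul_kdet n).tsum_eq]
          ring
        have hc : HasSum (fun i => ∑' n, ((n.choose k : ℂ) * z ^ n) *
            ∑ l ∈ S i, a i l * kadj a S n l i) 0 := by
          have : ∀ i, ∑' n, ((n.choose k : ℂ) * z ^ n) *
            ∑ l ∈ S i, a i l * kadj a S n l i = 0 := by
            intro i
            rw [(h.hasSum_hasse_row hz0 k i i).tsum_eq]
            exact Finset.sum_eq_zero fun l _ => by rw [ih.2, mul_zero]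
          simp only [this]
          exact hasSum_zero
        have hsum : Summable (Function.uncurry fun (i : ι) (n : ℕ) => ((n.choose k : ℂ) * z ^ n) *
            ∑ l ∈ S i, a i l * kadj a S n l i) := by
          refine Summable.of_norm_bounded
            (g := fun p : ι × ℕ => ρ p.1 * ((Real.exp ((∑' i, ρ i ^ s) / s * (4 * ‖z‖) ^ s)) *
              (1 / 2) ^ p.2)) ?_ ?_
          · refine Summable.mul_of_nonneg h.summable (summable_geometric_two.mul_left _) h.nonneg ?_
            intro n; positivity
          · rintro ⟨i, n⟩
            simp only [Function.uncurry]
            rw [Finset.mul_sum]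
            calc _ ≤ ∑ l ∈ S i, ‖a i l‖ * ((Real.exp ((∑' i, ρ i ^ s) / s * (4 * ‖z‖) ^ s)) *
                    (1 / 2) ^ n) := by
                  refine (norm_sum_le _ _).trans (Finset.sum_le_sum fun l _ => ?_)
                  have := norm_hasse_term_le (fun n => hB n l i) k n
                  calc _ = ‖a i l‖ * ‖(n.choose k : ℂ) * z ^ n * kadj a S n l i‖ := by
                        rw [← norm_mul]; congr 1; ring
                    _ ≤ _ := by gcongr
              _ = (∑ l ∈ S i, ‖a i l‖) * ((Real.exp ((∑' i, ρ i ^ s) / s * (4 * ‖z‖) ^ s)) *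
                    (1 / 2) ^ n) := by rw [Finset.sum_mul]
              _ ≤ _ := by gcongr; exact h.row i
        have h3 := hsum.tsum_comm
        rw [hc.tsum_eq] at h3
        have h4 := eq_add_of_hasSum_succ h1 (t := 0) (by
          have hs2 : Summable fun n => ∑' i, ((n.choose k : ℂ) * z ^ n) *
            ∑ l ∈ S i, a i l * kadj a S n l i := hsum.prod_symm.prod
          have h5 := hs2.hasSum
          rw [h3] at h5
          have h6 := h5.mul_left (-z * ((k : ℂ) + 1)⁻¹)
          rw [mul_zero] at h6
          refine h6.congr_fun fun n => ?_
          have h7 := h2 n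
          have hk : ((k : ℂ) + 1) ≠ 0 := by exact_mod_cast Nat.succ_ne_zero k
          have h8 : (((n : ℂ) + 1) * (n.choose k : ℂ)) = ((n + 1).choose (k + 1) : ℂ) * (k + 1) := by
            exact_mod_cast Nat.add_one_mul_choose_eq n k
          rw [← neg_eq_iff_eq_neg] at h7
          rw [← h7]
          field_simp
          linear_combination (- z ^ (n + 1) * kdet a S (n + 1)) * h8)
        simpa using h4
      refine ⟨h0, fun i j => hnoev j (k + 1) (fun i => ?_) i⟩
      have h1 := (hasSum_hasse (fun n => hB n i j) (k + 1))
      have h2 := (hasSum_hasse hE (k + 1))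
      have h3 := (h.hasSum_hasse_row hz0 k i j).mul_left z
      have h3' := (h.hasSum_hasse_row hz0 (k + 1) i j).mul_left z
      have h4 := eq_add_of_hasSum_succ (h1.sub (h2.mul_right (if i = j then 1 else 0)))
        ((h3.add h3').congr_fun fun n => by
          rw [kadj_succ, Nat.choose_succ_succ]; push_cast; ring)
      rw [h0, zero_mul, sub_zero] at h4
      rw [h4]
      simp [ih.2]
  obtain ⟨k, hk⟩ := exists_hasse_ne_zero hE (by simp [kdet, fredCoeff_zero])
  exact hk (key k).1

end IsFredKernel

section Sites

lemma omega_pow_three : ω ^ 3 = 1 := by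
  rw [ω, ← Complex.exp_nat_mul, ← Complex.exp_two_pi_mul_I]
  congr 1
  push_cast
  ring

lemma omega_eq : ω = -1 / 2 + (Real.sqrt 3 / 2 : ℝ) * I := by
  rw [ω, show (2 * Real.pi * I / 3 : ℂ) = ((2 * Real.pi / 3 : ℝ) : ℂ) * I by push_cast; ring,
    Complex.exp_mul_I, ← Complex.ofReal_cos, ← Complex.ofReal_sin,
    show 2 * Real.pi / 3 = Real.pi - Real.pi / 3 by ring, Real.cos_pi_sub, Real.sin_pi_sub,
    Real.cos_pi_div_three, Real.sin_pi_div_three]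
  push_cast
  ring

lemma omega_re : ω.re = -1 / 2 := by
  rw [omega_eq, Complex.add_re, Complex.re_ofReal_mul]; norm_num

lemma omega_im : ω.im = Real.sqrt 3 / 2 := by
  rw [omega_eq, Complex.add_im, Complex.im_ofReal_mul]; norm_num

lemma omega_im_pos : 0 < ω.im := by
  rw [omega_im]; positivity

lemma omega_ne_one : ω ≠ 1 := by
  intro h
  have := omega_im_pos
  rw [h] at this
  simp at this

lemma omega_ne_zero : ω ≠ 0 := Complex.exp_ne_zero _

lemma omega_sq : ω ^ 2 = -1 - ω := by
  have h : (ω - 1) * (ω ^ 2 + ω + 1) = 0 := by linear_combination omega_pow_three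
  have := (mul_eq_zero.1 h).resolve_left (sub_ne_zero.2 omega_ne_one)
  linear_combination this

lemma norm_omega : ‖ω‖ = 1 := by
  have h : ‖ω‖ ^ 3 = 1 := by rw [← norm_pow, omega_pow_three, norm_one]
  exact (pow_eq_one_iff_of_nonneg (norm_nonneg _) (by norm_num)).1 h

/-- The embedding of `ℤ²` as the Eisenstein lattice. -/
def emb (n : ℤ × ℤ) : ℂ := n.1 + n.2 * ω

lemma emb_add (m n : ℤ × ℤ) : emb (m + n) = emb m + emb n := by
  simp only [emb, Prod.fst_add, Prod.snd_add]; push_cast; ring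

lemma emb_neg (n : ℤ × ℤ) : emb (-n) = -emb n := by
  simp only [emb, Prod.fst_neg, Prod.snd_neg]; push_cast; ring

lemma emb_sub (m n : ℤ × ℤ) : emb (m - n) = emb m - emb n := by
  rw [sub_eq_add_neg, emb_add, emb_neg, sub_eq_add_neg]

lemma emb_smul (k : ℤ) (n : ℤ × ℤ) : emb (k • n) = k * emb n := by
  simp only [emb, Prod.smul_fst, Prod.smul_snd, smul_eq_mul]; push_cast; ring

lemma emb_zero : emb 0 = 0 := by simp [emb]

/-- The quadratic form of the Eisenstein lattice. -/
def qform (n : ℤ × ℤ) : ℤ := n.1 ^ 2 - n.1 * n.2 + n.2 ^ 2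

lemma norm_emb_sq (n : ℤ × ℤ) : ‖emb n‖ ^ 2 = qform n := by
  have h3 : (Real.sqrt 3) ^ 2 = 3 := Real.sq_sqrt (by norm_num)
  rw [← Complex.normSq_eq_norm_sq, Complex.normSq_apply, emb]
  simp only [Complex.add_re, Complex.add_im, Complex.mul_re, Complex.mul_im, Complex.intCast_re,
    Complex.intCast_im, omega_re, omega_im, qform]
  push_cast
  linear_combination ((n.2 : ℝ) ^ 2 / 4) * h3

lemma qform_pos {n : ℤ × ℤ} (hn : n ≠ 0) : 0 < qform n := by
  have h : n.1 ≠ 0 ∨ n.2 ≠ 0 := by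
    by_contra! h
    exact hn (Prod.ext h.1 h.2)
  rw [qform]
  rcases h with h | h
  · have := sq_pos_of_ne_zero h
    nlinarith [sq_nonneg (n.1 - 2 * n.2)]
  · have := sq_pos_of_ne_zero h
    nlinarith [sq_nonneg (2 * n.1 - n.2)]

lemma one_le_norm_emb {n : ℤ × ℤ} (hn : n ≠ 0) : 1 ≤ ‖emb n‖ := by
  have h : (1 : ℝ) ≤ ‖emb n‖ ^ 2 := by
    rw [norm_emb_sq]; exact_mod_cast qform_pos hn
  nlinarith [norm_nonneg (emb n)]

lemma emb_ne_zero {n : ℤ × ℤ} (hn : n ≠ 0) : emb n ≠ 0 := by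
  have := one_le_norm_emb hn
  exact norm_pos_iff.1 (by linarith)

lemma emb_injective : Function.Injective emb := by
  intro m n h
  by_contra hne
  exact emb_ne_zero (sub_ne_zero.2 hne) (by rw [emb_sub, h, sub_self])

/-- Rotation by `2π/3`. -/
def rot (n : ℤ × ℤ) : ℤ × ℤ := (-n.2, n.1 - n.2)

lemma emb_rot (n : ℤ × ℤ) : emb (rot n) = ω * emb n := by
  simp only [emb, rot]
  push_cast
  linear_combination (-(n.2 : ℂ)) * omega_sq

lemma rot_rot_rot (n : ℤ × ℤ) : rot (rot (rot n)) = n := by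
  ext <;> simp [rot] <;> ring

lemma rot_add (m n : ℤ × ℤ) : rot (m + n) = rot m + rot n := by
  ext <;> simp [rot] <;> ring

lemma rot_smul (k : ℤ) (n : ℤ × ℤ) : rot (k • n) = k • rot n := by
  ext <;> simp [rot] <;> ring

/-- The three hopping directions. -/
def dir : ℕ → ℤ × ℤ
  | 0 => (1, 0)
  | 1 => (0, 1)
  | _ => (-1, -1)

/-- The sublattice type of a site: `0` at the centers, `±1` at the two kinds of vertices. -/
def eps (n : ℤ × ℤ) : ℤ :=
  if (n.1 + n.2) % 3 = 1 then 1 else if (n.1 + n.2) % 3 = 2 then -1 else 0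

lemma eps_eq_zero_iff (n : ℤ × ℤ) : eps n = 0 ↔ (n.1 + n.2) % 3 = 0 := by
  unfold eps; split_ifs with h1 h2 <;> simp <;> omega

lemma eps_eq_one_iff (n : ℤ × ℤ) : eps n = 1 ↔ (n.1 + n.2) % 3 = 1 := by
  unfold eps; split_ifs with h1 h2 <;> simp <;> omega

lemma eps_eq_neg_one_iff (n : ℤ × ℤ) : eps n = -1 ↔ (n.1 + n.2) % 3 = 2 := by
  unfold eps; split_ifs with h1 h2 <;> simp <;> omega

lemma eps_cases (n : ℤ × ℤ) : eps n = 0 ∨ eps n = 1 ∨ eps n = -1 := by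
  rw [eps]; split_ifs <;> simp

lemma eps_rot (n : ℤ × ℤ) : eps (rot n) = eps n := by
  have : ((rot n).1 + (rot n).2) % 3 = (n.1 + n.2) % 3 := by simp only [rot]; omega
  rw [eps, eps, this]

lemma eps_add_of_eps_eq_zero {m : ℤ × ℤ} (hm : eps m = 0) (n : ℤ × ℤ) : eps (m + n) = eps n := by
  rw [eps_eq_zero_iff] at hm
  have : ((m + n).1 + (m + n).2) % 3 = (n.1 + n.2) % 3 := by
    simp only [Prod.fst_add, Prod.snd_add]; omega
  rw [eps, eps, this]

lemma eps_neg (n : ℤ × ℤ) : eps (-n) = -eps n := by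
  rw [eps, eps]; simp only [Prod.fst_neg, Prod.snd_neg]; split_ifs <;> first | rfl | omega

lemma dir_sum (l : ℕ) : ((dir l).1 + (dir l).2) % 3 = 1 := by
  rcases l with _ | _ | l <;> simp [dir]

/-- The neighbour of `n` in direction `l`. -/
def nbr (n : ℤ × ℤ) (l : ℕ) : ℤ × ℤ := n + eps n • dir l

lemma eps_nbr (n : ℤ × ℤ) (l : ℕ) : eps (nbr n l) = -eps n := by
  have h := dir_sum l
  rcases eps_cases n with h0 | h0 | h0
  · simp [nbr, h0]
  · rw [h0, eps_eq_neg_one_iff, nbr, h0]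
    rw [eps_eq_one_iff] at h0
    simp only [one_smul, Prod.fst_add, Prod.snd_add]; omega
  · rw [h0, neg_neg, eps_eq_one_iff, nbr, h0]
    rw [eps_eq_neg_one_iff] at h0
    simp only [neg_smul, one_smul, Prod.fst_add, Prod.snd_add, Prod.fst_neg, Prod.snd_neg]; omega

lemma nbr_add_of_eps_eq_zero {m : ℤ × ℤ} (hm : eps m = 0) (n : ℤ × ℤ) (l : ℕ) :
    nbr (m + n) l = m + nbr n l := by
  rw [nbr, nbr, eps_add_of_eps_eq_zero hm, add_assoc]

lemma emb_dir {l : ℕ} (hl : l < 3) : emb (dir l) = ω ^ l := by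
  interval_cases l
  · simp [dir, emb]
  · simp [dir, emb]
  · simp only [dir, emb]; rw [omega_sq]; push_cast; ring

lemma rot_dir_zero : rot (dir 0) = dir 1 := by simp [rot, dir]
lemma rot_dir_one : rot (dir 1) = dir 2 := by simp [rot, dir]
lemma rot_dir_two : rot (dir 2) = dir 0 := by simp [rot, dir]

lemma nbr_rot (n : ℤ × ℤ) (l : ℕ) : rot (nbr n l) = rot n + eps n • rot (dir l) := by
  rw [nbr, rot_add, rot_smul]

lemma norm_emb_nbr_sub_le (n : ℤ × ℤ) (l : ℕ) : ‖emb (nbr n l) - emb n‖ ≤ 1 := by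
  rw [nbr, emb_add, add_sub_cancel_left, emb_smul, norm_mul]
  have h1 : ‖emb (dir l)‖ = 1 := by
    rcases l with _ | _ | l
    · rw [emb_dir (by norm_num)]; simp
    · rw [emb_dir (by norm_num)]; simp [norm_omega]
    · rw [show dir (l + 1 + 1) = dir 2 from rfl, emb_dir (by norm_num)]; simp [norm_omega]
  rw [h1, mul_one]
  rcases eps_cases n with h | h | h <;> simp [h]

/-- The hopping operator. -/
def hop (u : ℤ × ℤ → ℂ) (n : ℤ × ℤ) : ℂ := ∑ l ∈ Finset.range 3, ω ^ l * u (nbr n l)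

lemma hop_rot (u : ℤ × ℤ → ℂ) (n : ℤ × ℤ) :
    hop u (rot n) = ω * hop (fun m => u (rot m)) n := by
  have h0 : nbr (rot n) 0 = rot (nbr n 2) := by rw [nbr_rot, nbr, eps_rot, rot_dir_two]
  have h1 : nbr (rot n) 1 = rot (nbr n 0) := by rw [nbr_rot, nbr, eps_rot, rot_dir_zero]
  have h2 : nbr (rot n) 2 = rot (nbr n 1) := by rw [nbr_rot, nbr, eps_rot, rot_dir_one]
  simp only [hop, Finset.sum_range_succ, Finset.sum_range_zero, h0, h1, h2]
  linear_combination (- u (rot (nbr n 2))) * omega_pow_three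

lemma norm_hop_le {u : ℤ × ℤ → ℂ} {n : ℤ × ℤ} {B : ℝ} (h : ∀ l, ‖u (nbr n l)‖ ≤ B) :
    ‖hop u n‖ ≤ 3 * B := by
  rw [hop]
  calc _ ≤ ∑ l ∈ Finset.range 3, ‖ω ^ l * u (nbr n l)‖ := norm_sum_le _ _
    _ ≤ ∑ l ∈ Finset.range 3, B := by
        refine Finset.sum_le_sum fun l _ => ?_
        rw [norm_mul, norm_pow, norm_omega, one_pow, one_mul]
        exact h l
    _ = 3 * B := by simp

/-- The weighted hopping operator. -/
def wop (c : ℤ × ℤ → ℂ) : Module.End ℂ (ℤ × ℤ → ℂ) where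
  toFun u n := c n * hop u n
  map_add' u v := by
    funext n
    simp only [hop, Pi.add_apply, mul_add, Finset.sum_add_distrib]
  map_smul' a u := by
    funext n
    simp only [hop, Pi.smul_apply, smul_eq_mul, RingHom.id_apply, Finset.mul_sum]
    exact Finset.sum_congr rfl fun l _ => by ring

lemma wop_apply (c u : ℤ × ℤ → ℂ) (n : ℤ × ℤ) : wop c u n = c n * hop u n := rfl

/-- Inverse of the shifted diagonal, vanishing at the centers. -/
def invw (z : ℂ) (n : ℤ × ℤ) : ℂ := if eps n = 0 then 0 else (emb n + z)⁻¹

lemma ne_zero_of_eps_ne_zero {n : ℤ × ℤ} (h : eps n ≠ 0) : n ≠ 0 := by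
  rintro rfl
  exact h (by simp [eps])

lemma norm_emb_le_two_mul_nbr {n : ℤ × ℤ} (h : eps n ≠ 0) (l : ℕ) :
    ‖emb n‖ ≤ 2 * ‖emb (nbr n l)‖ := by
  have h1 : 1 ≤ ‖emb (nbr n l)‖ := one_le_norm_emb (ne_zero_of_eps_ne_zero (by
    rw [eps_nbr]; simpa using h))
  have h2 := norm_emb_nbr_sub_le n l
  have h3 : ‖emb n‖ ≤ ‖emb (nbr n l)‖ + ‖emb (nbr n l) - emb n‖ := by
    have := norm_sub_le (emb (nbr n l)) (emb (nbr n l) - emb n)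
    rwa [sub_sub_cancel] at this
  linarith

/-- Polynomial decay of order `p` on the noncentral sites. -/
def Decays (p : ℕ) (B : ℝ) (u : ℤ × ℤ → ℂ) : Prop :=
  ∀ n, eps n ≠ 0 → ‖u n‖ * ‖emb n‖ ^ p ≤ B

lemma Decays.hop {p : ℕ} {B : ℝ} {u : ℤ × ℤ → ℂ} (h : Decays p B u) {n : ℤ × ℤ}
    (hn : eps n ≠ 0) : ‖hop u n‖ * ‖emb n‖ ^ p ≤ 3 * 2 ^ p * B := by
  have hpos : 0 < ‖emb n‖ := norm_pos_iff.2 (emb_ne_zero (ne_zero_of_eps_ne_zero hn))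
  have h1 : ∀ l, ‖u (nbr n l)‖ ≤ 2 ^ p * B / ‖emb n‖ ^ p := by
    intro l
    rw [le_div_iff₀ (by positivity)]
    have h2 := h (nbr n l) (by rw [eps_nbr]; simpa using hn)
    calc ‖u (nbr n l)‖ * ‖emb n‖ ^ p ≤ ‖u (nbr n l)‖ * (2 * ‖emb (nbr n l)‖) ^ p := by
          gcongr; exact norm_emb_le_two_mul_nbr hn l
      _ = 2 ^ p * (‖u (nbr n l)‖ * ‖emb (nbr n l)‖ ^ p) := by rw [mul_pow]; ring
      _ ≤ _ := by gcongr
  have := norm_hop_le h1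
  rw [← mul_div_assoc, le_div_iff₀ (by positivity)] at this
  linarith

lemma Decays.wop {p : ℕ} {B : ℝ} {u : ℤ × ℤ → ℂ} (h : Decays p B u) :
    Decays (p + 1) (3 * 2 ^ p * B) (wop (invw 0) u) := by
  intro n hn
  have hpos : 0 < ‖emb n‖ := norm_pos_iff.2 (emb_ne_zero (ne_zero_of_eps_ne_zero hn))
  rw [wop_apply, invw, if_neg hn, add_zero, norm_mul, norm_inv, pow_succ]
  have := h.hop hn
  field_simp
  linarith

lemma summable_norm_emb_rpow {s : ℝ} (hs : 2 < s) : Summable fun n => ‖emb n‖ ^ (-s) := by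
  let z : UpperHalfPlane := ⟨ω, omega_im_pos⟩
  have h1 : Summable fun x : Fin 2 → ℤ => ‖(x 0 : ℂ) * z + x 1‖ ^ (-s) := by
    refine Summable.of_nonneg_of_le (fun x => by positivity)
      (fun x => EisensteinSeries.summand_bound z (by linarith) x)
      ((EisensteinSeries.summable_one_div_norm_rpow hs).mul_left _)
  have h2 := ((Equiv.prodComm ℤ ℤ).trans (finTwoArrowEquiv ℤ).symm).summable_iff.2 h1
  refine h2.congr fun n => ?_
  simp [emb, z, add_comm]

end Sites

section KernelOfOperator

variable {ι : Type*} [DecidableEq ι]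

/-- The operator is row-finite with respect to the given finite sets. -/
def RowFinite (A : Module.End ℂ (ι → ℂ)) (S : ι → Finset ι) : Prop :=
  ∀ i u, (∀ j ∈ S i, u j = 0) → A u i = 0

/-- The matrix of an operator. -/
def opKernel (A : Module.End ℂ (ι → ℂ)) (i j : ι) : ℂ := A (Pi.single j 1) i

lemma RowFinite.apply_eq {A : Module.End ℂ (ι → ℂ)} {S : ι → Finset ι} (h : RowFinite A S)
    (u : ι → ℂ) (i : ι) : A u i = ∑ j ∈ S i, opKernel A i j * u j := by
  have h1 := h i (u - ∑ j ∈ S i, u j • Pi.single j 1) (fun j hj => by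
    rw [Pi.sub_apply, Finset.sum_apply, Finset.sum_eq_single j]
    · simp
    · intro l _ hl; simp [hl.symm]
    · exact fun h => absurd hj h)
  rw [map_sub, map_sum, Pi.sub_apply, Finset.sum_apply, sub_eq_zero] at h1
  rw [h1]
  refine Finset.sum_congr rfl fun j _ => ?_
  rw [map_smul, Pi.smul_apply, smul_eq_mul, opKernel, mul_comm]

lemma RowFinite.kpow_eq {A : Module.End ℂ (ι → ℂ)} {S : ι → Finset ι} (h : RowFinite A S)
    (k : ℕ) (i j : ι) : kpow (opKernel A) S k i j = (A ^ k) (Pi.single j 1) i := by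
  induction k generalizing i with
  | zero => simp [kpow, Pi.single_apply]
  | succ k ih =>
    rw [kpow, pow_succ', Module.End.mul_apply, h.apply_eq]
    exact Finset.sum_congr rfl fun l _ => by rw [ih]

lemma RowFinite.comp {A B : Module.End ℂ (ι → ℂ)} {S S' : ι → Finset ι} (hA : RowFinite A S)
    (hB : RowFinite B S') : RowFinite (A * B) fun i => (S i).biUnion S' := by
  intro i u hu
  rw [Module.End.mul_apply]
  refine hA i _ fun j hj => hB j u fun l hl => hu l ?_
  exact Finset.mem_biUnion.2 ⟨j, hj, hl⟩

lemma RowFinite.isFredKernel {A : Module.End ℂ (ι → ℂ)} {S : ι → Finset ι} (h : RowFinite A S)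
    {ρ : ι → ℝ} {s : ℝ} (hb : ∀ u : ι → ℂ, (∀ j, ‖u j‖ ≤ 1) → ∀ i, ‖A u i‖ ≤ ρ i)
    (hs0 : 0 < s) (hs1 : s < 1) (hρ : Summable ρ) (hρs : Summable fun i => ρ i ^ s) :
    IsFredKernel (opKernel A) S ρ s where
  supp i j hne := by
    by_contra hj
    exact hne (h i _ fun l hl => by
      have : l ≠ j := fun hlj => hj (hlj ▸ hl)
      simp [this])
  row i := by
    have h1 := hb (fun j => if opKernel A i j = 0 then 0 else
      (starRingEnd ℂ) (opKernel A i j) / ‖opKernel A i j‖) (fun j => by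
        split_ifs with h0
        · simp
        · have : ‖opKernel A i j‖ ≠ 0 := by simpa using h0
          simp [this]) i
    rw [h.apply_eq] at h1
    have h2 : ∀ j, opKernel A i j * (if opKernel A i j = 0 then 0 else
      (starRingEnd ℂ) (opKernel A i j) / ‖opKernel A i j‖) = (‖opKernel A i j‖ : ℂ) := by
      intro j
      split_ifs with h0
      · simp [h0]
      · have : (‖opKernel A i j‖ : ℂ) ≠ 0 := by simpa using h0
        rw [← mul_div_assoc, Complex.mul_conj, Complex.normSq_eq_norm_sq]
        push_cast
        field_simp
    simp only [h2] at h1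
    rw [← Complex.ofReal_sum, Complex.norm_real, Real.norm_of_nonneg
      (Finset.sum_nonneg fun _ _ => norm_nonneg _)] at h1
    exact h1
  summable := hρ
  s_pos := hs0
  s_lt := hs1
  summable_rpow := hρs

end KernelOfOperator

section BirmanSchwinger

/-- The hopping operator weighted with the inverse of the diagonal. -/
def hopT : Module.End ℂ (ℤ × ℤ → ℂ) := wop (invw 0)

/-- Composition with the rotation. -/
def rotOp : Module.End ℂ (ℤ × ℤ → ℂ) := LinearMap.funLeft ℂ ℂ rot

/-- Averaging over the rotation group. -/
def rotAvg : Module.End ℂ (ℤ × ℤ → ℂ) := (1 / 3 : ℂ) • (1 + rotOp + rotOp ^ 2)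

/-- The trace class operator whose Fredholm determinant detects degenerate magic parameters. -/
def bsOp : Module.End ℂ (ℤ × ℤ → ℂ) := hopT ^ 4 * rotAvg

lemma rotOp_apply (u : ℤ × ℤ → ℂ) (n : ℤ × ℤ) : rotOp u n = u (rot n) := rfl

lemma rotAvg_apply (u : ℤ × ℤ → ℂ) (n : ℤ × ℤ) :
    rotAvg u n = (u n + u (rot n) + u (rot (rot n))) / 3 := by
  simp only [rotAvg, LinearMap.smul_apply, LinearMap.add_apply, Pi.smul_apply, Pi.add_apply,
    Module.End.one_apply, pow_two, Module.End.mul_apply, rotOp_apply, smul_eq_mul]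
  ring

lemma commute_hopT_rotOp : Commute hopT rotOp := by
  refine LinearMap.ext fun u => funext fun n => ?_
  simp only [Module.End.mul_apply, rotOp_apply, hopT, wop_apply]
  rw [hop_rot, invw, invw, eps_rot, emb_rot]
  split_ifs
  · simp
  · have := omega_ne_zero
    change _ = _ * (ω * hop (rotOp u) n)
    rw [add_zero, add_zero, mul_inv]
    field_simp

lemma rotOp_cube : rotOp ^ 3 = 1 := by
  refine LinearMap.ext fun u => funext fun n => ?_
  simp only [pow_succ, pow_zero, one_mul, Module.End.mul_apply, rotOp_apply, rot_rot_rot,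
    Module.End.one_apply]

lemma rotOp_mul_rotAvg : rotOp * rotAvg = rotAvg := by
  rw [rotAvg, mul_smul_comm]
  congr 1
  calc rotOp * (1 + rotOp + rotOp ^ 2) = rotOp + rotOp ^ 2 + rotOp ^ 3 := by noncomm_ring
    _ = _ := by rw [rotOp_cube]; abel

lemma commute_hopT_rotAvg : Commute hopT rotAvg := by
  rw [rotAvg]
  exact (((Commute.one_right _).add_right commute_hopT_rotOp).add_right
    (commute_hopT_rotOp.pow_right 2)).smul_right _

lemma rotAvg_mul_self : rotAvg * rotAvg = rotAvg := by
  nth_rw 1 [rotAvg]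
  rw [smul_mul_assoc, add_mul, add_mul, one_mul, pow_two, mul_assoc, rotOp_mul_rotAvg,
    rotOp_mul_rotAvg]
  refine LinearMap.ext fun u => funext fun n => ?_
  simp only [LinearMap.smul_apply, LinearMap.add_apply, Pi.smul_apply, Pi.add_apply, smul_eq_mul]
  ring

lemma bsOp_pow (k : ℕ) (hk : 0 < k) : bsOp ^ k = hopT ^ (4 * k) * rotAvg := by
  have hc : Commute (hopT ^ 4) rotAvg := commute_hopT_rotAvg.pow_left 4
  rw [bsOp, hc.mul_pow, ← pow_mul]
  congr 1
  exact IsIdempotentElem.pow_eq (rotAvg_mul_self) (by omega)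

lemma rowFinite_wop (c : ℤ × ℤ → ℂ) :
    RowFinite (wop c) fun n => (Finset.range 3).image (nbr n) := by
  intro n u hu
  rw [wop_apply, hop, Finset.sum_eq_zero, mul_zero]
  intro l hl
  rw [hu _ (Finset.mem_image_of_mem _ hl), mul_zero]

lemma rowFinite_rotAvg : RowFinite rotAvg fun n => {n, rot n, rot (rot n)} := by
  intro n u hu
  rw [rotAvg_apply, hu _ (by simp), hu _ (by simp), hu _ (by simp)]
  simp

lemma exists_rowFinite_bsOp : ∃ S, RowFinite bsOp S := by
  have h := rowFinite_wop (invw 0)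
  have h2 := (((h.comp h).comp h).comp h).comp rowFinite_rotAvg
  have : bsOp = wop (invw 0) * wop (invw 0) * wop (invw 0) * wop (invw 0) * rotAvg := by
    rw [bsOp, hopT]
    noncomm_ring
  rw [this]
  exact ⟨_, h2⟩

/-- The rows entering the operator. -/
def bsRow : ℤ × ℤ → Finset (ℤ × ℤ) := exists_rowFinite_bsOp.choose

lemma rowFinite_bsOp : RowFinite bsOp bsRow := exists_rowFinite_bsOp.choose_spec

/-- Row bounds of the operator. -/
def bsBound (n : ℤ × ℤ) : ℝ := 5184 * ‖emb n‖ ^ (-(4 : ℝ))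

lemma norm_bsOp_le (u : ℤ × ℤ → ℂ) (hu : ∀ j, ‖u j‖ ≤ 1) (n : ℤ × ℤ) :
    ‖bsOp u n‖ ≤ bsBound n := by
  have h0 : Decays 0 1 (rotAvg u) := by
    intro m _
    rw [pow_zero, mul_one, rotAvg_apply, norm_div]
    have := norm_add₃_le (a := u m) (b := u (rot m)) (c := u (rot (rot m)))
    have := hu m
    have := hu (rot m)
    have := hu (rot (rot m))
    rw [div_le_iff₀ (by simp)]
    simp only [Complex.norm_ofNat]
    linarith
  have h4 := h0.wop.wop.wop.wop
  have heq : bsOp u = wop (invw 0) (wop (invw 0) (wop (invw 0) (wop (invw 0) (rotAvg u)))) := by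
    rw [bsOp, hopT]
    simp only [pow_succ, pow_zero, one_mul, Module.End.mul_apply]
  rw [heq, bsBound]
  by_cases hn : eps n = 0
  · rw [wop_apply, invw, if_pos hn, zero_mul, norm_zero]
    positivity
  · have hpos : 0 < ‖emb n‖ := norm_pos_iff.2 (emb_ne_zero (ne_zero_of_eps_ne_zero hn))
    have := h4 n hn
    rw [Real.rpow_neg hpos.le, ← div_eq_mul_inv, le_div_iff₀ (by positivity)]
    norm_num at this ⊢
    exact_mod_cast this

lemma isFredKernel_bsOp : IsFredKernel (opKernel bsOp) bsRow bsBound (3 / 4) := by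
  refine rowFinite_bsOp.isFredKernel norm_bsOp_le (by norm_num) (by norm_num)
    ((summable_norm_emb_rpow (by norm_num)).mul_left _) ?_
  refine ((summable_norm_emb_rpow (s := 3) (by norm_num)).mul_left ((5184 : ℝ) ^ (3 / 4 : ℝ))).congr
    fun n => ?_
  rw [bsBound, Real.mul_rpow (by norm_num) (by positivity), ← Real.rpow_mul (norm_nonneg _)]
  norm_num

/-- The coefficients of the Fredholm determinant of the operator. -/
def bsDet : ℕ → ℂ := kdet (opKernel bsOp) bsRow

/-- The factorisation step: an eigenvector of a fourth power yields one of the operator. -/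
lemma exists_eigenvector_of_pow_four {V : Type*} [AddCommGroup V] [Module ℂ V]
    (T : Module.End ℂ V) (W : Submodule ℂ V) (hW : ∀ v ∈ W, T v ∈ W) {v : V} (hv : v ∈ W)
    (hv0 : v ≠ 0) {a : ℂ} (ha : a ≠ 0) (h : v = a ^ 4 • (T ^ 4) v) :
    ∃ b : ℂ, b ^ 4 = a ^ 4 ∧ ∃ w ∈ W, w ≠ 0 ∧ w = b • T w := by
  have key : ∀ (b : ℂ) (w : V), w ∈ W → b ^ 4 = a ^ 4 → (w - b • T w) = 0 → w ≠ 0 →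
      ∃ b : ℂ, b ^ 4 = a ^ 4 ∧ ∃ w ∈ W, w ≠ 0 ∧ w = b • T w :=
    fun b w hw hb h0 hne => ⟨b, hb, w, hw, hne, sub_eq_zero.1 h0⟩
  have hmem : ∀ (b : ℂ) (w : V), w ∈ W → w - b • T w ∈ W := fun b w hw =>
    W.sub_mem hw (W.smul_mem _ (hW w hw))
  set v1 := v - a • T v with hv1
  set v2 := v1 - (-a) • T v1 with hv2
  set v3 := v2 - (a * I) • T v2 with hv3
  have m1 := hmem a v hv
  have m2 := hmem (-a) _ m1
  have m3 := hmem (a * I) _ m2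
  have hI : I ^ 4 = 1 := Complex.I_pow_four
  have hv4 : v3 - (-(a * I)) • T v3 = 0 := by
    have h' : v - a ^ 4 • (T ^ 4) v = 0 := sub_eq_zero.2 h
    have e2 : v2 = v - a ^ 2 • T (T v) := by
      rw [hv2, hv1]; simp only [map_sub, map_smul]; module
    have e3 : v3 - (-(a * I)) • T v3 = v2 - (a * I) ^ 2 • T (T v2) := by
      rw [hv3]; simp only [map_sub, map_smul]; module
    rw [e3, e2, ← h', mul_pow, Complex.I_sq]
    simp only [map_sub, map_smul, pow_succ, pow_zero, one_mul, Module.End.mul_apply]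
    module
  by_cases c1 : v1 = 0
  · exact key a v hv rfl c1 hv0
  by_cases c2 : v2 = 0
  · exact key (-a) v1 m1 (by ring) c2 c1
  by_cases c3 : v3 = 0
  · exact key (a * I) v2 m2 (by rw [mul_pow, hI, mul_one]) c3 c2
  · exact key (-(a * I)) v3 m3 (by rw [neg_pow, mul_pow, hI]; ring) hv4 c3

/-- Zeros of the Fredholm determinant are fourth powers of parameters with a rotation invariant
bounded solution of the eigenvalue equation on the lattice. -/
lemma exists_solution_of_bsDet_zero {z : ℂ} (hz : ∑' n, bsDet n * z ^ n = 0) :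
    ∃ α : ℂ, α ^ 4 = z ∧ ∃ w : ℤ × ℤ → ℂ, w ≠ 0 ∧ (∃ C, ∀ n, ‖w n‖ ≤ C) ∧
      (∀ n, w (rot n) = w n) ∧ (∀ n, eps n = 0 → w n = 0) ∧
      ∀ n, eps n ≠ 0 → emb n * w n = I * α * hop w n := by
  obtain ⟨v, hvb, hv0, hv⟩ := isFredKernel_bsOp.exists_eigenvector hz
  have hv1 : v = z • bsOp v := by
    funext n
    rw [hv n, Pi.smul_apply, rowFinite_bsOp.apply_eq, smul_eq_mul]
  have hz0 : z ≠ 0 := by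
    rintro rfl
    rw [zero_smul] at hv1
    exact hv0 hv1
  let W : Submodule ℂ (ℤ × ℤ → ℂ) :=
    { carrier := {u | (∃ C, ∀ n, ‖u n‖ ≤ C) ∧ rotOp u = u}
      add_mem' := by
        rintro u u' ⟨⟨C, hC⟩, h⟩ ⟨⟨C', hC'⟩, h'⟩
        refine ⟨⟨C + C', fun n => (norm_add_le _ _).trans (add_le_add (hC n) (hC' n))⟩, ?_⟩
        rw [map_add, h, h']
      zero_mem' := ⟨⟨0, by simp⟩, map_zero _⟩
      smul_mem' := by
        rintro c u ⟨⟨C, hC⟩, h⟩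
        refine ⟨⟨‖c‖ * C, fun n => ?_⟩, by rw [map_smul, h]⟩
        rw [Pi.smul_apply, norm_smul]
        exact mul_le_mul_of_nonneg_left (hC n) (norm_nonneg _) }
  have hrv : rotAvg v = v := by
    have h1 : rotAvg (bsOp v) = bsOp v := by
      rw [← Module.End.mul_apply, bsOp, ← mul_assoc, ← (commute_hopT_rotAvg.pow_left 4).eq,
        mul_assoc, rotAvg_mul_self]
    rw [hv1, map_smul, h1]
  have hvW : v ∈ W := by
    refine ⟨hvb, ?_⟩
    rw [← hrv, ← Module.End.mul_apply, rotOp_mul_rotAvg]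
  have hW : ∀ u ∈ W, hopT u ∈ W := by
    rintro u ⟨⟨C, hC⟩, h⟩
    refine ⟨⟨3 * C, fun n => ?_⟩, ?_⟩
    · have hC0 : 0 ≤ C := (norm_nonneg _).trans (hC 0)
      rw [hopT, wop_apply, norm_mul]
      have h1 : ‖hop u n‖ ≤ 3 * C := norm_hop_le fun l => hC _
      have h2 : ‖invw 0 n‖ ≤ 1 := by
        rw [invw]
        split_ifs with hn
        · simp
        · rw [add_zero, norm_inv]
          exact inv_le_one_of_one_le₀ (one_le_norm_emb (ne_zero_of_eps_ne_zero hn))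
      calc _ ≤ 1 * (3 * C) := by gcongr
        _ = _ := one_mul _
    · rw [← Module.End.mul_apply, ← commute_hopT_rotOp.eq, Module.End.mul_apply, h]
  obtain ⟨a, ha⟩ := IsAlgClosed.exists_pow_nat_eq z (n := 4) (by norm_num)
  have ha0 : a ≠ 0 := by
    rintro rfl
    exact hz0 (by rw [← ha]; simp)
  obtain ⟨b, hb, w, hw, hw0, hwb⟩ := exists_eigenvector_of_pow_four hopT W hW hvW hv0 ha0 (by
    rw [ha]
    nth_rw 1 [hv1]
    rw [bsOp, Module.End.mul_apply, hrv])
  refine ⟨-I * b, ?_, w, hw0, hw.1, fun n => congrFun hw.2 n, fun n hn => ?_, fun n hn => ?_⟩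
  · rw [mul_pow, hb, ha, neg_pow, Complex.I_pow_four]
    ring
  · rw [hwb, Pi.smul_apply, hopT, wop_apply, invw, if_pos hn, zero_mul, smul_zero]
  · have h0 := emb_ne_zero (ne_zero_of_eps_ne_zero hn)
    have h1 := congrFun hwb n
    rw [Pi.smul_apply, hopT, wop_apply, invw, if_neg hn, add_zero, smul_eq_mul] at h1
    rw [h1]
    field_simp
    linear_combination (b * hop w n) * Complex.I_sq

end BirmanSchwinger

lemma pow_succ_wop_apply (c : ℤ × ℤ → ℂ) (N : ℕ) (u : ℤ × ℤ → ℂ) (n : ℤ × ℤ) :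
    ((wop c) ^ (N + 1)) u n =
      c n * ∑ l ∈ Finset.range 3, ω ^ l * ((wop c) ^ N) u (nbr n l) := by
  rw [pow_succ', Module.End.mul_apply, wop_apply, hop]

/-- Powers of the weighted hopping operator only see sites at bounded distance. -/
lemma wop_pow_local {c c' u u' : ℤ × ℤ → ℂ} (N : ℕ) (m : ℤ × ℤ)
    (hc : ∀ n, ‖emb n - emb m‖ ≤ N → c n = c' n) (hu : ∀ n, ‖emb n - emb m‖ ≤ N → u n = u' n) :
    ((wop c) ^ N) u m = ((wop c') ^ N) u' m := by
  induction N generalizing m with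
  | zero => simpa using hu m (by simp)
  | succ N ih =>
    rw [pow_succ_wop_apply, pow_succ_wop_apply, hc m (by simp; positivity)]
    congr 1
    refine Finset.sum_congr rfl fun l _ => ?_
    have h : ∀ n, ‖emb n - emb (nbr m l)‖ ≤ N → ‖emb n - emb m‖ ≤ (N + 1 : ℕ) := fun n hn => by
      have := norm_add_le (emb n - emb (nbr m l)) (emb (nbr m l) - emb m)
      rw [sub_add_sub_cancel] at this
      have h2 := norm_emb_nbr_sub_le m l
      push_cast
      linarith
    rw [ih _ (fun n hn => hc n (h n hn)) fun n hn => hu n (h n hn)]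

lemma wop_pow_single_eq_zero (c : ℤ × ℤ → ℂ) (N : ℕ) {i j : ℤ × ℤ}
    (h : (N : ℝ) < ‖emb j - emb i‖) : ((wop c) ^ N) (Pi.single j 1) i = 0 := by
  rw [wop_pow_local (c' := c) (u' := 0) N i (fun _ _ => rfl) fun n hn => ?_, map_zero]
  · rfl
  · have : n ≠ j := fun e => by rw [e] at hn; linarith
    simp [this]

/-- Diagonal entries of powers of the weighted hopping operator. -/
def diagv (N : ℕ) (m : ℤ × ℤ) (z : ℂ) : ℂ := ((wop (invw z)) ^ N) (Pi.single m 1) m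

lemma wop_pow_translate {β : ℤ × ℤ} (hβ : eps β = 0) (z : ℂ) (N : ℕ) (u : ℤ × ℤ → ℂ)
    (n : ℤ × ℤ) : ((wop (invw z)) ^ N) u (β + n) =
      ((wop (invw (z + emb β))) ^ N) (fun n => u (β + n)) n := by
  induction N generalizing n with
  | zero => rfl
  | succ N ih =>
    rw [pow_succ_wop_apply, pow_succ_wop_apply, invw, invw, eps_add_of_eps_eq_zero hβ, emb_add,
      show emb β + emb n + z = emb n + (z + emb β) by ring]
    congr 1
    refine Finset.sum_congr rfl fun l _ => ?_
    rw [nbr_add_of_eps_eq_zero hβ, ih]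

lemma diagv_translate {β : ℤ × ℤ} (hβ : eps β = 0) (N : ℕ) (m : ℤ × ℤ) (z : ℂ) :
    diagv N (β + m) z = diagv N m (z + emb β) := by
  rw [diagv, wop_pow_translate hβ, diagv]
  have h : (fun n => (Pi.single (β + m) 1 : ℤ × ℤ → ℂ) (β + n)) = Pi.single m 1 :=
    funext fun n => by simp [Pi.single_apply]
  rw [h]

/-- The field of algebraic numbers. -/
abbrev AlgNum := algebraicClosure ℚ ℂ

lemma omega_mem : ω ∈ AlgNum := by
  rw [mem_algebraicClosure_iff']
  exact IsAlgebraic.isIntegral ⟨Polynomial.X ^ 3 - 1, by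
    intro h
    have := congrArg (Polynomial.eval 0) h
    norm_num at this, by simp [omega_pow_three]⟩

lemma I_mem : I ∈ AlgNum := by
  rw [mem_algebraicClosure_iff']
  exact IsAlgebraic.isIntegral ⟨Polynomial.X ^ 2 + 1, by
    intro h
    have := congrArg (Polynomial.eval 0) h
    norm_num at this, by simp⟩

lemma emb_mem (n : ℤ × ℤ) : emb n ∈ AlgNum :=
  add_mem (intCast_mem _ _) (mul_mem (intCast_mem _ _) omega_mem)

lemma invw_zero_mem (n : ℤ × ℤ) : invw 0 n ∈ AlgNum := by
  unfold invw
  split_ifs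
  · exact zero_mem _
  · rw [add_zero]; exact inv_mem (emb_mem n)

lemma wop_pow_mem {c u : ℤ × ℤ → ℂ} (hc : ∀ n, c n ∈ AlgNum) (hu : ∀ n, u n ∈ AlgNum) (N : ℕ)
    (n : ℤ × ℤ) : ((wop c) ^ N) u n ∈ AlgNum := by
  induction N generalizing n with
  | zero => exact hu n
  | succ N ih =>
    rw [pow_succ_wop_apply]
    exact mul_mem (hc n) (sum_mem fun l _ => mul_mem (pow_mem omega_mem l) (ih _))

/-- Points at which all weights are defined. -/
def regSet : Set ℂ := {z | ∀ n, eps n ≠ 0 → emb n + z ≠ 0}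

/-- The elementary fractions with poles in the non-central sites. -/
def elemFrac (p : {n : ℤ × ℤ // eps n ≠ 0} × ℕ) (z : regSet) : ℂ :=
  ((emb p.1 + z) ^ (p.2 + 1))⁻¹

/-- The span of elementary fractions over the algebraic numbers. -/
def fracSpan : Submodule AlgNum (regSet → ℂ) := Submodule.span AlgNum (Set.range elemFrac)

lemma elemFrac_mem (p : {n : ℤ × ℤ // eps n ≠ 0} × ℕ) : elemFrac p ∈ fracSpan :=
  Submodule.subset_span ⟨p, rfl⟩

lemma elemFrac_mul_mem (s t : {n : ℤ × ℤ // eps n ≠ 0}) (r : ℕ) :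
    (fun z => elemFrac (s, r) z * elemFrac (t, 0) z) ∈ fracSpan := by
  by_cases hst : s = t
  · subst hst
    convert elemFrac_mem (s, r + 1) using 1
    funext z
    simp only [elemFrac]
    rw [← mul_inv, ← pow_add]
  have hne : emb t.1 - emb s.1 ≠ 0 := by
    rw [← emb_sub]
    exact emb_ne_zero (sub_ne_zero.2 fun e => hst (Subtype.ext e.symm))
  have hmem : (emb t.1 - emb s.1)⁻¹ ∈ AlgNum := inv_mem (sub_mem (emb_mem _) (emb_mem _))
  induction r with
  | zero =>
    convert fracSpan.smul_mem ⟨_, hmem⟩ (fracSpan.sub_mem (elemFrac_mem (s, 0))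
      (elemFrac_mem (t, 0))) using 1
    funext z
    have h1 := z.2 s s.2
    have h2 := z.2 t t.2
    simp only [elemFrac, Pi.smul_apply, Pi.sub_apply, Algebra.smul_def, zero_add, pow_one,
      IntermediateField.algebraMap_apply]
    field_simp
    ring
  | succ r ih =>
    convert fracSpan.smul_mem ⟨_, hmem⟩ (fracSpan.sub_mem (elemFrac_mem (s, r + 1)) ih) using 1
    funext z
    have h1 := z.2 s s.2
    have h2 := z.2 t t.2
    simp only [elemFrac, Pi.smul_apply, Pi.sub_apply, Algebra.smul_def, zero_add, pow_one,
      IntermediateField.algebraMap_apply]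
    field_simp
    ring

lemma mul_elemFrac_mem {g : regSet → ℂ} (hg : g ∈ fracSpan) (t : {n : ℤ × ℤ // eps n ≠ 0}) :
    (fun z => g z * elemFrac (t, 0) z) ∈ fracSpan := by
  induction hg using Submodule.span_induction with
  | mem x h =>
    obtain ⟨⟨s, r⟩, rfl⟩ := h
    exact elemFrac_mul_mem s t r
  | zero =>
    convert fracSpan.zero_mem using 1
    funext z
    simp
  | add x y _ _ hx hy =>
    convert fracSpan.add_mem hx hy using 1
    funext z
    simp [add_mul]
  | smul a x _ hx =>
    convert fracSpan.smul_mem a hx using 1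
    funext z
    simp [Algebra.smul_def, mul_assoc]

lemma algNum_smul_apply (a : AlgNum) (g : regSet → ℂ) (z : regSet) :
    (a • g) z = (a : ℂ) * g z := rfl

lemma invw_mul_sum_mem_fracSpan (n : ℤ × ℤ) (g : regSet → ℕ → ℂ)
    (hg : ∀ l, ∀ h : eps n ≠ 0, (fun z => g z l * elemFrac (⟨n, h⟩, 0) z) ∈ fracSpan) :
    (fun z : regSet => invw z n * ∑ l ∈ Finset.range 3, ω ^ l * g z l) ∈ fracSpan := by
  by_cases h : eps n = 0
  · convert fracSpan.zero_mem using 1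
    funext z
    simp [invw, h]
  convert fracSpan.sum_mem (t := Finset.range 3) fun l _ =>
    fracSpan.smul_mem (⟨ω ^ l, pow_mem omega_mem l⟩ : AlgNum) (hg l h) using 1
  funext z
  simp only [invw, if_neg h, Finset.mul_sum, Finset.sum_apply, algNum_smul_apply, elemFrac]
  refine Finset.sum_congr rfl fun l _ => ?_
  ring

lemma wop_pow_mem_fracSpan {u : ℤ × ℤ → ℂ} (hu : ∀ n, u n ∈ AlgNum) (N : ℕ) (n : ℤ × ℤ) :
    (fun z : regSet => ((wop (invw z)) ^ (N + 1)) u n) ∈ fracSpan := by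
  induction N generalizing n with
  | zero =>
    simp only [pow_succ_wop_apply]
    refine invw_mul_sum_mem_fracSpan n (fun z l => ((wop (invw z)) ^ 0) u (nbr n l)) fun l h => ?_
    exact fracSpan.smul_mem ⟨_, hu (nbr n l)⟩ (elemFrac_mem (⟨n, h⟩, 0))
  | succ N ih =>
    simp only [pow_succ_wop_apply _ (N + 1)]
    exact invw_mul_sum_mem_fracSpan n (fun z l => ((wop (invw z)) ^ (N + 1)) u (nbr n l))
      fun l h => mul_elemFrac_mem (ih _) _

/-- The sum of the diagonal entries at the two non-central sites of a cell. -/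
def cellv (N : ℕ) (z : ℂ) : ℂ := diagv N (1, 0) z + diagv N (-1, 0) z

lemma exists_cellv_eq (N : ℕ) : ∃ c : ({n : ℤ × ℤ // eps n ≠ 0} × ℕ) →₀ AlgNum, ∀ z ∈ regSet,
    cellv (N + 1) z = ∑ j ∈ c.support, (c j : ℂ) * ((emb j.1 + z) ^ (j.2 + 1))⁻¹ := by
  have hs : ∀ m n : ℤ × ℤ, (Pi.single m 1 : ℤ × ℤ → ℂ) n ∈ AlgNum := fun m n => by
    rw [Pi.single_apply]
    split_ifs
    · exact one_mem _
    · exact zero_mem _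
  have h := fracSpan.add_mem (wop_pow_mem_fracSpan (hs (1, 0)) N (1, 0))
    (wop_pow_mem_fracSpan (hs (-1, 0)) N (-1, 0))
  obtain ⟨c, hc⟩ := (Finsupp.mem_span_range_iff_exists_finsupp).1 h
  refine ⟨c, fun z hz => ?_⟩
  have h2 := congrFun hc ⟨z, hz⟩
  simp only [Finsupp.sum, Finset.sum_apply, algNum_smul_apply, elemFrac] at h2
  exact h2.symm

section FiniteSection

open Polynomial Asymptotics Filter Topology

/-- The incidence weight between two sites. -/
def hopW (i j : ℤ × ℤ) : ℂ := ∑ l ∈ Finset.range 3, if nbr i l = j then ω ^ l else 0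

variable (F : Finset (ℤ × ℤ))

/-- The finite section of the weighted hopping operator. -/
def secMat (z : ℂ) : Matrix F F ℂ := Matrix.of fun i j => (emb i + z)⁻¹ * hopW i j

/-- The weights restricted to a finite set. -/
def secw (z : ℂ) (n : ℤ × ℤ) : ℂ := if n ∈ F then (emb n + z)⁻¹ else 0

lemma secMat_pow (z : ℂ) (k : ℕ) (i j : F) :
    (secMat F z ^ k) i j = ((wop (secw F z)) ^ k) (Pi.single (j : ℤ × ℤ) 1) i := by
  have hsupp : ∀ k, ∀ n ∉ F, ((wop (secw F z)) ^ k) (Pi.single (j : ℤ × ℤ) 1) n = 0 := by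
    intro k n hn
    cases k with
    | zero =>
      have : n ≠ j := fun e => hn (e ▸ j.2)
      simp [this]
    | succ k => rw [pow_succ_wop_apply, secw, if_neg hn, zero_mul]
  induction k generalizing i with
  | zero =>
    rw [pow_zero, pow_zero, Module.End.one_apply, Matrix.one_apply, Pi.single_apply]
    simp only [Subtype.ext_iff]
  | succ k ih =>
    rw [pow_succ', Matrix.mul_apply, pow_succ_wop_apply, secw, if_pos i.2]
    have hM : ∀ l, secMat F z i l = (emb i + z)⁻¹ * hopW i l := fun _ => rfl
    simp only [ih, hM, hopW, Finset.mul_sum, Finset.sum_mul]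
    rw [Finset.sum_comm]
    refine Finset.sum_congr rfl fun l _ => ?_
    by_cases hl : nbr i l ∈ F
    · rw [Finset.sum_eq_single (⟨nbr i l, hl⟩ : F)]
      · simp [mul_assoc]
      · intro b _ hb
        rw [if_neg fun e => hb (Subtype.ext e.symm)]
        simp
      · simp
    · rw [hsupp k _ hl, mul_zero, mul_zero]
      refine Finset.sum_eq_zero fun x _ => ?_
      rw [if_neg fun e : nbr i l = x => hl (e ▸ x.2)]
      simp

/-- The characteristic polynomial of a finite section, with the denominators cleared, as a
polynomial in two variables. -/
def secDet : ℂ[X][X] :=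
  (Matrix.of fun i j : F => (if i = j then C (X + C (emb i)) else 0) -
    X * C (C (hopW i j)) : Matrix F F ℂ[X][X]).det

lemma secDet_map (z : ℂ) : (secDet F).map (evalRingHom z) =
    (Matrix.of fun i j : F => (if i = j then C (z + emb i) else 0) -
      X * C (hopW i j) : Matrix F F ℂ[X]).det := by
  rw [secDet, ← coe_mapRingHom, RingHom.map_det]
  congr 1
  ext1 i j
  simp only [RingHom.mapMatrix_apply, Matrix.map_apply, Matrix.of_apply, coe_mapRingHom,
    Polynomial.map_sub, Polynomial.map_mul, map_X, map_C]
  split_ifs <;> simp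

lemma secDet_coeff_eval {z : ℂ} (hz : ∀ i ∈ F, emb i + z ≠ 0) (n : ℕ) :
    ((secDet F).coeff n).eval z = (∏ i : F, (emb i + z)) * detCoeff (secMat F z) n := by
  have h1 : (Matrix.of fun i j : F => (if i = j then C (z + emb i) else 0) -
      X * C (hopW i j) : Matrix F F ℂ[X]) =
      Matrix.diagonal (fun i : F => C (emb i + z)) * oneSubX (secMat F z) := by
    ext1 i j
    rw [Matrix.diagonal_mul]
    simp only [oneSubX, secMat, Matrix.of_apply, Matrix.sub_apply, Matrix.one_apply,
      Matrix.smul_apply, Matrix.map_apply, smul_eq_mul, mul_sub, mul_left_comm _ X, ← C_mul]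
    rw [mul_inv_cancel_left₀ (hz i i.2), add_comm z]
    split_ifs <;> simp
  have h2 := congrArg (fun p : ℂ[X] => p.coeff n) (secDet_map F z)
  simp only [coeff_map, coe_evalRingHom] at h2
  rw [h2, h1, Matrix.det_mul, Matrix.det_diagonal, ← map_prod, coeff_C_mul, detCoeff]

/-- The finite section is not singular at a centre of symmetry of the finite set. -/
lemma secDet_map_eq_zero (m : ℤ × ℤ) (hm : m ∈ F)
    (hF : ∀ n ∈ F, m + rot (n - m) ∈ F) (hF0 : ∀ n ∈ F, eps n ≠ 0) :
    (secDet F).map (evalRingHom (-emb m)) = 0 := by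
  let σ : ℤ × ℤ → ℤ × ℤ := fun n => m + rot (n - m)
  have hσ3 : ∀ n, σ (σ (σ n)) = n := fun n => by simp [σ, rot_rot_rot]
  let e : Equiv.Perm F := ⟨fun n => ⟨σ n, hF n n.2⟩, fun n => ⟨σ (σ n), hF _ (hF n n.2)⟩,
    fun n => Subtype.ext (hσ3 n), fun n => Subtype.ext (hσ3 n)⟩
  have hβ : eps (m - rot m) = 0 := by
    rw [eps_eq_zero_iff]; simp only [rot, Prod.fst_sub, Prod.snd_sub]; omega
  have hσ : ∀ n, σ n = (m - rot m) + rot n := fun n => by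
    simp only [σ, sub_eq_add_neg, rot_add]
    have : rot (-m) = -rot m := by ext <;> simp [rot]; ring
    rw [this]; abel
  have hinj : Function.Injective σ := fun a b h => by rw [← hσ3 a, h, hσ3]
  have hnbr : ∀ n l, eps n ≠ 0 → σ (nbr n l) = (m - rot m) + (rot n + eps n • rot (dir l)) :=
    fun n l _ => by rw [hσ, nbr_rot]
  have hnbr2 : ∀ n l, nbr (σ n) l = (m - rot m) + (rot n + eps n • dir l) := fun n l => by
    rw [hσ, nbr_add_of_eps_eq_zero hβ, nbr, eps_rot]
  have hW : ∀ i j, eps i ≠ 0 → hopW (σ i) (σ j) = ω * hopW i j := by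
    intro i j hi
    have hh : ∀ l l', rot (dir l) = dir l' → nbr (σ i) l' = σ (nbr i l) := fun l l' hl => by
      rw [hnbr i l hi, hnbr2, hl]
    simp only [hopW, Finset.sum_range_succ, Finset.sum_range_zero, hh 0 1 rot_dir_zero,
      hh 1 2 rot_dir_one, hh 2 0 rot_dir_two, hinj.eq_iff, zero_add]
    have h3 := omega_pow_three
    split_ifs <;> first | ring1 | linear_combination -h3
  rw [secDet_map]
  refine Polynomial.funext fun y => ?_
  rw [← coe_evalRingHom, RingHom.map_det, coe_evalRingHom, eval_zero]
  set A : Matrix F F ℂ := Matrix.of fun i j : F =>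
    (if i = j then -emb m + emb i else 0) - y * hopW i j with hA
  have h1 : (evalRingHom y).mapMatrix (Matrix.of fun i j : F =>
      (if i = j then C (-emb m + emb i) else 0) - X * C (hopW i j)) = A := by
    ext1 i j
    simp only [RingHom.mapMatrix_apply, Matrix.map_apply, Matrix.of_apply, hA, coe_evalRingHom,
      eval_sub, eval_mul, eval_X, eval_C]
    split_ifs <;> simp
  rw [h1]
  have h2 : A.submatrix e e = ω • A := by
    ext1 i j
    simp only [Matrix.submatrix_apply, hA, Matrix.of_apply, Matrix.smul_apply, smul_eq_mul]
    have he : ∀ i, ((e i : F) : ℤ × ℤ) = σ i := fun i => rfl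
    simp only [he, hW i j (hF0 i i.2), e.injective.eq_iff]
    have h3 : emb (σ i) = emb m + ω * (emb i - emb m) := by
      simp only [σ]; rw [emb_add, emb_rot, emb_sub]
    rw [h3]
    split_ifs <;> ring
  have hcard : ω ^ Fintype.card F = ω := by
    let e' : Function.End F := fun x => e x
    have h3 : e' ^ 3 ^ 1 = 1 := funext fun n => Subtype.ext (hσ3 n)
    have : Fact (Nat.Prime 3) := ⟨Nat.prime_three⟩
    have h4 := Equiv.Perm.card_fixedPoints_modEq h3
    have h5 : Fintype.card (Function.fixedPoints e') = 1 := by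
      rw [Fintype.card_eq_one_iff]
      refine ⟨⟨⟨m, hm⟩, Subtype.ext (show m + rot (m - m) = m by simp [rot])⟩, ?_⟩
      rintro ⟨n, hn⟩
      have h6 : m + rot (n - m) = n := congrArg Subtype.val hn
      have h7 : rot ((n : ℤ × ℤ) - m) = n - m := eq_sub_of_add_eq' h6
      have h8 := congrArg Prod.fst h7
      have h9 := congrArg Prod.snd h7
      simp only [rot, Prod.fst_sub, Prod.snd_sub] at h8 h9
      refine Subtype.ext (Subtype.ext (Prod.ext ?_ ?_)) <;> simp only <;> omega
    rw [h5] at h4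
    have h6 : Fintype.card F % 3 = 1 := h4
    rw [← Nat.div_add_mod (Fintype.card F) 3, h6, pow_add, pow_mul, omega_pow_three]
    simp
  have h3 := Matrix.det_submatrix_equiv_self e A
  rw [h2, Matrix.det_smul, hcard] at h3
  have h4 : (ω - 1) * A.det = 0 := by linear_combination h3
  simpa using (mul_eq_zero.1 h4).resolve_left (sub_ne_zero.2 omega_ne_one)

lemma isBigO_detCoeff (m : ℤ × ℤ) (hm : m ∈ F)
    (hF : ∀ n ∈ F, m + rot (n - m) ∈ F) (hF0 : ∀ n ∈ F, eps n ≠ 0) (n : ℕ) :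
    (fun z => detCoeff (secMat F z) n) =O[𝓝[≠] (-emb m)] fun _ => (1 : ℝ) := by
  have h0 := congrArg (fun p : ℂ[X] => p.coeff n) (secDet_map_eq_zero F m hm hF hF0)
  simp only [coeff_map, coe_evalRingHom, coeff_zero] at h0
  obtain ⟨g, hg⟩ := dvd_iff_isRoot.2 h0
  have hne : ∀ i ∈ F.erase m, emb i + -emb m ≠ 0 := fun i hi => by
    rw [← sub_eq_add_neg, ← emb_sub]
    exact emb_ne_zero (sub_ne_zero.2 (Finset.ne_of_mem_erase hi))
  have hc : ContinuousAt (fun z => g.eval z / ∏ i ∈ F.erase m, (emb i + z)) (-emb m) := by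
    refine g.continuous.continuousAt.div (by fun_prop) ?_
    exact Finset.prod_ne_zero_iff.2 hne
  have hO : (fun z => g.eval z / ∏ i ∈ F.erase m, (emb i + z)) =O[𝓝[≠] (-emb m)]
      fun _ => (1 : ℝ) :=
    (hc.tendsto.mono_left nhdsWithin_le_nhds).isBigO_one ℝ
  refine hO.congr' ?_ EventuallyEq.rfl
  have hev : ∀ᶠ z in 𝓝[≠] (-emb m), ∀ i ∈ F.erase m, emb i + z ≠ 0 := by
    refine nhdsWithin_le_nhds ?_
    refine (Finset.eventually_all _).2 ?_
    exact fun i hi => ContinuousAt.eventually_ne (by fun_prop) (hne i hi)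
  filter_upwards [hev, self_mem_nhdsWithin] with z hz hzm
  have hzm' : emb m + z ≠ 0 := fun h => hzm (by
    rw [Set.mem_singleton_iff]; linear_combination h)
  have hall : ∀ i ∈ F, emb i + z ≠ 0 := fun i hi => by
    by_cases him : i = m
    · rwa [him]
    · exact hz i (Finset.mem_erase.2 ⟨him, hi⟩)
  have h1 := secDet_coeff_eval F hall n
  rw [hg, eval_mul, Finset.prod_coe_sort F (fun i => emb i + z), ← Finset.mul_prod_erase F _ hm] at h1
  simp only [eval_sub, eval_X, eval_C, sub_neg_eq_add] at h1
  rw [div_eq_iff (Finset.prod_ne_zero_iff.2 hz)]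
  refine mul_left_cancel₀ hzm' ?_
  linear_combination h1

lemma isBigO_trace_secMat (m : ℤ × ℤ) (hm : m ∈ F)
    (hF : ∀ n ∈ F, m + rot (n - m) ∈ F) (hF0 : ∀ n ∈ F, eps n ≠ 0) (k : ℕ) :
    (fun z => (secMat F z ^ (k + 1)).trace) =O[𝓝[≠] (-emb m)] fun _ => (1 : ℝ) := by
  have hd := isBigO_detCoeff F m hm hF hF0
  induction k using Nat.strong_induction_on with
  | _ k ih =>
    have h1 : (fun z => -((k : ℂ) + 1) * detCoeff (secMat F z) (k + 1) -
        ∑ i ∈ Finset.range k, detCoeff (secMat F z) (i + 1) *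
          (secMat F z ^ (k - (i + 1) + 1)).trace) =O[𝓝[≠] (-emb m)] fun _ => (1 : ℝ) := by
      refine ((hd (k + 1)).const_mul_left _).sub (IsBigO.fun_sum fun i hi => ?_)
      simpa using (hd (i + 1)).mul (ih (k - (i + 1)) (by
        have := Finset.mem_range.1 hi; omega))
    refine h1.congr_left fun z => ?_
    have h2 := fredCoeff_succ (fun k => (secMat F z ^ k).trace) k
    rw [← detCoeff_eq_fredCoeff, Finset.sum_range_succ', detCoeff_zero] at h2
    have h3 : ∑ i ∈ Finset.range k, detCoeff (secMat F z) (i + 1) *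
        (secMat F z ^ (k - (i + 1) + 1)).trace = ∑ i ∈ Finset.range k,
        detCoeff (secMat F z) (i + 1) * (secMat F z ^ (k + 1 - (i + 1))).trace := by
      refine Finset.sum_congr rfl fun i hi => ?_
      rw [show k - (i + 1) + 1 = k + 1 - (i + 1) by have := Finset.mem_range.1 hi; omega]
    rw [h3]
    simp only [Nat.sub_zero, one_mul] at h2
    linear_combination -h2

end FiniteSection

lemma finite_norm_emb_le (R : ℝ) : {n : ℤ × ℤ | ‖emb n‖ ≤ R}.Finite := by
  obtain ⟨M, hM⟩ := exists_nat_ge (2 * R ^ 2)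
  refine (((Set.finite_Icc (-M : ℤ) M).prod (Set.finite_Icc (-M : ℤ) M))).subset fun n hn => ?_
  have h1 : ((qform n : ℤ) : ℝ) ≤ R ^ 2 := by
    rw [← norm_emb_sq]
    exact pow_le_pow_left₀ (norm_nonneg _) hn 2
  have h2 : 2 * qform n ≤ (M : ℤ) := by
    have : (2 * qform n : ℝ) ≤ M := by linarith
    exact_mod_cast this
  simp only [qform] at h2
  simp only [Set.mem_prod, Set.mem_Icc]
  refine ⟨⟨?_, ?_⟩, ?_, ?_⟩ <;> nlinarith [sq_nonneg (n.1 - n.2), sq_nonneg (n.1 + n.2),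
    sq_nonneg (2 * n.1 - n.2), sq_nonneg (2 * n.2 - n.1), Int.le_self_sq n.1, Int.le_self_sq n.2,
    Int.le_self_sq (-n.1), Int.le_self_sq (-n.2)]

lemma finite_norm_emb_sub_le (m : ℤ × ℤ) (R : ℝ) : {n : ℤ × ℤ | ‖emb n - emb m‖ ≤ R}.Finite := by
  refine (finite_norm_emb_le (R + ‖emb m‖)).subset fun n hn => ?_
  have := norm_add_le (emb n - emb m) (emb m)
  rw [sub_add_cancel] at this
  exact this.trans (by gcongr; exact hn)

section ClassSums

open Polynomial Asymptotics Filter Topology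

lemma continuousAt_wop_pow {c : ℂ → ℤ × ℤ → ℂ} {z₀ : ℂ} (u : ℤ × ℤ → ℂ) (N : ℕ) (n : ℤ × ℤ)
    (hc : ∀ n', ‖emb n' - emb n‖ ≤ N → ContinuousAt (fun z => c z n') z₀) :
    ContinuousAt (fun z => ((wop (c z)) ^ N) u n) z₀ := by
  induction N generalizing n with
  | zero => exact continuousAt_const
  | succ N ih =>
    simp only [pow_succ_wop_apply]
    refine (hc n (by simp; positivity)).mul ?_
    have : ∀ l, ContinuousAt (fun z => ω ^ l * ((wop (c z)) ^ N) u (nbr n l)) z₀ := fun l => by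
      refine continuousAt_const.mul (ih _ fun n' hn' => hc n' ?_)
      have h1 := norm_add_le (emb n' - emb (nbr n l)) (emb (nbr n l) - emb n)
      rw [sub_add_sub_cancel] at h1
      have h2 := norm_emb_nbr_sub_le n l
      push_cast
      linarith
    exact tendsto_finsetSum _ fun l _ => this l

lemma continuousAt_invw {m n : ℤ × ℤ} (h : n ≠ m) : ContinuousAt (fun z => invw z n) (-emb m) := by
  unfold invw
  split_ifs
  · exact continuousAt_const
  · refine ContinuousAt.inv₀ (by fun_prop) ?_
    rw [← sub_eq_add_neg, ← emb_sub]
    exact emb_ne_zero (sub_ne_zero.2 h)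

/-- Sums of diagonal entries over a large set of sites are bounded near each pole. -/
lemma isBigO_sum_diagv {m : ℤ × ℤ} (hm : eps m ≠ 0) (k : ℕ) (G : Finset (ℤ × ℤ))
    (hG : ∀ n, eps n ≠ 0 → ‖emb n - emb m‖ ≤ (k + 1 : ℕ) → n ∈ G) (hG0 : ∀ n ∈ G, eps n ≠ 0) :
    (fun z => ∑ n ∈ G, diagv (k + 1) n z) =O[𝓝[≠] (-emb m)] fun _ => (1 : ℝ) := by
  classical
  set F : Finset (ℤ × ℤ) :=
    (finite_norm_emb_sub_le m (2 * (k + 1 : ℕ))).toFinset.filter fun n => eps n ≠ 0 with hFdef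
  have hFm : ∀ n, n ∈ F ↔ ‖emb n - emb m‖ ≤ 2 * (k + 1 : ℕ) ∧ eps n ≠ 0 := fun n => by
    simp [hFdef]
  set B := F.filter fun n => ‖emb n - emb m‖ ≤ (k + 1 : ℕ) with hB
  have hsub : B ⊆ G := fun n hn => by
    obtain ⟨h1, h2⟩ := Finset.mem_filter.1 hn
    exact hG n ((hFm n).1 h1).2 h2
  have hone : ∀ {f : ℂ → ℂ}, ContinuousAt f (-emb m) → f =O[𝓝[≠] (-emb m)] fun _ => (1 : ℝ) :=
    fun hf => (hf.tendsto.mono_left nhdsWithin_le_nhds).isBigO_one ℝ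
  have hdist : ∀ {n n' : ℤ × ℤ}, (k + 1 : ℕ) < ‖emb n - emb m‖ →
      ‖emb n' - emb n‖ ≤ (k + 1 : ℕ) → n' ≠ m := fun h1 h2 e => by
    rw [e, norm_sub_rev] at h2; linarith
  have htr := isBigO_trace_secMat F m ((hFm m).2 ⟨by simp; positivity, hm⟩)
    (fun n hn => by
      rw [hFm] at hn ⊢
      refine ⟨?_, ?_⟩
      · rw [emb_add, emb_rot, add_sub_cancel_left, norm_mul, norm_omega, one_mul, emb_sub]
        exact hn.1
      · have h1 := hn.2
        contrapose! h1
        rw [eps_eq_zero_iff] at h1 ⊢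
        simp only [rot, Prod.fst_add, Prod.snd_add, Prod.fst_sub, Prod.snd_sub] at h1
        omega)
    (fun n hn => ((hFm n).1 hn).2) k
  have hfar1 : (fun z => ∑ n ∈ F \ B, ((wop (secw F z)) ^ (k + 1)) (Pi.single n 1) n)
      =O[𝓝[≠] (-emb m)] fun _ => (1 : ℝ) := by
    refine IsBigO.fun_sum fun n hn => hone (continuousAt_wop_pow _ _ _ fun n' hn' => ?_)
    obtain ⟨h1, h2⟩ := Finset.mem_sdiff.1 hn
    have h3 : (k + 1 : ℕ) < ‖emb n - emb m‖ := by
      by_contra h; exact h2 (Finset.mem_filter.2 ⟨h1, not_lt.1 h⟩)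
    unfold secw
    split_ifs
    · refine ContinuousAt.inv₀ (by fun_prop) ?_
      rw [← sub_eq_add_neg, ← emb_sub]
      exact emb_ne_zero (sub_ne_zero.2 (hdist h3 hn'))
    · exact continuousAt_const
  have hfar2 : (fun z => ∑ n ∈ G \ B, diagv (k + 1) n z) =O[𝓝[≠] (-emb m)] fun _ => (1 : ℝ) := by
    refine IsBigO.fun_sum fun n hn => hone (continuousAt_wop_pow _ _ _ fun n' hn' => ?_)
    obtain ⟨h1, h2⟩ := Finset.mem_sdiff.1 hn
    refine continuousAt_invw (hdist (n := n) ?_ hn')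
    by_contra h
    exact h2 (Finset.mem_filter.2 ⟨(hFm n).2 ⟨(not_lt.1 h).trans (by push_cast; linarith), hG0 n h1⟩,
      not_lt.1 h⟩)
  refine (hfar2.add (htr.sub hfar1)).congr_left fun z => ?_
  have h1 : (secMat F z ^ (k + 1)).trace =
      ∑ n ∈ F, ((wop (secw F z)) ^ (k + 1)) (Pi.single n 1) n := by
    rw [Matrix.trace, ← Finset.sum_coe_sort F]
    exact Finset.sum_congr rfl fun n _ => by rw [Matrix.diag_apply, secMat_pow]
  have h2 : ∀ n ∈ B, ((wop (secw F z)) ^ (k + 1)) (Pi.single n 1) n = diagv (k + 1) n z := by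
    intro n hn
    refine wop_pow_local _ _ (fun n' hn' => ?_) fun _ _ => rfl
    have h3 := (Finset.mem_filter.1 hn).2
    have h4 := norm_add_le (emb n' - emb n) (emb n - emb m)
    rw [sub_add_sub_cancel] at h4
    by_cases h0 : eps n' = 0
    · rw [secw, if_neg fun h => ((hFm n').1 h).2 h0, invw, if_pos h0]
    · rw [secw, if_pos ((hFm n').2 ⟨by linarith, h0⟩), invw, if_neg h0]
  rw [h1, ← Finset.sum_sdiff (Finset.filter_subset _ F : B ⊆ F), add_sub_cancel_left,
    Finset.sum_congr rfl h2, Finset.sum_sdiff hsub]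

lemma sum_eq_zero_of_isBigO {ι : Type*} (J : Finset ι) (c : ι → ℂ) (r : ι → ℕ) (z₀ : ℂ)
    (h : (fun z => ∑ j ∈ J, c j * ((z - z₀) ^ (r j + 1))⁻¹) =O[𝓝[≠] z₀] fun _ => (1 : ℝ)) (k : ℕ) :
    ∑ j ∈ J with r j = k, c j = 0 := by
  set p : ℂ[X] := ∑ j ∈ J, C (c j) * X ^ (r j + 1) with hp
  have h1 : ∀ z, p.eval ((z - z₀)⁻¹) = ∑ j ∈ J, c j * ((z - z₀) ^ (r j + 1))⁻¹ := fun z => by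
    simp [hp, eval_finsetSum]
  have hdeg : p.degree ≤ 0 := by
    by_contra hd
    have h2 : Tendsto (fun z => ‖(z - z₀)⁻¹‖) (𝓝[≠] z₀) atTop := by
      simp only [norm_inv]
      refine tendsto_inv_nhdsGT_zero.comp (tendsto_norm_sub_self_nhdsNE z₀)
    have h3 := p.tendsto_norm_atTop (not_le.1 hd) h2
    simp only [h1] at h3
    rw [isBigO_one_iff] at h
    exact not_isBoundedUnder_of_tendsto_atTop h3 h
  have h2 : p.coeff (k + 1) = 0 :=
    coeff_eq_zero_of_degree_lt (hdeg.trans_lt (by exact_mod_cast Nat.succ_pos k))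
  rw [hp, finsetSum_coeff] at h2
  rw [Finset.sum_filter]
  refine (Finset.sum_congr rfl fun j _ => ?_).trans h2
  rw [coeff_C_mul, coeff_X_pow]
  simp [eq_comm]

/-- In a decomposition of `cellv` into elementary fractions, the coefficients over each class of
poles sum to zero. -/
lemma sum_class_eq_zero {ι : Type*} (k : ℕ) (J : Finset ι) (c : ι → ℂ) (s : ι → ℤ × ℤ)
    (r : ι → ℕ) (hrep : ∀ z ∈ regSet,
      cellv (k + 1) z = ∑ j ∈ J, c j * ((emb (s j) + z) ^ (r j + 1))⁻¹)
    {m : ℤ × ℤ} (hm : eps m ≠ 0) (q : ℕ) :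
    ∑ j ∈ J with eps (s j) = eps m ∧ r j = q, c j = 0 := by
  classical
  have hone : ∀ {f : ℂ → ℂ}, ContinuousAt f (-emb m) → f =O[𝓝[≠] (-emb m)] fun _ => (1 : ℝ) :=
    fun hf => (hf.tendsto.mono_left nhdsWithin_le_nhds).isBigO_one ℝ
  set R : ℝ := (k + 1 : ℕ) + ‖emb m‖ + 1 + ∑ j ∈ J, ‖emb (m - s j)‖ with hR
  have hRs : 0 ≤ ∑ j ∈ J, ‖emb (m - s j)‖ := Finset.sum_nonneg fun _ _ => norm_nonneg _
  set B : Finset (ℤ × ℤ) := (finite_norm_emb_le R).toFinset.filter fun n => eps n = 0 with hBdef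
  have hB : ∀ n, n ∈ B ↔ ‖emb n‖ ≤ R ∧ eps n = 0 := fun n => by simp [hBdef]
  set G : Finset (ℤ × ℤ) := (B.map (addRightEmbedding (1, 0))) ∪
    (B.map (addRightEmbedding (-1, 0))) with hGdef
  have e1 : ∀ n, eps n = 0 → eps (n + (1, 0)) = 1 := fun n h => by
    rw [eps_add_of_eps_eq_zero h]; decide
  have e2 : ∀ n, eps n = 0 → eps (n + (-1, 0)) = -1 := fun n h => by
    rw [eps_add_of_eps_eq_zero h]; decide
  have hdisj : Disjoint (B.map (addRightEmbedding (1, 0))) (B.map (addRightEmbedding (-1, 0))) := by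
    rw [Finset.disjoint_left]
    intro n h1 h2
    obtain ⟨a, ha, rfl⟩ := Finset.mem_map.1 h1
    obtain ⟨b, hb, hab⟩ := Finset.mem_map.1 h2
    have h3 := e1 a ((hB a).1 ha).2
    have h4 := e2 b ((hB b).1 hb).2
    simp only [addRightEmbedding_apply] at hab
    rw [hab, h3] at h4
    norm_num at h4
  have hsum : ∀ z, ∑ n ∈ G, diagv (k + 1) n z = ∑ β ∈ B, cellv (k + 1) (z + emb β) := by
    intro z
    rw [hGdef, Finset.sum_union hdisj, Finset.sum_map, Finset.sum_map, ← Finset.sum_add_distrib]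
    refine Finset.sum_congr rfl fun β hβ => ?_
    simp only [addRightEmbedding_apply]
    rw [diagv_translate ((hB β).1 hβ).2, diagv_translate ((hB β).1 hβ).2, cellv]
  have hO := isBigO_sum_diagv hm k G (fun n hn hnm => by
    have hb : ∀ t : ℤ × ℤ, ‖emb t‖ = 1 → ‖emb (n - t)‖ ≤ R := fun t ht => by
      rw [emb_sub]
      have h1 := norm_add_le (emb n - emb m) (emb m)
      rw [sub_add_cancel] at h1
      have h2 := norm_sub_le (emb n) (emb t)
      rw [hR]
      linarith
    rw [hGdef, Finset.mem_union, Finset.mem_map, Finset.mem_map]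
    rcases eps_cases n with h | h | h
    · exact absurd h hn
    · refine Or.inl ⟨n - (1, 0), (hB _).2 ⟨hb _ (by simp [emb]), ?_⟩, by simp⟩
      rw [eps_eq_one_iff] at h
      rw [eps_eq_zero_iff]
      simp only [Prod.fst_sub, Prod.snd_sub]
      omega
    · refine Or.inr ⟨n - (-1, 0), (hB _).2 ⟨hb _ (by simp [emb]), ?_⟩, by simp⟩
      rw [eps_eq_neg_one_iff] at h
      rw [eps_eq_zero_iff]
      simp only [Prod.fst_sub, Prod.snd_sub]
      omega) (fun n hn => by
    rcases Finset.mem_union.1 hn with h | h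
    · obtain ⟨a, ha, rfl⟩ := Finset.mem_map.1 h
      rw [addRightEmbedding_apply, e1 a ((hB a).1 ha).2]
      norm_num
    · obtain ⟨a, ha, rfl⟩ := Finset.mem_map.1 h
      rw [addRightEmbedding_apply, e2 a ((hB a).1 ha).2]
      norm_num)
  simp only [hsum] at hO
  have hreg : ∀ᶠ z in 𝓝[≠] (-emb m), ∀ β ∈ B, z + emb β ∈ regSet := by
    have hball : ∀ᶠ z in 𝓝[≠] (-emb m), ‖z + emb m‖ < 1 := by
      refine nhdsWithin_le_nhds ?_
      have : ContinuousAt (fun z => ‖z + emb m‖) (-emb m) := by fun_prop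
      exact this.eventually_lt continuousAt_const (by simp)
    filter_upwards [hball, self_mem_nhdsWithin] with z hz hzm β hβ n hn h0
    have h1 : z = -emb (n + β) := by rw [emb_add]; linear_combination h0
    by_cases h2 : n + β = m
    · exact hzm (by rw [h1, h2]; rfl)
    · have h3 := one_le_norm_emb (sub_ne_zero.2 (Ne.symm h2))
      rw [emb_sub, sub_eq_neg_add, ← h1] at h3
      linarith
  have hfar : (fun z => ∑ j ∈ J, c j * ∑ β ∈ B.filter (fun β => s j + β ≠ m),
      ((emb (s j + β) + z) ^ (r j + 1))⁻¹) =O[𝓝[≠] (-emb m)] fun _ => (1 : ℝ) := by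
    refine IsBigO.fun_sum fun j _ => (IsBigO.fun_sum fun β hβ => hone ?_).const_mul_left _
    refine ContinuousAt.inv₀ (by fun_prop) (pow_ne_zero _ ?_)
    rw [← sub_eq_add_neg, ← emb_sub]
    exact emb_ne_zero (sub_ne_zero.2 (Finset.mem_filter.1 hβ).2)
  have hmain : (fun z => ∑ j ∈ J with eps (s j) = eps m,
      c j * ((z - (-emb m)) ^ (r j + 1))⁻¹) =O[𝓝[≠] (-emb m)] fun _ => (1 : ℝ) := by
    refine (hO.sub hfar).congr' ?_ EventuallyEq.rfl
    filter_upwards [hreg] with z hz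
    rw [Finset.sum_congr rfl fun β hβ => hrep _ (hz β hβ), Finset.sum_comm,
      ← Finset.sum_sub_distrib, Finset.sum_filter]
    refine Finset.sum_congr rfl fun j hj => ?_
    rw [← Finset.mul_sum, ← mul_sub]
    have h1 : ∑ β ∈ B, ((emb (s j) + (z + emb β)) ^ (r j + 1))⁻¹ =
        ∑ β ∈ B, ((emb (s j + β) + z) ^ (r j + 1))⁻¹ :=
      Finset.sum_congr rfl fun β _ => by rw [emb_add]; ring_nf
    rw [h1, ← Finset.sum_filter_add_sum_filter_not B (fun β => s j + β ≠ m), add_sub_cancel_left]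
    simp only [not_not]
    split_ifs with h2
    · have h3 : B.filter (fun β => s j + β = m) = {m - s j} := by
        ext β
        rw [Finset.mem_filter, Finset.mem_singleton, hB]
        refine ⟨fun h => eq_sub_of_add_eq' h.2, ?_⟩
        rintro rfl
        refine ⟨⟨?_, ?_⟩, by abel⟩
        · have := Finset.single_le_sum (f := fun j => ‖emb (m - s j)‖)
            (fun _ _ => norm_nonneg _) hj
          have h4 := norm_nonneg (emb m)
          have h5 : (0 : ℝ) ≤ (k + 1 : ℕ) := by positivity
          linarith
        · rcases eps_cases m with h | h | h
          · exact absurd h hm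
          · rw [h] at h2
            rw [eps_eq_one_iff] at h h2
            rw [eps_eq_zero_iff]
            simp only [Prod.fst_sub, Prod.snd_sub]
            omega
          · rw [h] at h2
            rw [eps_eq_neg_one_iff] at h h2
            rw [eps_eq_zero_iff]
            simp only [Prod.fst_sub, Prod.snd_sub]
            omega
      rw [h3, Finset.sum_singleton]
      congr 3
      rw [add_sub_cancel]; ring
    · rw [Finset.filter_false_of_mem, Finset.sum_empty, mul_zero]
      intro β hβ h3
      apply h2
      rw [← h3, add_comm, eps_add_of_eps_eq_zero ((hB β).1 hβ).2]
  have := sum_eq_zero_of_isBigO _ c r _ hmain q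
  rwa [Finset.filter_filter] at this

end ClassSums

section Cotangent

open Filter Topology

/-- The regularised sums `∑ (x + ζ)^{-(r + 1)}` over the integers `x`. -/
def latSum (r : ℕ) (ζ : ℂ) : ℂ :=
  if r = 0 then Real.pi * Complex.cot (Real.pi * ζ) else ∑' x : ℤ, (((x : ℂ) + ζ) ^ (r + 1))⁻¹

lemma summable_int_add_pow_inv {r : ℕ} (hr : r ≠ 0) (ζ : ℂ) :
    Summable fun x : ℤ => (((x : ℂ) + ζ) ^ (r + 1))⁻¹ := by
  have := EisensteinSeries.linear_right_summable ζ 1 (k := ((r + 1 : ℕ) : ℤ)) (by omega)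
  refine this.congr fun x => ?_
  rw [zpow_natCast]
  push_cast
  ring_nf

lemma int_add_ne_zero {A : ℂ} (hA : A ∈ integerComplement) (x : ℤ) : (x : ℂ) + A ≠ 0 := by
  rw [add_comm]; exact integerComplement_add_ne_zero hA x

lemma summable_int_add_inv_sub {A B : ℂ} (hA : A ∈ integerComplement) (hB : B ∈ integerComplement) :
    Summable fun x : ℤ => ((x : ℂ) + A)⁻¹ - ((x : ℂ) + B)⁻¹ := by
  have h : Summable fun n : ℤ => (((1 : ℤ) * A + n) * ((1 : ℤ) * B + n))⁻¹ := by
    apply EisensteinSeries.summable_inv_of_isBigO_rpow_inv (a := 2) (by norm_cast)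
    simpa [pow_two] using (EisensteinSeries.linear_inv_isBigO_right 1 B).mul
      (EisensteinSeries.linear_inv_isBigO_right 1 A)
  refine (h.mul_left (B - A)).congr fun x => ?_
  have h1 := int_add_ne_zero hA x
  have h2 := int_add_ne_zero hB x
  have h1' : A + (x : ℂ) ≠ 0 := by rwa [add_comm]
  have h2' : B + (x : ℂ) ≠ 0 := by rwa [add_comm]
  push_cast
  rw [one_mul, one_mul, inv_sub_inv h1 h2, add_comm A, add_comm B, div_eq_mul_inv]
  ring

lemma hasSum_inv_symm {A : ℂ} (hA : A ∈ integerComplement) :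
    HasSum (fun n : ℕ => ((n : ℂ) + A)⁻¹ + (-(n : ℂ) + A)⁻¹)
      (Real.pi * Complex.cot (Real.pi * A) + A⁻¹) := by
  have h := (summable_cotTerm hA).hasSum
  have h2 : ∑' n : ℕ, cotTerm A n = Real.pi * Complex.cot (Real.pi * A) - 1 / A :=
    (cot_series_rep' hA).symm
  rw [h2] at h
  rw [← hasSum_nat_add_iff' 1]
  simp only [Finset.range_one, Finset.sum_singleton, Nat.cast_zero, zero_add, neg_zero]
  have h3 := h.congr_fun (g := fun n : ℕ => (((n + 1 : ℕ) : ℂ) + A)⁻¹ + (-((n + 1 : ℕ) : ℂ) + A)⁻¹)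
    fun n => by
      simp only [cotTerm, one_div]
      push_cast
      rw [add_comm (((A - ((n : ℂ) + 1)))⁻¹)]
      congr 2 <;> ring
  have h4 : Real.pi * Complex.cot (Real.pi * A) + A⁻¹ - (A⁻¹ + A⁻¹) =
      Real.pi * Complex.cot (Real.pi * A) - 1 / A := by rw [one_div]; ring
  rw [h4]
  exact h3

lemma hasSum_latSum_sub (r : ℕ) {A B : ℂ} (hA : A ∈ integerComplement) (hB : B ∈ integerComplement) :
    HasSum (fun x : ℤ => (((x : ℂ) + A) ^ (r + 1))⁻¹ - (((x : ℂ) + B) ^ (r + 1))⁻¹)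
      (latSum r A - latSum r B) := by
  rcases eq_or_ne r 0 with rfl | hr
  · simp only [latSum, if_true, zero_add, pow_one]
    have h := summable_int_add_inv_sub hA hB
    have h1 := h.hasSum.nat_add_neg
    have h2 := (hasSum_inv_symm hA).sub (hasSum_inv_symm hB)
    have h3 := h2.unique (h1.congr_fun fun n => by push_cast; ring)
    simp only [Int.cast_zero, zero_add] at h3
    have h4 : ∑' x : ℤ, (((x : ℂ) + A)⁻¹ - ((x : ℂ) + B)⁻¹) =
        Real.pi * Complex.cot (Real.pi * A) - Real.pi * Complex.cot (Real.pi * B) := by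
      linear_combination -h3
    rw [← h4]
    exact h.hasSum
  · simp only [latSum, if_neg hr]
    exact (summable_int_add_pow_inv hr A).hasSum.sub (summable_int_add_pow_inv hr B).hasSum

lemma latSum_add_intCast (r : ℕ) (ζ : ℂ) (n : ℤ) : latSum r (ζ + n) = latSum r ζ := by
  rcases eq_or_ne r 0 with rfl | hr
  · simp only [latSum, if_true]
    rw [Complex.cot_pi_eq_exp_ratio, Complex.cot_pi_eq_exp_ratio]
    have : Complex.exp (2 * Real.pi * I * (ζ + n)) = Complex.exp (2 * Real.pi * I * ζ) := by
      rw [mul_add, Complex.exp_add, show 2 * (Real.pi : ℂ) * I * n = n * (2 * Real.pi * I) by ring,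
        Complex.exp_int_mul_two_pi_mul_I, mul_one]
    rw [this]
  · simp only [latSum, if_neg hr]
    rw [← (Equiv.addRight n).tsum_eq fun x : ℤ => (((x : ℂ) + ζ) ^ (r + 1))⁻¹]
    refine tsum_congr fun x => ?_
    simp only [Equiv.coe_addRight]
    push_cast
    ring_nf

lemma tendsto_latSum_zero_of_im_atTop {ι : Type*} {l : Filter ι} {z : ι → ℂ}
    (hz : Tendsto (fun i => (z i).im) l atTop) :
    Tendsto (fun i => latSum 0 (z i)) l (𝓝 (-(Real.pi * I))) := by
  simp only [latSum, if_true]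
  have h : Tendsto (fun i => Complex.exp (2 * Real.pi * I * z i)) l (𝓝 0) := by
    rw [tendsto_zero_iff_norm_tendsto_zero]
    simp only [Complex.norm_exp]
    refine Real.tendsto_exp_atBot.comp ?_
    have : ∀ i, (2 * (Real.pi : ℂ) * I * z i).re = -(2 * Real.pi * (z i).im) := by
      intro i; simp
    simp only [this]
    exact tendsto_neg_atTop_atBot.comp (hz.const_mul_atTop (by positivity))
  simp only [Complex.cot_pi_eq_exp_ratio]
  have h2 : Tendsto (fun i => (Real.pi : ℂ) * ((Complex.exp (2 * Real.pi * I * z i) + 1) /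
      (I * (1 - Complex.exp (2 * Real.pi * I * z i))))) l
      (𝓝 ((Real.pi : ℂ) * ((0 + 1) / (I * (1 - 0))))) := by
    refine Tendsto.const_mul _ ((h.add_const 1).div (((h.const_sub 1)).const_mul I) (by simp))
  convert h2 using 2
  simp

lemma tendsto_latSum_zero_of_im_atBot {ι : Type*} {l : Filter ι} {z : ι → ℂ}
    (hz : Tendsto (fun i => (z i).im) l atBot) :
    Tendsto (fun i => latSum 0 (z i)) l (𝓝 (Real.pi * I)) := by
  have h := (tendsto_latSum_zero_of_im_atTop (z := fun i => -z i)
    (by simpa [Function.comp_def] using tendsto_neg_atBot_atTop.comp hz)).neg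
  rw [neg_neg] at h
  refine h.congr fun i => ?_
  simp [latSum, Complex.cot, div_neg]

lemma norm_int_add_pow_inv_le {r : ℕ} (hr : r ≠ 0) {z : ℂ} (h0 : 0 ≤ z.re) (h1 : z.re ≤ 1)
    (him : 1 ≤ |z.im|) (x : ℤ) :
    ‖(((x : ℂ) + z) ^ (r + 1))⁻¹‖ ≤ 3 * ‖(((x : ℂ) + I) ^ (1 + 1))⁻¹‖ := by
  have hz2 : 1 ≤ z.im ^ 2 := by rw [← sq_abs]; nlinarith
  have hn : ‖(x : ℂ) + z‖ ^ 2 = (x + z.re) ^ 2 + z.im ^ 2 := by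
    rw [← Complex.normSq_eq_norm_sq, Complex.normSq_apply]; simp; ring
  have hI : ‖(x : ℂ) + I‖ ^ 2 = (x : ℝ) ^ 2 + 1 := by
    rw [← Complex.normSq_eq_norm_sq, Complex.normSq_apply]; simp; ring
  have hge : 1 ≤ ‖(x : ℂ) + z‖ := by
    by_contra hlt
    push Not at hlt
    nlinarith [norm_nonneg ((x : ℂ) + z), sq_nonneg ((x : ℝ) + z.re)]
  have hpow : ‖(x : ℂ) + z‖ ^ 2 ≤ ‖(x : ℂ) + z‖ ^ (r + 1) :=
    pow_le_pow_right₀ hge (by omega)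
  rw [norm_inv, norm_inv, norm_pow, norm_pow, ← one_div, ← div_eq_mul_inv,
    div_le_div_iff₀ (by positivity) (by rw [hI]; positivity), hI, one_mul]
  nlinarith [sq_nonneg ((x : ℝ) + 2 * z.re)]

lemma tendsto_latSum_of_abs_im_atTop {r : ℕ} (hr : r ≠ 0) {ι : Type*} {l : Filter ι} {z : ι → ℂ}
    (hz : Tendsto (fun i => |(z i).im|) l atTop) :
    Tendsto (fun i => latSum r (z i)) l (𝓝 0) := by
  have hfl : ∀ i, latSum r (z i) = latSum r (z i + ((-⌊(z i).re⌋ : ℤ) : ℂ)) :=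
    fun i => (latSum_add_intCast r _ _).symm
  simp only [hfl]
  simp only [latSum, if_neg hr]
  rw [show (0 : ℂ) = ∑' _ : ℤ, (0 : ℂ) by simp]
  refine tendsto_tsum_of_dominated_convergence
    (bound := fun x : ℤ => 3 * ‖(((x : ℂ) + I) ^ (1 + 1))⁻¹‖)
    ((summable_int_add_pow_inv one_ne_zero I).norm.mul_left 3) ?_ ?_
  · intro x
    rw [tendsto_zero_iff_norm_tendsto_zero]
    have h : Tendsto (fun i => (|(z i).im| ^ (r + 1))⁻¹) l (𝓝 0) :=
      tendsto_inv_atTop_zero.comp ((tendsto_pow_atTop (by omega)).comp hz)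
    refine squeeze_zero' (Eventually.of_forall fun i => norm_nonneg _) ?_ h
    filter_upwards [hz.eventually_ge_atTop 1] with i hi
    rw [norm_inv, norm_pow]
    refine inv_anti₀ (by positivity) (pow_le_pow_left₀ (by positivity) ?_ _)
    refine le_trans (le_of_eq ?_) (Complex.abs_im_le_norm _)
    simp
  · filter_upwards [hz.eventually_ge_atTop 1] with i hi x
    refine norm_int_add_pow_inv_le hr ?_ ?_ (by simpa using hi) x
    · simp [Int.floor_le]
    · have := Int.lt_floor_add_one (z i).re
      rw [Complex.add_re, Complex.intCast_re, Int.cast_neg]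
      linarith

lemma tendsto_sum_Ico_shift {H : ℤ → ℂ} {a b : ℂ} (ha : Tendsto H atTop (𝓝 a))
    (hb : Tendsto H atBot (𝓝 b)) (Q : ℤ) :
    Tendsto (fun N : ℕ => ∑ y ∈ Finset.Ico (-N : ℤ) N, (H (y + Q) - H y)) atTop
      (𝓝 (Q * (a - b))) := by
  have hstep : ∀ Q : ℤ, Tendsto (fun N : ℕ => ∑ y ∈ Finset.Ico (-N : ℤ) N,
      (H (y + (Q + 1)) - H (y + Q))) atTop (𝓝 (a - b)) := by
    intro Q
    have h1 : ∀ N : ℕ, ∑ y ∈ Finset.Ico (-N : ℤ) N, (H (y + (Q + 1)) - H (y + Q)) =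
        H (N + Q) - H (-N + Q) := by
      intro N
      have := Finset.sum_Ico_int_sub N fun y => H (y + Q)
      rw [← neg_inj, ← Finset.sum_neg_distrib, neg_sub, ← this]
      refine Finset.sum_congr rfl fun y _ => ?_
      rw [neg_sub, show y + (Q + 1) = y + 1 + Q by ring]
    simp only [h1]
    refine (ha.comp ?_).sub (hb.comp ?_)
    · exact tendsto_atTop_add_const_right _ _ tendsto_natCast_atTop_atTop
    · exact tendsto_atBot_add_const_right _ _
        (tendsto_neg_atTop_atBot.comp tendsto_natCast_atTop_atTop)
  induction Q using Int.induction_on with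
  | zero => simp
  | succ k ih =>
    refine ((ih.add (hstep k)).congr fun N => ?_).trans (le_of_eq ?_)
    · rw [← Finset.sum_add_distrib]
      exact Finset.sum_congr rfl fun y _ => by ring
    · congr 1; push_cast; ring
  | pred k ih =>
    refine ((ih.sub (hstep (-k - 1))).congr fun N => ?_).trans (le_of_eq ?_)
    · rw [← Finset.sum_sub_distrib]
      refine Finset.sum_congr rfl fun y _ => ?_
      rw [show y + (-(k : ℤ) - 1 + 1) = y + -(k : ℤ) by ring]
      ring
    · congr 1; push_cast; ring

/-- The coordinate of a site along the lattice direction `(1, 2)`. -/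
def zcoord (n : ℤ × ℤ) : ℂ := emb n / emb (1, 2)

/-- The centre with coordinates `x`, `y` in the basis `(1, 2)`, `(-2, -1)`. -/
def centre (p : ℤ × ℤ) : ℤ × ℤ := (p.2 - 2 * p.1, 2 * p.2 - p.1)

/-- The coordinate along `(-2, -1)` of the centre next to a site. -/
def rowIndex (n : ℤ × ℤ) : ℤ := (n.2 - 2 * n.1 + 2 * eps n) / 3

lemma emb_one_two : emb (1, 2) = 1 + 2 * ω := by simp [emb]

lemma emb_one_two_sq : emb (1, 2) ^ 2 = -3 := by
  rw [emb_one_two]; linear_combination 4 * omega_sq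

lemma emb_one_two_ne_zero : emb (1, 2) ≠ 0 := emb_ne_zero (by simp)

lemma zcoord_add_centre (n p : ℤ × ℤ) :
    zcoord (n + centre p) = p.2 + (zcoord n + p.1 * ω) := by
  simp only [zcoord]
  rw [div_eq_iff emb_one_two_ne_zero, add_mul, add_mul, div_mul_cancel₀ _ emb_one_two_ne_zero,
    emb_add, emb_one_two]
  simp only [emb, centre]
  push_cast
  linear_combination -2 * (p.1 : ℂ) * omega_sq

lemma zcoord_im (n : ℤ × ℤ) : (zcoord n).im = -(emb (1, 2)).im * (2 * n.1 - n.2) / 6 := by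
  have h : zcoord n = -(emb n * emb (1, 2)) / 3 := by
    rw [zcoord, div_eq_iff emb_one_two_ne_zero]
    linear_combination (emb n / 3) * emb_one_two_sq
  rw [h, Complex.div_ofNat_im, Complex.neg_im, Complex.mul_im]
  simp only [emb, Complex.add_im, Complex.add_re, Complex.mul_im, Complex.mul_re,
    Complex.intCast_re, Complex.intCast_im, omega_re, omega_im]
  push_cast
  ring

lemma emb_one_two_im_pos : 0 < (emb (1, 2)).im := by
  rw [emb_one_two]
  simp [omega_im_pos]

lemma zcoord_mem {n : ℤ × ℤ} (hn : eps n ≠ 0) : zcoord n ∈ integerComplement := by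
  rintro ⟨x, hx⟩
  have h1 : (zcoord n).im = 0 := by rw [← hx]; simp
  rw [zcoord_im] at h1
  have h2 := emb_one_two_im_pos.ne'
  have h3 : (2 * n.1 - n.2 : ℝ) = 0 := by
    have : (emb (1, 2)).im * (2 * n.1 - n.2) = 0 := by linarith
    exact (mul_eq_zero.1 this).resolve_left h2
  have h4 : 2 * n.1 - n.2 = 0 := by exact_mod_cast h3
  exact hn ((eps_eq_zero_iff n).2 (by omega))

lemma three_mul_rowIndex (n : ℤ × ℤ) : 3 * rowIndex n = n.2 - 2 * n.1 + 2 * eps n := by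
  have h : (n.2 - 2 * n.1 + 2 * eps n) % 3 = 0 := by
    rcases eps_cases n with h | h | h
    · have := (eps_eq_zero_iff n).1 h; rw [h]; omega
    · have := (eps_eq_one_iff n).1 h; rw [h]; omega
    · have := (eps_eq_neg_one_iff n).1 h; rw [h]; omega
  rw [rowIndex]
  omega

lemma eq_base_add_centre (n : ℤ × ℤ) :
    n = (eps n, 0) + centre (rowIndex n, n.1 + 2 * rowIndex n - eps n) := by
  have := three_mul_rowIndex n
  ext <;> simp only [centre, Prod.fst_add, Prod.snd_add] <;> linarith

lemma eps_base (n : ℤ × ℤ) : eps (eps n, 0) = eps n := by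
  rcases eps_cases n with h | h | h <;> rw [h] <;> decide

lemma eps_centre (p : ℤ × ℤ) : eps (centre p) = 0 :=
  (eps_eq_zero_iff _).2 (by simp only [centre]; omega)

lemma eps_add_centre (n p : ℤ × ℤ) : eps (n + centre p) = eps n := by
  rw [add_comm]; exact eps_add_of_eps_eq_zero (eps_centre p) n

variable {ι : Type*}

lemma sum_mul_class_eq_zero {J : Finset ι} {c : ι → ℂ} {s : ι → ℤ × ℤ} {r : ι → ℕ}
    (hs : ∀ j ∈ J, eps (s j) ≠ 0)
    (hcls : ∀ m, eps m ≠ 0 → ∀ q, ∑ j ∈ J with eps (s j) = eps m ∧ r j = q, c j = 0)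
    (g : ℤ → ℕ → ℂ) : ∑ j ∈ J, c j * g (eps (s j)) (r j) = 0 := by
  classical
  rw [← Finset.sum_fiberwise_of_maps_to (t := J.image fun j => (eps (s j), r j))
    (g := fun j => (eps (s j), r j)) fun j hj => Finset.mem_image_of_mem _ hj]
  refine Finset.sum_eq_zero fun p hp => ?_
  obtain ⟨i, hi, rfl⟩ := Finset.mem_image.1 hp
  have h := hcls (s i) (hs i hi) (r i)
  have h2 : ∀ j ∈ J.filter (fun j => (eps (s j), r j) = (eps (s i), r i)),
      c j * g (eps (s j)) (r j) = c j * g (eps (s i)) (r i) := by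
    intro j hj
    have := (Finset.mem_filter.1 hj).2
    simp only [Prod.mk.injEq] at this
    rw [this.1, this.2]
  rw [Finset.sum_congr rfl h2, ← Finset.sum_mul]
  simp only [Prod.mk.injEq]
  rw [h, zero_mul]

lemma tendsto_base_im_atTop (z : ℂ) : Tendsto (fun y : ℤ => (z + y * ω).im) atTop atTop := by
  have : ∀ y : ℤ, (z + y * ω).im = z.im + y * ω.im := by intro y; simp
  simp only [this]
  exact tendsto_atTop_add_const_left _ _
    (tendsto_intCast_atTop_atTop.atTop_mul_const omega_im_pos)

lemma tendsto_base_im_atBot (z : ℂ) : Tendsto (fun y : ℤ => (z + y * ω).im) atBot atBot := by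
  have : ∀ y : ℤ, (z + y * ω).im = z.im + y * ω.im := by intro y; simp
  simp only [this]
  exact tendsto_atBot_add_const_left _ _
    ((tendsto_intCast_atBot_iff.2 tendsto_id).atBot_mul_const omega_im_pos)

lemma tendsto_sum_latSum_shift (r : ℕ) (z : ℂ) (Q : ℤ) :
    Tendsto (fun N : ℕ => ∑ y ∈ Finset.Ico (-N : ℤ) N,
      (latSum r (z + (y + Q : ℤ) * ω) - latSum r (z + y * ω))) atTop
      (𝓝 (if r = 0 then Q * (-(2 * Real.pi * I)) else 0)) := by
  rcases eq_or_ne r 0 with rfl | hr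
  · have := tendsto_sum_Ico_shift (H := fun y : ℤ => latSum 0 (z + y * ω))
      (tendsto_latSum_zero_of_im_atTop (tendsto_base_im_atTop z))
      (tendsto_latSum_zero_of_im_atBot (tendsto_base_im_atBot z)) Q
    convert this using 2
    rw [if_pos rfl]; ring
  · have := tendsto_sum_Ico_shift (H := fun y : ℤ => latSum r (z + y * ω))
      (tendsto_latSum_of_abs_im_atTop hr
        (tendsto_abs_atTop_atTop.comp (tendsto_base_im_atTop z)))
      (tendsto_latSum_of_abs_im_atTop hr
        (tendsto_abs_atBot_atTop.comp (tendsto_base_im_atBot z))) Q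
    convert this using 2
    rw [if_neg hr]; ring

lemma hasSum_row {J : Finset ι} {c : ι → ℂ} {s : ι → ℤ × ℤ} {r : ι → ℕ}
    (hs : ∀ j ∈ J, eps (s j) ≠ 0)
    (hcls : ∀ m, eps m ≠ 0 → ∀ q, ∑ j ∈ J with eps (s j) = eps m ∧ r j = q, c j = 0) (y : ℤ) :
    HasSum (fun x : ℤ => ∑ j ∈ J, c j * (zcoord (s j + centre (y, x)) ^ (r j + 1))⁻¹)
      (∑ j ∈ J, c j * (latSum (r j) (zcoord (eps (s j), 0) + (y + rowIndex (s j) : ℤ) * ω) -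
        latSum (r j) (zcoord (eps (s j), 0) + y * ω))) := by
  have h : ∀ x : ℤ, ∑ j ∈ J, c j * (zcoord (s j + centre (y, x)) ^ (r j + 1))⁻¹ =
      ∑ j ∈ J, c j * (((x + (zcoord (s j) + y * ω)) ^ (r j + 1))⁻¹ -
        ((x + (zcoord (eps (s j), 0) + y * ω)) ^ (r j + 1))⁻¹) := by
    intro x
    simp only [mul_sub, Finset.sum_sub_distrib]
    rw [sum_mul_class_eq_zero hs hcls fun t q => ((x + (zcoord (t, 0) + y * ω)) ^ (q + 1))⁻¹,
      sub_zero]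
    simp only [zcoord_add_centre]
  simp only [h]
  refine hasSum_sum fun j hj => HasSum.mul_left _ ?_
  have hmem : ∀ n, eps n ≠ 0 → zcoord n + y * ω ∈ integerComplement := by
    intro n hn
    have := zcoord_mem (n := n + centre (y, 0)) (by rwa [eps_add_centre])
    rw [zcoord_add_centre] at this
    simpa using this
  have h2 : zcoord (s j) = zcoord (eps (s j), 0) + rowIndex (s j) * ω +
      ((s j).1 + 2 * rowIndex (s j) - eps (s j) : ℤ) := by
    conv_lhs => rw [eq_base_add_centre (s j), zcoord_add_centre]
    ring
  have h3 : latSum (r j) (zcoord (eps (s j), 0) + (y + rowIndex (s j) : ℤ) * ω) =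
      latSum (r j) (zcoord (s j) + y * ω) := by
    rw [h2, add_right_comm, latSum_add_intCast]
    congr 1
    push_cast
    ring
  rw [h3]
  exact hasSum_latSum_sub (r j) (hmem _ (hs j hj))
    (hmem (eps (s j), 0) (by rw [eps_base]; exact hs j hj))

theorem tsum_lattice_eq {J : Finset ι} {c : ι → ℂ} {s : ι → ℤ × ℤ} {r : ι → ℕ}
    (hs : ∀ j ∈ J, eps (s j) ≠ 0)
    (hcls : ∀ m, eps m ≠ 0 → ∀ q, ∑ j ∈ J with eps (s j) = eps m ∧ r j = q, c j = 0)
    (hsum : Summable fun p : ℤ × ℤ => ∑ j ∈ J, c j * (zcoord (s j + centre p) ^ (r j + 1))⁻¹) :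
    ∑' p : ℤ × ℤ, ∑ j ∈ J, c j * (zcoord (s j + centre p) ^ (r j + 1))⁻¹ =
      -(2 * Real.pi * I) * ∑ j ∈ J with r j = 0, c j * rowIndex (s j) := by
  have h1 := hsum.hasSum.prod_fiberwise fun y => hasSum_row hs hcls y
  have h2 := h1.comp Finset.tendsto_Ico_neg
  have h3 := tendsto_finsetSum J fun j (_ : j ∈ J) =>
    (tendsto_sum_latSum_shift (r j) (zcoord (eps (s j), 0)) (rowIndex (s j))).const_mul (c j)
  have h4 := tendsto_nhds_unique h2 (h3.congr fun N => by
    simp only [Finset.mul_sum, Function.comp]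
    exact Finset.sum_comm)
  rw [h4, Finset.mul_sum, Finset.sum_filter]
  refine Finset.sum_congr rfl fun j _ => ?_
  split_ifs <;> ring

end Cotangent

section TraceFormula

lemma rot_eq_iff (i n : ℤ × ℤ) : rot n = i ↔ n = rot (rot i) := by
  constructor
  · rintro rfl; rw [rot_rot_rot]
  · rintro rfl; rw [rot_rot_rot]

lemma rotAvg_single (i : ℤ × ℤ) : rotAvg (Pi.single i 1) = (1 / 3 : ℂ) •
    (Pi.single i 1 + Pi.single (rot (rot i)) 1 + Pi.single (rot i) 1) := by
  funext n
  have h1 : rot n = i ↔ n = rot (rot i) := rot_eq_iff i n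
  have h2 : rot (rot n) = i ↔ n = rot i := by rw [rot_eq_iff, rot_eq_iff, rot_rot_rot]
  simp only [rotAvg_apply, Pi.smul_apply, Pi.add_apply, Pi.single_apply, smul_eq_mul, h1, h2]
  ring

lemma norm_emb_le_norm_rot_sub (i : ℤ × ℤ) : ‖emb i‖ ≤ ‖emb (rot i) - emb i‖ := by
  rw [emb_rot, show ω * emb i - emb i = (ω - 1) * emb i by ring, norm_mul]
  refine le_mul_of_one_le_left (norm_nonneg _) ?_
  refine le_trans ?_ (Complex.abs_re_le_norm _)
  rw [Complex.sub_re, omega_re]; norm_num [abs_of_nonpos]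

lemma norm_emb_le_norm_rot_rot_sub (i : ℤ × ℤ) : ‖emb i‖ ≤ ‖emb (rot (rot i)) - emb i‖ := by
  rw [emb_rot, emb_rot, show ω * (ω * emb i) - emb i = (ω ^ 2 - 1) * emb i by ring, norm_mul]
  refine le_mul_of_one_le_left (norm_nonneg _) ?_
  refine le_trans ?_ (Complex.abs_re_le_norm _)
  rw [omega_sq, Complex.sub_re, Complex.sub_re, omega_re]; norm_num [abs_of_nonpos]

/-- The contribution of the rotated terms to the trace. -/
def rotTerm (N : ℕ) (i : ℤ × ℤ) : ℂ :=
  (hopT ^ N) (Pi.single (rot (rot i)) 1) i + (hopT ^ N) (Pi.single (rot i) 1) i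

lemma rotTerm_eq_zero {N : ℕ} {i : ℤ × ℤ} (h : (N : ℝ) < ‖emb i‖) : rotTerm N i = 0 := by
  rw [rotTerm, hopT, wop_pow_single_eq_zero _ _ (h.trans_le (norm_emb_le_norm_rot_rot_sub i)),
    wop_pow_single_eq_zero _ _ (h.trans_le (norm_emb_le_norm_rot_sub i)), add_zero]

lemma single_mem (m n : ℤ × ℤ) : (Pi.single m 1 : ℤ × ℤ → ℂ) n ∈ AlgNum := by
  rw [Pi.single_apply]
  split_ifs
  · exact one_mem _
  · exact zero_mem _

lemma rotTerm_mem (N : ℕ) (i : ℤ × ℤ) : rotTerm N i ∈ AlgNum :=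
  add_mem (wop_pow_mem invw_zero_mem (single_mem _) _ _)
    (wop_pow_mem invw_zero_mem (single_mem _) _ _)

lemma rotTerm_support (N : ℕ) : ∀ i ∉ (finite_norm_emb_le N).toFinset, rotTerm N i = 0 := by
  intro i hi
  refine rotTerm_eq_zero ?_
  simpa using hi

lemma kpow_bsOp_diag (k : ℕ) (i : ℤ × ℤ) : kpow (opKernel bsOp) bsRow (k + 1) i i =
    (1 / 3 : ℂ) * (diagv (4 * (k + 1)) i 0 + rotTerm (4 * (k + 1)) i) := by
  rw [rowFinite_bsOp.kpow_eq, bsOp_pow _ k.succ_pos, Module.End.mul_apply, rotAvg_single, map_smul,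
    map_add, map_add, rotTerm, diagv, hopT]
  simp only [Pi.smul_apply, Pi.add_apply, smul_eq_mul]
  ring

lemma summable_rotTerm (N : ℕ) : Summable (rotTerm N) :=
  summable_of_ne_finset_zero (rotTerm_support N)

lemma summable_diagv (k : ℕ) : Summable fun n => diagv (4 * (k + 1)) n 0 := by
  refine (((isFredKernel_bsOp.summable_kpow k).mul_left 3).sub
    (summable_rotTerm (4 * (k + 1)))).congr fun i => ?_
  rw [kpow_bsOp_diag]
  ring

lemma exists_ktr_eq (k : ℕ) : ∃ r ∈ AlgNum, ktr (opKernel bsOp) bsRow (k + 1) =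
    (1 / 3 : ℂ) * ∑' n, diagv (4 * (k + 1)) n 0 + r := by
  refine ⟨(1 / 3 : ℂ) * ∑' n, rotTerm (4 * (k + 1)) n, ?_, ?_⟩
  · rw [tsum_eq_sum (rotTerm_support _)]
    refine mul_mem ?_ (sum_mem fun i _ => rotTerm_mem _ i)
    exact div_mem (one_mem _) (ofNat_mem _ 3)
  · rw [ktr, ← mul_add, ← (summable_diagv k).tsum_add (summable_rotTerm _), ← tsum_mul_left]
    exact tsum_congr fun i => kpow_bsOp_diag k i

lemma diagv_succ_of_eps_eq_zero (N : ℕ) {n : ℤ × ℤ} (hn : eps n = 0) (z : ℂ) :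
    diagv (N + 1) n z = 0 := by
  rw [diagv, pow_succ_wop_apply, invw, if_pos hn, zero_mul]

lemma centre_add_injective (m : ℤ × ℤ) : Function.Injective fun p => centre p + m := by
  intro p q h
  simp only [add_left_inj] at h
  simp only [centre, Prod.mk.injEq] at h
  ext <;> omega

lemma emb_centre_mem_regSet (p : ℤ × ℤ) : emb (centre p) ∈ regSet := by
  intro n hn
  rw [← emb_add]
  refine emb_ne_zero (ne_zero_of_eps_ne_zero ?_)
  rwa [eps_add_centre]

lemma tsum_diagv_eq_tsum_cellv {N : ℕ} (h : Summable fun n => diagv (N + 1) n 0) :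
    (Summable fun p => cellv (N + 1) (emb (centre p))) ∧
    ∑' n, diagv (N + 1) n 0 = ∑' p, cellv (N + 1) (emb (centre p)) := by
  have hd : ∀ (m p : ℤ × ℤ), diagv (N + 1) (centre p + m) 0 =
      diagv (N + 1) m (emb (centre p)) := by
    intro m p; rw [diagv_translate (eps_centre p), zero_add]
  have h1 := h.comp_injective (centre_add_injective (1, 0))
  have h2 := h.comp_injective (centre_add_injective (-1, 0))
  have e1 : ∀ p, ((fun n => diagv (N + 1) n 0) ∘ fun p => centre p + (1, 0)) p =
    diagv (N + 1) (1, 0) (emb (centre p)) := fun p => hd _ p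
  have e2 : ∀ p, ((fun n => diagv (N + 1) n 0) ∘ fun p => centre p + (-1, 0)) p =
    diagv (N + 1) (-1, 0) (emb (centre p)) := fun p => hd _ p
  have h1' := h1.congr e1
  have h2' := h2.congr e2
  refine ⟨h1'.add h2', ?_⟩
  simp only [cellv]
  rw [h1'.tsum_add h2']
  have hone : ∀ t : ℤ, t = 1 ∨ t = -1 → ∑' n, (if eps n = t then diagv (N + 1) n 0 else 0) =
      ∑' p, diagv (N + 1) (t, 0) (emb (centre p)) := by
    intro t ht
    have hte : eps (t, 0) = t := by rcases ht with rfl | rfl <;> decide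
    rw [← (centre_add_injective (t, 0)).tsum_eq]
    · refine tsum_congr fun p => ?_
      rw [if_pos, hd]
      rw [add_comm, eps_add_centre, hte]
    · intro n hn
      have hnt : eps n = t := by
        by_contra hne
        exact hn (if_neg hne)
      have := eq_base_add_centre n
      rw [hnt, add_comm] at this
      exact ⟨_, this.symm⟩
  rw [← hone 1 (Or.inl rfl), ← hone (-1) (Or.inr rfl), ← Summable.tsum_add]
  · refine tsum_congr fun n => ?_
    rcases eps_cases n with h0 | h0 | h0
    · rw [diagv_succ_of_eps_eq_zero N h0]; simp
    · simp [h0]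
    · simp [h0]
  · exact Summable.of_norm_bounded h.norm fun n => by split_ifs <;> simp
  · exact Summable.of_norm_bounded h.norm fun n => by split_ifs <;> simp

/-- The trace of a power is determined by the simple poles of the cell sum. -/
theorem tsum_diagv_eq {ι : Type*} {k : ℕ} {J : Finset ι} {c : ι → ℂ} {s : ι → ℤ × ℤ} {r : ι → ℕ}
    (hs : ∀ j ∈ J, eps (s j) ≠ 0) (hrep : ∀ z ∈ regSet,
      cellv (k + 1) z = ∑ j ∈ J, c j * ((emb (s j) + z) ^ (r j + 1))⁻¹)
    (hsum : Summable fun n => diagv (k + 1) n 0) :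
    ∑' n, diagv (k + 1) n 0 = Real.pi * (-(2 * I) / emb (1, 2) *
      ∑ j ∈ J with r j = 0, c j * rowIndex (s j)) := by
  obtain ⟨h1, h2⟩ := tsum_diagv_eq_tsum_cellv hsum
  have hcell : ∀ p, cellv (k + 1) (emb (centre p)) =
      ∑ j ∈ J, (c j * (emb (1, 2) ^ (r j + 1))⁻¹) * (zcoord (s j + centre p) ^ (r j + 1))⁻¹ := by
    intro p
    rw [hrep _ (emb_centre_mem_regSet p)]
    refine Finset.sum_congr rfl fun j _ => ?_
    rw [← emb_add, mul_assoc, ← mul_inv, ← mul_pow, zcoord, mul_div_cancel₀ _ emb_one_two_ne_zero]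
  have hcls : ∀ m, eps m ≠ 0 → ∀ q, ∑ j ∈ J with eps (s j) = eps m ∧ r j = q,
      c j * (emb (1, 2) ^ (r j + 1))⁻¹ = 0 := by
    intro m hm q
    have h := sum_class_eq_zero k J c s r hrep hm q
    rw [Finset.sum_congr rfl (g := fun j => c j * (emb (1, 2) ^ (q + 1))⁻¹), ← Finset.sum_mul, h,
      zero_mul]
    intro j hj
    rw [(Finset.mem_filter.1 hj).2.2]
  rw [h2, tsum_congr hcell, tsum_lattice_eq hs hcls (h1.congr hcell), Finset.mul_sum,
    Finset.mul_sum, Finset.mul_sum]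
  refine Finset.sum_congr rfl fun j hj => ?_
  rw [(Finset.mem_filter.1 hj).2, zero_add, pow_one, div_eq_mul_inv]
  ring

theorem exists_tsum_diagv_eq_pi_mul (k : ℕ) : ∃ q ∈ AlgNum,
    ∑' n, diagv (4 * (k + 1)) n 0 = Real.pi * q := by
  obtain ⟨c, hc⟩ := exists_cellv_eq (4 * k + 3)
  refine ⟨_, ?_, tsum_diagv_eq (k := 4 * k + 3) (J := c.support) (c := fun j => (c j : ℂ))
    (s := fun j => j.1) (r := fun j => j.2) (fun j _ => j.1.2) hc (summable_diagv k)⟩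
  refine mul_mem (div_mem (neg_mem (mul_mem (ofNat_mem _ 2) I_mem)) (emb_mem _))
    (sum_mem fun j _ => mul_mem (c j).2 (intCast_mem _ _))

end TraceFormula

section FirstTrace

/-- The elementary fraction with a pole at a given site. -/
def poleTerm (j : {n : ℤ × ℤ // eps n ≠ 0} × ℕ) (a z : ℂ) : ℂ :=
  a * ((emb j.1 + z) ^ (j.2 + 1))⁻¹

/-- The weighted residue at a given site. -/
def poleValue (j : {n : ℤ × ℤ // eps n ≠ 0} × ℕ) (a : ℂ) : ℂ :=
  if j.2 = 0 then a * rowIndex j.1 else 0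

/-- `f` is a combination of elementary fractions whose weighted sum of residues is `q`. -/
def HasPoleSum (f : ℂ → ℂ) (q : ℂ) : Prop :=
  ∃ c : ({n : ℤ × ℤ // eps n ≠ 0} × ℕ) →₀ ℂ,
    (∀ z ∈ regSet, f z = c.sum fun j a => poleTerm j a z) ∧ c.sum poleValue = q

lemma HasPoleSum.add {f g : ℂ → ℂ} {p q : ℂ} (hf : HasPoleSum f p) (hg : HasPoleSum g q) :
    HasPoleSum (fun z => f z + g z) (p + q) := by
  classical
  obtain ⟨c, hc, rfl⟩ := hf
  obtain ⟨d, hd, rfl⟩ := hg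
  refine ⟨c + d, fun z hz => ?_, ?_⟩
  · beta_reduce
    rw [Finsupp.sum_add_index' (by simp [poleTerm]) (by intros; simp only [poleTerm]; ring), hc z hz,
      hd z hz]
  · exact Finsupp.sum_add_index' (by simp [poleValue])
      (by intro j a b; simp only [poleValue]; split_ifs <;> ring)

lemma HasPoleSum.const_mul {f : ℂ → ℂ} {p : ℂ} (a : ℂ) (hf : HasPoleSum f p) :
    HasPoleSum (fun z => a * f z) (a * p) := by
  obtain ⟨c, hc, rfl⟩ := hf
  refine ⟨a • c, fun z hz => ?_, ?_⟩
  · beta_reduce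
    rw [Finsupp.sum_smul_index' (by simp [poleTerm]), hc z hz, Finsupp.mul_sum]
    exact Finsupp.sum_congr fun j _ => by simp only [poleTerm, smul_eq_mul]; ring
  · rw [Finsupp.sum_smul_index' (by simp [poleValue]), Finsupp.mul_sum]
    exact Finsupp.sum_congr fun j _ => by
      simp only [poleValue, smul_eq_mul]; split_ifs <;> ring

lemma HasPoleSum.congr {f g : ℂ → ℂ} {p q : ℂ} (hf : HasPoleSum f p)
    (h : ∀ z ∈ regSet, g z = f z) (hpq : q = p) : HasPoleSum g q := by
  obtain ⟨c, hc, rfl⟩ := hf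
  exact ⟨c, fun z hz => (h z hz).trans (hc z hz), hpq.symm⟩

lemma invw_eq {n : ℤ × ℤ} (hn : eps n ≠ 0) (z : ℂ) : invw z n = (emb n + z)⁻¹ := if_neg hn

lemma hasPoleSum_invw {n : ℤ × ℤ} (hn : eps n ≠ 0) :
    HasPoleSum (fun z => invw z n) (rowIndex n) :=
  ⟨Finsupp.single (⟨n, hn⟩, 0) 1, fun z _ => by
    beta_reduce; rw [Finsupp.sum_single_index (by simp [poleTerm]), invw_eq hn]; simp [poleTerm], by
    rw [Finsupp.sum_single_index (by simp [poleValue])]; simp [poleValue]⟩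

lemma hasPoleSum_invw_sq {n : ℤ × ℤ} (hn : eps n ≠ 0) :
    HasPoleSum (fun z => invw z n ^ 2) 0 :=
  ⟨Finsupp.single (⟨n, hn⟩, 1) 1, fun z _ => by
    beta_reduce; rw [Finsupp.sum_single_index (by simp [poleTerm]), invw_eq hn]; simp [poleTerm], by
    rw [Finsupp.sum_single_index (by simp [poleValue])]; simp [poleValue]⟩

lemma hasPoleSum_star_self {n m : ℤ × ℤ} (hn : eps n ≠ 0) (hm : eps m ≠ 0) {u : ℂ}
    (hmu : emb m = emb n + u) :
    HasPoleSum (fun z => (u * u) ^ 2 * (invw z n ^ 2 * invw z m * invw z m))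
      (-2 * u * rowIndex n + 2 * u * rowIndex m) := by
  refine (((((hasPoleSum_invw_sq hn).const_mul (u ^ 2)).add ((hasPoleSum_invw hn).const_mul
    (-2 * u))).add ((hasPoleSum_invw_sq hm).const_mul (u ^ 2))).add ((hasPoleSum_invw hm).const_mul
    (2 * u))).congr (fun z hz => ?_) (by ring)
  have h1 := hz n hn
  have h2 := hz m hm
  rw [invw_eq hn, invw_eq hm]
  rw [hmu] at h2 ⊢
  field_simp
  ring

lemma hasPoleSum_star {n m m' : ℤ × ℤ} (hn : eps n ≠ 0) (hm : eps m ≠ 0) (hm' : eps m' ≠ 0)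
    {u u' v : ℂ} (hv : (u - u') * v = 1) (hmu : emb m = emb n + u)
    (hmu' : emb m' = emb n + u') :
    HasPoleSum (fun z => (u * u') ^ 2 * (invw z n ^ 2 * invw z m * invw z m'))
      (-(u + u') * rowIndex n - u' ^ 2 * v * rowIndex m + u ^ 2 * v * rowIndex m') := by
  refine (((((hasPoleSum_invw_sq hn).const_mul (u * u')).add ((hasPoleSum_invw hn).const_mul
    (-(u + u')))).add ((hasPoleSum_invw hm).const_mul (-(u' ^ 2 * v)))).add
    ((hasPoleSum_invw hm').const_mul (u ^ 2 * v))).congr (fun z hz => ?_) (by ring)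
  have h0 : u - u' ≠ 0 := left_ne_zero_of_mul_eq_one hv
  have hv' : v = (u - u')⁻¹ := eq_inv_of_mul_eq_one_right hv
  have h1 := hz n hn
  have h2 := hz m hm
  have h3 := hz m' hm'
  rw [invw_eq hn, invw_eq hm, invw_eq hm', hv']
  rw [hmu] at h2 ⊢
  rw [hmu'] at h3 ⊢
  field_simp
  ring

lemma hasPoleSum_chain {n m m' : ℤ × ℤ} (hn : eps n ≠ 0) (hm : eps m ≠ 0) (hm' : eps m' ≠ 0)
    {u u' v : ℂ} (hv : (u - u') * v = 1) (hmu : emb m = emb n + u)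
    (hmu' : emb m' = emb n + (u - u')) :
    HasPoleSum (fun z => (u * u') ^ 2 * (invw z n * invw z m ^ 2 * invw z m'))
      (u' ^ 2 * v * rowIndex n - u ^ 2 * v * rowIndex m' + (u + u') * rowIndex m) := by
  refine (((((hasPoleSum_invw_sq hm).const_mul (u * u')).add ((hasPoleSum_invw hm).const_mul
    (u + u'))).add ((hasPoleSum_invw hn).const_mul (u' ^ 2 * v))).add
    ((hasPoleSum_invw hm').const_mul (-(u ^ 2 * v)))).congr (fun z hz => ?_) (by ring)
  have h0 : u - u' ≠ 0 := left_ne_zero_of_mul_eq_one hv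
  have hv' : v = (u - u')⁻¹ := eq_inv_of_mul_eq_one_right hv
  have h1 := hz n hn
  have h2 := hz m hm
  have h3 := hz m' hm'
  rw [invw_eq hn, invw_eq hm, invw_eq hm', hv']
  rw [hmu] at h2 ⊢
  rw [hmu'] at h3 ⊢
  field_simp
  ring

lemma hasPoleSum_diagv_four_one :
    HasPoleSum (diagv 4 (1, 0)) (-2) := by
  have hs : ω ^ 2 = -1 - ω := omega_sq
  have h4 : ω ^ 4 = ω := by rw [pow_succ, omega_pow_three, one_mul]
  have h6 : ω ^ 6 = 1 := by rw [show ω ^ 6 = (ω ^ 3) ^ 2 by ring, omega_pow_three, one_pow]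
  have h7 : ω ^ 7 = ω := by rw [pow_succ, h6, one_mul]
  have h8 : ω ^ 8 = -1 - ω := by rw [pow_succ, h7, ← sq, hs]
  have a0 := hasPoleSum_star_self (n := (1, 0)) (m := (2, 0)) (u := 1) (by decide) (by decide)
    (by simp [emb]; ring)
  have a1 := hasPoleSum_star_self (n := (1, 0)) (m := (1, 1)) (u := ω) (by decide) (by decide)
    (by simp [emb])
  have a2 := hasPoleSum_star_self (n := (1, 0)) (m := (0, -1)) (u := (-1 - ω)) (by decide) (by decide)
    (by simp [emb]; ring)
  have b01 := hasPoleSum_star (n := (1, 0)) (m := (2, 0)) (m' := (1, 1)) (u := 1)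
    (u' := ω) (v := ((2) + (1) * ω) / 3) (by decide) (by decide) (by decide)
    (by ring_nf; rw [hs]; ring) (by simp [emb]; ring) (by simp [emb])
  have b02 := hasPoleSum_star (n := (1, 0)) (m := (2, 0)) (m' := (0, -1)) (u := 1)
    (u' := (-1 - ω)) (v := ((1) + (-1) * ω) / 3) (by decide) (by decide) (by decide)
    (by ring_nf; rw [hs]; ring) (by simp [emb]; ring) (by simp [emb]; ring)
  have b12 := hasPoleSum_star (n := (1, 0)) (m := (1, 1)) (m' := (0, -1)) (u := ω)
    (u' := (-1 - ω)) (v := ((-1) + (-2) * ω) / 3) (by decide) (by decide) (by decide)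
    (by ring_nf; rw [hs]; ring) (by simp [emb]) (by simp [emb]; ring)
  have c01 := hasPoleSum_chain (n := (1, 0)) (m := (2, 0)) (m' := (2, -1)) (u := 1)
    (u' := ω) (v := ((2) + (1) * ω) / 3) (by decide) (by decide) (by decide)
    (by ring_nf; rw [hs]; ring) (by simp [emb]; ring) (by simp [emb]; ring)
  have c02 := hasPoleSum_chain (n := (1, 0)) (m := (2, 0)) (m' := (3, 1)) (u := 1)
    (u' := (-1 - ω)) (v := ((1) + (-1) * ω) / 3) (by decide) (by decide) (by decide)
    (by ring_nf; rw [hs]; ring) (by simp [emb]; ring) (by simp [emb]; ring)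
  have c10 := hasPoleSum_chain (n := (1, 0)) (m := (1, 1)) (m' := (0, 1)) (u := ω)
    (u' := 1) (v := ((-2) + (-1) * ω) / 3) (by decide) (by decide) (by decide)
    (by ring_nf; rw [hs]; ring) (by simp [emb]) (by simp [emb])
  have c12 := hasPoleSum_chain (n := (1, 0)) (m := (1, 1)) (m' := (2, 2)) (u := ω)
    (u' := (-1 - ω)) (v := ((-1) + (-2) * ω) / 3) (by decide) (by decide) (by decide)
    (by ring_nf; rw [hs]; ring) (by simp [emb]) (by simp [emb]; ring)
  have c20 := hasPoleSum_chain (n := (1, 0)) (m := (0, -1)) (m' := (-1, -1)) (u := (-1 - ω))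
    (u' := 1) (v := ((-1) + (1) * ω) / 3) (by decide) (by decide) (by decide)
    (by ring_nf; rw [hs]; ring) (by simp [emb]; ring) (by simp [emb]; ring)
  have c21 := hasPoleSum_chain (n := (1, 0)) (m := (0, -1)) (m' := (0, -2)) (u := (-1 - ω))
    (u' := ω) (v := ((1) + (2) * ω) / 3) (by decide) (by decide) (by decide)
    (by ring_nf; rw [hs]; ring) (by simp [emb]; ring) (by simp [emb]; ring)
  refine (((((((((((a0.add
    a1).add
    a2).add
    (b01.const_mul 2)).add
    (b02.const_mul 2)).add
    (b12.const_mul 2)).add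
    c01).add
    c02).add
    c10).add
    c12).add
    c20).add
    c21).congr (fun z _ => ?_) ?_
  · simp only [diagv, pow_succ_wop_apply (N := 3), pow_succ_wop_apply (N := 2),
      pow_succ_wop_apply (N := 1), pow_succ_wop_apply (N := 0), pow_zero, Finset.sum_range_succ,
      Finset.sum_range_zero, Module.End.one_apply, Pi.single_apply, nbr, eps, dir]
    norm_num
    ring_nf
    simp only [hs, h4, h6, h8, omega_pow_three]
    ring
  · norm_num [rowIndex, eps]
    ring_nf
    simp only [hs]
    ring

lemma hasPoleSum_diagv_four_neg_one :
    HasPoleSum (diagv 4 (-1, 0)) (-2) := by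
  have hs : ω ^ 2 = -1 - ω := omega_sq
  have h4 : ω ^ 4 = ω := by rw [pow_succ, omega_pow_three, one_mul]
  have h6 : ω ^ 6 = 1 := by rw [show ω ^ 6 = (ω ^ 3) ^ 2 by ring, omega_pow_three, one_pow]
  have h7 : ω ^ 7 = ω := by rw [pow_succ, h6, one_mul]
  have h8 : ω ^ 8 = -1 - ω := by rw [pow_succ, h7, ← sq, hs]
  have a0 := hasPoleSum_star_self (n := (-1, 0)) (m := (-2, 0)) (u := (-1)) (by decide) (by decide)
    (by simp [emb]; ring)
  have a1 := hasPoleSum_star_self (n := (-1, 0)) (m := (-1, -1)) (u := (-ω)) (by decide) (by decide)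
    (by simp [emb])
  have a2 := hasPoleSum_star_self (n := (-1, 0)) (m := (0, 1)) (u := (1 + ω)) (by decide) (by decide)
    (by simp [emb])
  have b01 := hasPoleSum_star (n := (-1, 0)) (m := (-2, 0)) (m' := (-1, -1)) (u := (-1))
    (u' := (-ω)) (v := ((-2) + (-1) * ω) / 3) (by decide) (by decide) (by decide)
    (by ring_nf; rw [hs]; ring) (by simp [emb]; ring) (by simp [emb])
  have b02 := hasPoleSum_star (n := (-1, 0)) (m := (-2, 0)) (m' := (0, 1)) (u := (-1))
    (u' := (1 + ω)) (v := ((-1) + (1) * ω) / 3) (by decide) (by decide) (by decide)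
    (by ring_nf; rw [hs]; ring) (by simp [emb]; ring) (by simp [emb])
  have b12 := hasPoleSum_star (n := (-1, 0)) (m := (-1, -1)) (m' := (0, 1)) (u := (-ω))
    (u' := (1 + ω)) (v := ((1) + (2) * ω) / 3) (by decide) (by decide) (by decide)
    (by ring_nf; rw [hs]; ring) (by simp [emb]) (by simp [emb])
  have c01 := hasPoleSum_chain (n := (-1, 0)) (m := (-2, 0)) (m' := (-2, 1)) (u := (-1))
    (u' := (-ω)) (v := ((-2) + (-1) * ω) / 3) (by decide) (by decide) (by decide)
    (by ring_nf; rw [hs]; ring) (by simp [emb]; ring) (by simp [emb]; ring)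
  have c02 := hasPoleSum_chain (n := (-1, 0)) (m := (-2, 0)) (m' := (-3, -1)) (u := (-1))
    (u' := (1 + ω)) (v := ((-1) + (1) * ω) / 3) (by decide) (by decide) (by decide)
    (by ring_nf; rw [hs]; ring) (by simp [emb]; ring) (by simp [emb]; ring)
  have c10 := hasPoleSum_chain (n := (-1, 0)) (m := (-1, -1)) (m' := (0, -1)) (u := (-ω))
    (u' := (-1)) (v := ((2) + (1) * ω) / 3) (by decide) (by decide) (by decide)
    (by ring_nf; rw [hs]; ring) (by simp [emb]) (by simp [emb])
  have c12 := hasPoleSum_chain (n := (-1, 0)) (m := (-1, -1)) (m' := (-2, -2)) (u := (-ω))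
    (u' := (1 + ω)) (v := ((1) + (2) * ω) / 3) (by decide) (by decide) (by decide)
    (by ring_nf; rw [hs]; ring) (by simp [emb]) (by simp [emb]; ring)
  have c20 := hasPoleSum_chain (n := (-1, 0)) (m := (0, 1)) (m' := (1, 1)) (u := (1 + ω))
    (u' := (-1)) (v := ((1) + (-1) * ω) / 3) (by decide) (by decide) (by decide)
    (by ring_nf; rw [hs]; ring) (by simp [emb]) (by simp [emb])
  have c21 := hasPoleSum_chain (n := (-1, 0)) (m := (0, 1)) (m' := (0, 2)) (u := (1 + ω))
    (u' := (-ω)) (v := ((-1) + (-2) * ω) / 3) (by decide) (by decide) (by decide)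
    (by ring_nf; rw [hs]; ring) (by simp [emb]) (by simp [emb]; ring)
  refine (((((((((((a0.add
    a1).add
    a2).add
    (b01.const_mul 2)).add
    (b02.const_mul 2)).add
    (b12.const_mul 2)).add
    c01).add
    c02).add
    c10).add
    c12).add
    c20).add
    c21).congr (fun z _ => ?_) ?_
  · simp only [diagv, pow_succ_wop_apply (N := 3), pow_succ_wop_apply (N := 2),
      pow_succ_wop_apply (N := 1), pow_succ_wop_apply (N := 0), pow_zero, Finset.sum_range_succ,
      Finset.sum_range_zero, Module.End.one_apply, Pi.single_apply, nbr, eps, dir]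
    norm_num
    ring_nf
    simp only [hs, h4, h6, h8, omega_pow_three]
    ring
  · norm_num [rowIndex, eps]
    ring_nf
    simp only [hs]
    ring

/-- The trace of the fourth power of the hopping operator. -/
theorem tsum_diagv_four : ∑' n, diagv 4 n 0 = Real.pi * (8 * I / emb (1, 2)) := by
  obtain ⟨c, hc, hq⟩ := hasPoleSum_diagv_four_one.add hasPoleSum_diagv_four_neg_one
  have h := tsum_diagv_eq (k := 3) (J := c.support) (c := c) (s := fun j => (j.1 : ℤ × ℤ))
    (r := fun j => j.2) (fun j _ => j.1.2) hc (summable_diagv 0)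
  have h2 : ∑ j ∈ c.support with j.2 = 0, c j * (rowIndex (j.1 : ℤ × ℤ) : ℂ) = -2 + -2 := by
    rw [Finset.sum_filter, ← hq]
    rfl
  rw [h2] at h
  rw [h]
  ring

end FirstTrace

section Nonvanishing

open Polynomial

/-- Determinant coefficients of traces that are affine in a number are polynomials in it. -/
lemma exists_fredCoeff_eq_aeval {F : IntermediateField ℚ ℂ} {x : ℂ} {τ : ℕ → ℂ} {q r : ℕ → F}
    (hτ : ∀ k, τ (k + 1) = x * q k + r k) (h0 : q 0 ≠ 0) (n : ℕ) :
    ∃ E : F[X], aeval x E = fredCoeff τ n ∧ E.natDegree ≤ n ∧ E.coeff n ≠ 0 := by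
  induction n using Nat.strong_induction_on with
  | _ n ih =>
    rcases n with _ | n
    · exact ⟨1, by simp [fredCoeff_zero], by simp, by simp⟩
    choose! E hE hdeg hlead using ih
    have hn : ((n : F) + 1) ≠ 0 := by exact_mod_cast Nat.succ_ne_zero n
    have hn' : ((n : ℂ) + 1) ≠ 0 := by exact_mod_cast Nat.succ_ne_zero n
    refine ⟨C (-((n : F) + 1)⁻¹) * ∑ i ∈ Finset.range (n + 1),
      E i * (X * C (q (n - i)) + C (r (n - i))), ?_, ?_, ?_⟩
    · have h := fredCoeff_succ τ n
      have h2 : ∀ i ∈ Finset.range (n + 1), fredCoeff τ i * τ (n + 1 - i) =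
          aeval x (E i * (X * C (q (n - i)) + C (r (n - i)))) := fun i hi => by
        have hi' : i < n + 1 := Finset.mem_range.1 hi
        rw [show n + 1 - i = n - i + 1 by omega, hτ, map_mul, hE i hi']
        simp only [map_add, map_mul, aeval_X, aeval_C]
        rfl
      rw [Finset.sum_congr rfl h2, ← map_sum] at h
      rw [map_mul, aeval_C, ← mul_right_inj' hn', h, ← mul_assoc]
      have h3 : algebraMap F ℂ (-((n : F) + 1)⁻¹) = -((n : ℂ) + 1)⁻¹ := by simp
      rw [h3, mul_neg, mul_inv_cancel₀ hn', neg_one_mul]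
    · refine (natDegree_C_mul_le _ _).trans (natDegree_sum_le_of_forall_le _ _ fun i hi => ?_)
      have hi' : i < n + 1 := Finset.mem_range.1 hi
      refine natDegree_mul_le.trans ?_
      have h1 : (X * C (q (n - i)) + C (r (n - i))).natDegree ≤ 1 := by compute_degree
      have := hdeg i hi'
      omega
    · rw [coeff_C_mul]
      refine mul_ne_zero (neg_ne_zero.2 (inv_ne_zero hn)) ?_
      have h1 : ∀ i ∈ Finset.range (n + 1), i ≠ n →
          (E i * (X * C (q (n - i)) + C (r (n - i)))).coeff (n + 1) = 0 := fun i hi hin => by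
        have hi' : i < n + 1 := Finset.mem_range.1 hi
        refine coeff_eq_zero_of_natDegree_lt (natDegree_mul_le.trans_lt ?_)
        have h1 : (X * C (q (n - i)) + C (r (n - i))).natDegree ≤ 1 := by compute_degree
        have := hdeg i hi'
        omega
      rw [Polynomial.finsetSum_coeff, Finset.sum_eq_single n h1 (by simp), Nat.sub_self, mul_add,
        coeff_add, ← mul_assoc, coeff_mul_C, coeff_mul_X, coeff_mul_C,
        coeff_eq_zero_of_natDegree_lt ((hdeg n (by simp)).trans_lt n.lt_succ_self), zero_mul,
        add_zero]
      exact mul_ne_zero (hlead n (by simp)) h0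

theorem bsDet_ne_zero (n : ℕ) : bsDet n ≠ 0 := by
  have h : ∀ k : ℕ, ∃ q r : AlgNum, ktr (opKernel bsOp) bsRow (k + 1) = Real.pi * q + r := by
    intro k
    obtain ⟨r, hr, h⟩ := exists_ktr_eq k
    obtain ⟨q, hq, h'⟩ := exists_tsum_diagv_eq_pi_mul k
    refine ⟨(1 / 3 : AlgNum) * ⟨q, hq⟩, ⟨r, hr⟩, ?_⟩
    rw [h, h']
    push_cast
    rw [show ((3 : AlgNum) : ℂ) = 3 from rfl]
    ring
  choose q r hqr using h
  have hq0 : q 0 ≠ 0 := by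
    intro h0
    obtain ⟨r', hr', h⟩ := exists_ktr_eq 0
    rw [hqr, h0, show 4 * (0 + 1) = 4 from rfl, tsum_diagv_four] at h
    have hne : (8 * I / emb (1, 2) : ℂ) ≠ 0 :=
      div_ne_zero (mul_ne_zero (by norm_num) I_ne_zero) emb_one_two_ne_zero
    have hmem : (8 * I / emb (1, 2) : ℂ) ∈ AlgNum :=
      div_mem (mul_mem (ofNat_mem _ 8) I_mem) (emb_mem _)
    let a : AlgNum := ⟨_, hmem⟩
    refine aeval_pi_ne_zero (C ((1 / 3 : AlgNum) * a) * X + C (⟨r', hr'⟩ - r 0)) (fun h1 => ?_) ?_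
    · have h2 := congrArg (fun p => p.coeff 1) h1
      simp [coeff_C] at h2
      exact hne (congrArg Subtype.val h2)
    · simp only [map_add, map_mul, aeval_C, aeval_X]
      change ((((1 / 3 : AlgNum) * a : AlgNum) : ℂ)) * _ + ((⟨r', hr'⟩ - r 0 : AlgNum) : ℂ) = 0
      push_cast
      rw [show ((3 : AlgNum) : ℂ) = 3 from rfl]
      simp only [ZeroMemClass.coe_zero, mul_zero, zero_add] at h
      linear_combination -h
  obtain ⟨E, hE, -, hlead⟩ := exists_fredCoeff_eq_aeval (x := (Real.pi : ℂ)) hqr hq0 n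
  rw [bsDet, kdet, ← hE]
  exact aeval_pi_ne_zero E fun h0 => hlead (by rw [h0, coeff_zero])

/-- There are infinitely many resonances at the origin. -/
theorem infinite_zeros_bsDet : {z : ℂ | ∑' n, bsDet n * z ^ n = 0}.Infinite := by
  intro hfin
  obtain ⟨n, hn⟩ := exists_coeff_eq_zero (a := bsDet) (C := (∑' i, bsBound i ^ (3 / 4 : ℝ)) / (3 / 4))
    (s := 3 / 4) (fredCoeff_zero _)
    (div_nonneg (tsum_nonneg fun i => Real.rpow_nonneg (isFredKernel_bsOp.nonneg i) _) (by norm_num))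
    (by norm_num) (by norm_num) (fun n R hR => isFredKernel_bsOp.norm_kdet_le hR n) hfin
  exact bsDet_ne_zero n hn

end Nonvanishing

section PlaneWaves

lemma pair_eq (z w : ℂ) : pair z w = z.re * w.re + z.im * w.im := by simp [pair]

/-- The pairing with a fixed vector, times `K`. -/
def phaseL (w : ℂ) : ℂ →L[ℝ] ℝ :=
  (4 * Real.pi / 3 * w.re) • reCLM + (4 * Real.pi / 3 * w.im) • imCLM

lemma phaseL_apply (w z : ℂ) : phaseL w z = 4 * Real.pi / 3 * pair z w := by
  rw [pair_eq]; simp [phaseL]; ring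

lemma norm_phaseL_le (w : ℂ) : ‖phaseL w‖ ≤ 4 * Real.pi / 3 * ‖w‖ := by
  refine ContinuousLinearMap.opNorm_le_bound _ (by positivity) fun z => ?_
  rw [phaseL_apply, norm_mul, Real.norm_of_nonneg (by positivity), mul_assoc]
  gcongr
  rw [pair, Real.norm_eq_abs]
  refine (abs_re_le_norm _).trans ?_
  rw [norm_mul, Complex.norm_conj, mul_comm]

/-- The plane wave with frequency at a given site. -/
def wave (n : ℤ × ℤ) (z : ℂ) : ℂ := Complex.exp (phaseL (emb n) z * I)

lemma norm_wave (n : ℤ × ℤ) (z : ℂ) : ‖wave n z‖ = 1 := norm_exp_ofReal_mul_I _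

lemma wave_ne_zero (n : ℤ × ℤ) (z : ℂ) : wave n z ≠ 0 := Complex.exp_ne_zero _

lemma phaseL_add (v w : ℂ) : phaseL (v + w) = phaseL v + phaseL w := by
  ext z; simp [phaseL]; ring

lemma wave_add (n m : ℤ × ℤ) (z : ℂ) : wave (n + m) z = wave n z * wave m z := by
  rw [wave, wave, wave, ← Complex.exp_add, emb_add, phaseL_add]
  congr 1
  push_cast [_root_.add_apply]
  ring

lemma wave_zero (z : ℂ) : wave 0 z = 1 := by
  have h : phaseL (emb 0) z = 0 := by rw [emb_zero]; simp [phaseL]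
  simp [wave, h]

lemma wave_neg (n : ℤ × ℤ) (z : ℂ) : wave (-n) z = (wave n z)⁻¹ := by
  refine eq_inv_of_mul_eq_one_left ?_
  rw [← wave_add, neg_add_cancel, wave_zero]

lemma wave_neg_arg (n : ℤ × ℤ) (z : ℂ) : wave n (-z) = wave (-n) z := by
  rw [wave_neg, wave, wave, ← Complex.exp_neg, map_neg]
  push_cast
  ring_nf

lemma wave_add_arg (n : ℤ × ℤ) (z w : ℂ) : wave n (z + w) = wave n z * wave n w := by
  rw [wave, wave, wave, ← Complex.exp_add, map_add]
  push_cast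
  ring_nf

lemma contDiff_wave (n : ℤ × ℤ) {N : WithTop ℕ∞} : ContDiff ℝ N (wave n) := by
  unfold wave
  exact ((ofRealCLM.contDiff.comp (phaseL (emb n)).contDiff).mul contDiff_const).cexp

lemma differentiable_wave (n : ℤ × ℤ) : Differentiable ℝ (wave n) :=
  (contDiff_wave n (N := 1)).differentiable one_ne_zero

lemma hasFDerivAt_wave (n : ℤ × ℤ) (z : ℂ) :
    HasFDerivAt (wave n) (wave n z • ((ofRealCLM.comp (phaseL (emb n))).smulRight I)) z := by
  have h := ((ofRealCLM.comp (phaseL (emb n))).hasFDerivAt (x := z)).mul_const I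
  have h2 := h.cexp
  refine h2.congr_fderiv ?_
  ext v
  simp [wave]
  ring

lemma fderiv_wave (n : ℤ × ℤ) (z v : ℂ) :
    fderiv ℝ (wave n) z v = wave n z * (phaseL (emb n) v * I) := by
  rw [(hasFDerivAt_wave n z).fderiv]; simp

lemma norm_fderiv_wave_le (n : ℤ × ℤ) (z : ℂ) :
    ‖fderiv ℝ (wave n) z‖ ≤ 4 * Real.pi / 3 * ‖emb n‖ := by
  refine ContinuousLinearMap.opNorm_le_bound _ (by positivity) fun v => ?_
  rw [fderiv_wave, norm_mul, norm_wave, one_mul, norm_mul, norm_I, mul_one, norm_real]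
  exact (phaseL (emb n)).le_of_opNorm_le (norm_phaseL_le _) v

lemma Dbar_wave (n : ℤ × ℤ) (z : ℂ) : Dbar (wave n) z = K * emb n * wave n z := by
  rw [Dbar, fderiv_wave, fderiv_wave, phaseL_apply, phaseL_apply, pair_eq, pair_eq, K]
  conv_rhs => rw [← re_add_im (emb n)]
  simp only [one_re, one_im, I_re, I_im]
  push_cast
  field_simp
  ring

lemma Dbar_mul {f g : ℂ → ℂ} {z : ℂ} (hf : DifferentiableAt ℝ f z) (hg : DifferentiableAt ℝ g z) :
    Dbar (fun w => f w * g w) z = Dbar f z * g z + f z * Dbar g z := by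
  rw [Dbar, Dbar, Dbar, fderiv_fun_mul hf hg]
  simp
  ring

lemma Dbar_const (a z : ℂ) : Dbar (fun _ => a) z = 0 := by simp [Dbar]

lemma Dbar_add {f g : ℂ → ℂ} {z : ℂ} (hf : DifferentiableAt ℝ f z) (hg : DifferentiableAt ℝ g z) :
    Dbar (fun w => f w + g w) z = Dbar f z + Dbar g z := by
  rw [Dbar, Dbar, Dbar, fderiv_fun_add hf hg]
  simp
  ring

lemma Dbar_const_mul {f : ℂ → ℂ} {z : ℂ} (a : ℂ) (hf : DifferentiableAt ℝ f z) :
    Dbar (fun w => a * f w) z = a * Dbar f z := by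
  rw [Dbar_mul (differentiableAt_const a) hf, Dbar_const, zero_mul, zero_add]

lemma UBM_eq (z : ℂ) : UBM z = -K * I * ∑ l ∈ Finset.range 3, ω ^ l * wave (dir l) z := by
  rw [UBM, K]
  congr 1
  refine Finset.sum_congr rfl fun l hl => ?_
  rw [wave, emb_dir (Finset.mem_range.1 hl), phaseL_apply]
  push_cast
  ring_nf

lemma UBM_neg_eq (z : ℂ) : UBM (-z) = -K * I * ∑ l ∈ Finset.range 3, ω ^ l * wave (-dir l) z := by
  simp only [UBM_eq, wave_neg_arg]

lemma K_ne_zero : K ≠ 0 := by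
  rw [K]
  have : (Real.pi : ℂ) ≠ 0 := ofReal_ne_zero.2 Real.pi_ne_zero
  exact div_ne_zero (mul_ne_zero (by norm_num) this) (by norm_num)

lemma phaseL_lattice (n : ℤ × ℤ) (c d : ℤ) : phaseL (emb n) (c * ω + d) =
    2 * Real.pi / 3 * (d * (2 * n.1 - n.2) + c * (2 * n.2 - n.1)) := by
  have h3 : (Real.sqrt 3) ^ 2 = 3 := Real.sq_sqrt (by norm_num)
  rw [phaseL_apply, pair_eq]
  simp only [emb, add_re, mul_re, add_im, mul_im, intCast_re, intCast_im, omega_re, omega_im]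
  ring_nf
  rw [h3]
  ring

lemma wave_lattice (n : ℤ × ℤ) {γ : ℂ} (hγ : γ ∈ Λ) :
    wave n γ = Complex.exp (eps n * (I * (pair γ K : ℂ))) := by
  obtain ⟨c, d, rfl⟩ := hγ
  obtain ⟨j, hj⟩ : ∃ j, n.1 + n.2 = 3 * j + eps n := by
    refine ⟨(n.1 + n.2 - eps n) / 3, ?_⟩
    unfold eps
    split_ifs <;> omega
  have hj' : (n.1 : ℂ) + n.2 = 3 * j + eps n := by exact_mod_cast hj
  have hK : K = ((4 * Real.pi / 3 : ℝ) : ℂ) := by rw [K]; push_cast; rfl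
  rw [wave, phaseL_lattice, Complex.exp_eq_exp_iff_exists_int]
  refine ⟨d * (n.1 - j - eps n) + c * (n.2 - j), ?_⟩
  rw [pair_eq, hK, ofReal_re, ofReal_im]
  simp only [add_re, mul_re, intCast_re, intCast_im, omega_re, omega_im]
  push_cast
  linear_combination (-2 * Real.pi / 3 * I * (d + c)) * hj'

lemma wave_add_lattice_of_eps_eq_zero {n : ℤ × ℤ} (hn : eps n = 0) {γ : ℂ} (hγ : γ ∈ Λ) (z : ℂ) :
    wave n (z + γ) = wave n z := by
  rw [wave_add_arg, wave_lattice n hγ, hn]; simp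

lemma one_mem_lattice : (1 : ℂ) ∈ Λ := ⟨0, 1, by simp⟩

lemma omega_mem_lattice : ω ∈ Λ := ⟨1, 0, by simp⟩

end PlaneWaves

section CellAverage

lemma eq_zero_of_fourier_eq_zero {g : ℝ → ℂ} (hg : Continuous g) (hper : ∀ x, g (x + 1) = g x)
    (h : ∀ n : ℤ, ∫ x in (0 : ℝ)..1, g x * Complex.exp (2 * Real.pi * I * n * x) = 0) (x : ℝ) :
    g x = 0 := by
  have hp : Function.Periodic g 1 := hper
  let F : C(AddCircle (1 : ℝ), ℂ) := ⟨hp.lift, by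
    refine continuous_coinduced_dom.2 ?_
    exact hg⟩
  have : Fact (0 < (1 : ℝ)) := ⟨one_pos⟩
  have h0 : fourierCoeff F = 0 := by
    funext n
    rw [fourierCoeff_eq_intervalIntegral F n 0]
    have : ∫ x in (0 : ℝ)..0 + 1, (fourier (-n) (x : AddCircle (1 : ℝ)) : ℂ) • F x = 0 := by
      rw [zero_add, ← h (-n)]
      refine intervalIntegral.integral_congr fun x _ => ?_
      rw [fourier_coe_apply, smul_eq_mul, mul_comm]
      congr 2
      push_cast
      ring
    rw [this, smul_zero]
    rfl
  have h1 := has_pointwise_sum_fourier_series_of_summable (f := F) (by rw [h0]; exact summable_zero)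
    (x : AddCircle (1 : ℝ))
  rw [h0] at h1
  simp only [Pi.zero_apply, zero_smul] at h1
  exact h1.unique hasSum_zero

/-- The average over a unit cell. -/
def avg (f : ℂ → ℂ) : ℂ := ∫ s in (0 : ℝ)..1, ∫ t in (0 : ℝ)..1, f (s + t * ω)

/-- Periodicity with respect to the moiré lattice. -/
def LPeriodic (f : ℂ → ℂ) : Prop := ∀ γ ∈ Λ, ∀ z, f (z + γ) = f z

lemma avg_add {f g : ℂ → ℂ} (hf : Continuous f) (hg : Continuous g) :
    avg (fun z => f z + g z) = avg f + avg g := by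
  have h : ∀ F : ℂ → ℂ, Continuous F → ∀ s : ℝ,
      IntervalIntegrable (fun t : ℝ => F (s + t * ω)) volume 0 1 := fun F hF s =>
    Continuous.intervalIntegrable (by fun_prop) _ _
  rw [avg, avg, avg, ← intervalIntegral.integral_add
    (Continuous.intervalIntegrable (by fun_prop) _ _)
    (Continuous.intervalIntegrable (by fun_prop) _ _)]
  exact intervalIntegral.integral_congr fun s _ =>
    intervalIntegral.integral_add (h f hf s) (h g hg s)

lemma avg_const_mul (a : ℂ) (f : ℂ → ℂ) : avg (fun z => a * f z) = a * avg f := by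
  simp only [avg, intervalIntegral.integral_const_mul]

lemma avg_zero : avg (fun _ => 0) = 0 := by simp [avg]

lemma avg_one : avg (fun _ => 1) = 1 := by simp [avg]

lemma avg_sum {ι : Type*} (s : Finset ι) {f : ι → ℂ → ℂ} (h : ∀ i ∈ s, Continuous (f i)) :
    avg (fun z => ∑ i ∈ s, f i z) = ∑ i ∈ s, avg (f i) := by
  classical
  induction s using Finset.induction_on with
  | empty => simp [avg_zero]
  | insert i s hi ih =>
    simp only [Finset.sum_insert hi]
    rw [avg_add (h i (by simp)) (continuous_finsetSum _ fun j hj => h j (by simp [hj])),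
      ih fun j hj => h j (by simp [hj])]

lemma avg_Dbar {f : ℂ → ℂ} (hf : ContDiff ℝ 1 f) (hper : LPeriodic f) : avg (Dbar f) = 0 := by
  have hd : ∀ z, HasFDerivAt f (fderiv ℝ f z) z := fun z =>
    (hf.differentiable one_ne_zero z).hasFDerivAt
  have hc : ∀ v : ℂ, Continuous fun z => fderiv ℝ f z v := fun v =>
    (hf.continuous_fderiv one_ne_zero).clm_apply continuous_const
  have h0 : ∀ z v : ℂ, f (z + v) = f z →
      ∫ t in (0 : ℝ)..1, fderiv ℝ f (z + t * v) v = 0 := fun z v hv => by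
    have h : ∀ t : ℝ, HasDerivAt (fun t : ℝ => f (z + t * v)) (fderiv ℝ f (z + t * v) v) t := by
      intro t
      have h1 : HasDerivAt (fun t : ℝ => z + t * v) v t := by
        simpa using (((hasDerivAt_id t).ofReal_comp).mul_const v).const_add z
      exact (hd _).comp_hasDerivAt t h1
    rw [intervalIntegral.integral_eq_sub_of_hasDerivAt (fun t _ => h t)
      (((hc v).comp (by fun_prop)).intervalIntegrable _ _)]
    simp [hv]
  have h1 : avg (fun z => fderiv ℝ f z ω) = 0 := by
    simp only [avg, h0 _ ω (hper ω omega_mem_lattice _), intervalIntegral.integral_zero]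
  have h2 : avg (fun z => fderiv ℝ f z 1) = 0 := by
    have hc1 := hc 1
    have : Continuous (Function.uncurry fun s t : ℝ => fderiv ℝ f (s + t * ω) 1) := by
      refine hc1.comp (f := fun p : ℝ × ℝ => (p.1 + p.2 * ω : ℂ)) (by fun_prop)
    rw [avg, intervalIntegral_intervalIntegral_swap]
    · have h3 : ∀ t : ℝ, ∫ s in (0 : ℝ)..1, fderiv ℝ f (s + t * ω) 1 = 0 := fun t => by
        rw [← h0 (t * ω) 1 (hper 1 one_mem_lattice _)]
        refine intervalIntegral.integral_congr fun s _ => ?_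
        rw [mul_one, add_comm]
      simp only [h3, intervalIntegral.integral_zero]
    · exact (this.continuousOn.integrableOn_compact (isCompact_uIcc.prod isCompact_uIcc)).mono_set
        (Set.prod_mono Set.uIoc_subset_uIcc Set.uIoc_subset_uIcc)
  have h3 : Dbar f = fun z => (-I + (Real.sqrt 3 : ℂ)⁻¹) * fderiv ℝ f z 1 +
      (2 * (Real.sqrt 3 : ℂ)⁻¹) * fderiv ℝ f z ω := by
    funext z
    have hs : Real.sqrt 3 ≠ 0 := by positivity
    have hI : I = ((Real.sqrt 3)⁻¹ : ℝ) • (1 : ℂ) + (2 * (Real.sqrt 3)⁻¹ : ℝ) • ω := by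
      apply Complex.ext
      · simp [omega_re]; ring
      · simp [omega_im]
        field_simp
        exact (Real.sq_sqrt (by norm_num)).symm
    have h4 : fderiv ℝ f z I = (Real.sqrt 3 : ℂ)⁻¹ * fderiv ℝ f z 1 +
        (2 * (Real.sqrt 3 : ℂ)⁻¹) * fderiv ℝ f z ω := by
      conv_lhs => rw [hI]
      rw [map_add, map_smul, map_smul, real_smul, real_smul]
      push_cast
      rfl
    rw [Dbar, one_div, inv_I, h4]
    linear_combination (-(Real.sqrt 3 : ℂ)⁻¹ * fderiv ℝ f z 1 -
        (2 * (Real.sqrt 3 : ℂ)⁻¹) * fderiv ℝ f z ω) * I_sq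
  rw [h3, avg_add (f := fun z => _ * fderiv ℝ f z 1) (g := fun z => _ * fderiv ℝ f z ω)
    (continuous_const.mul (hc _)) (continuous_const.mul (hc _)), avg_const_mul,
    avg_const_mul, h1, h2]
  simp

lemma wave_cell (p q : ℤ) (s t : ℝ) : wave (2 * p + q, p + 2 * q) (s + t * ω) =
    Complex.exp (2 * Real.pi * I * p * s) * Complex.exp (2 * Real.pi * I * q * t) := by
  have h3 : (Real.sqrt 3) ^ 2 = 3 := Real.sq_sqrt (by norm_num)
  have h : phaseL (emb (2 * p + q, p + 2 * q)) (s + t * ω) = 2 * Real.pi * (p * s + q * t) := by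
    rw [phaseL_apply, pair_eq]
    simp only [emb, add_re, mul_re, add_im, mul_im, intCast_re, intCast_im, omega_re, omega_im,
      ofReal_re, ofReal_im]
    push_cast
    ring_nf
    rw [h3]
    ring
  rw [wave, h, ← Complex.exp_add]
  congr 1
  push_cast
  ring

lemma eq_zero_of_avg_mul_wave {f : ℂ → ℂ} (hf : Continuous f) (hper : LPeriodic f)
    (h : ∀ m, eps m = 0 → avg (fun z => f z * wave m z) = 0) (z : ℂ) : f z = 0 := by
  have h1 : ∀ (q : ℤ) (s : ℝ),
      ∫ t in (0 : ℝ)..1, f (s + t * ω) * Complex.exp (2 * Real.pi * I * q * t) = 0 := by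
    intro q
    refine eq_zero_of_fourier_eq_zero (by fun_prop) (fun s => ?_) fun p => ?_
    · refine intervalIntegral.integral_congr fun t _ => ?_
      rw [← hper 1 one_mem_lattice (s + t * ω)]
      push_cast
      ring_nf
    · rw [← h (2 * p + q, p + 2 * q) ((eps_eq_zero_iff _).2 (by simp only []; omega)), avg]
      refine intervalIntegral.integral_congr fun s _ => ?_
      rw [← intervalIntegral.integral_mul_const]
      refine intervalIntegral.integral_congr fun t _ => ?_
      rw [wave_cell]
      ring
  have h2 : ∀ s t : ℝ, f (s + t * ω) = 0 := fun s => by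
    refine eq_zero_of_fourier_eq_zero (by fun_prop) (fun t => ?_) fun q => h1 q s
    rw [← hper ω omega_mem_lattice (s + t * ω)]
    push_cast
    ring_nf
  have h3 : z = ((z.re + z.im / Real.sqrt 3 : ℝ) : ℂ) + ((2 * z.im / Real.sqrt 3 : ℝ) : ℂ) * ω := by
    apply Complex.ext
    · simp [omega_re]; ring
    · simp [omega_im]; field_simp
  rw [h3]
  exact h2 _ _

lemma LPeriodic.wave {m : ℤ × ℤ} (hm : eps m = 0) : LPeriodic (wave m) :=
  fun _ hγ z => wave_add_lattice_of_eps_eq_zero hm hγ z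

lemma avg_wave {m : ℤ × ℤ} (hm : eps m = 0) (h0 : m ≠ 0) : avg (wave m) = 0 := by
  have h := avg_Dbar (contDiff_wave m) (LPeriodic.wave hm)
  rw [show Dbar (TBG.wave m) = fun z => (K * emb m) * TBG.wave m z from funext (Dbar_wave m),
    avg_const_mul] at h
  exact (mul_eq_zero.1 h).resolve_left (mul_ne_zero K_ne_zero (emb_ne_zero h0))

/-- The superposition of plane waves with given amplitudes. -/
def synth (a : ℤ × ℤ → ℂ) (z : ℂ) : ℂ := ∑' n, a n * wave n z

lemma summable_mul_wave {a : ℤ × ℤ → ℂ} (ha : Summable fun n => ‖a n‖) (z : ℂ) :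
    Summable fun n => a n * wave n z :=
  Summable.of_norm (by simpa [norm_wave] using ha)

lemma continuous_wave (n : ℤ × ℤ) : Continuous (wave n) := (differentiable_wave n).continuous

lemma continuous_synth {a : ℤ × ℤ → ℂ} (ha : Summable fun n => ‖a n‖) : Continuous (synth a) :=
  continuous_tsum (fun n => continuous_const.mul (continuous_wave n)) ha fun n z => by
    simp [norm_wave]

lemma hasSum_avg_synth {a : ℤ × ℤ → ℂ} (ha : Summable fun n => ‖a n‖) :
    HasSum (fun n => a n * avg (wave n)) (avg (synth a)) := by
  have h1 : ∀ s : ℝ, HasSum (fun n => ∫ t in (0 : ℝ)..1, a n * wave n (s + t * ω))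
      (∫ t in (0 : ℝ)..1, synth a (s + t * ω)) := fun s => by
    refine intervalIntegral.hasSum_integral_of_dominated_convergence (fun n _ => ‖a n‖)
      (fun n => ?_) (fun n => ?_) ?_ ?_ ?_
    · exact Continuous.aestronglyMeasurable (continuous_const.mul ((continuous_wave n).comp
        (by fun_prop)))
    · exact Filter.Eventually.of_forall fun t _ => by simp [norm_wave]
    · exact Filter.Eventually.of_forall fun t _ => ha
    · exact intervalIntegrable_const
    · exact Filter.Eventually.of_forall fun t _ => (summable_mul_wave ha _).hasSum
  have hcw : ∀ n, Continuous fun s : ℝ => ∫ t in (0 : ℝ)..1, a n * wave n (s + t * ω) := fun n => by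
    have := continuous_wave n
    fun_prop
  have h2 : HasSum (fun n => ∫ s in (0 : ℝ)..1, ∫ t in (0 : ℝ)..1, a n * wave n (s + t * ω))
      (avg (synth a)) := by
    refine intervalIntegral.hasSum_integral_of_dominated_convergence (fun n _ => ‖a n‖)
      (fun n => (hcw n).aestronglyMeasurable) (fun n => ?_) ?_ ?_ ?_
    · refine Filter.Eventually.of_forall fun s _ => ?_
      simpa using intervalIntegral.norm_integral_le_of_norm_le_const (a := (0 : ℝ)) (b := 1)
        (f := fun t : ℝ => a n * wave n (s + t * ω)) (C := ‖a n‖) fun t _ => by simp [norm_wave]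
    · exact Filter.Eventually.of_forall fun t _ => ha
    · exact intervalIntegrable_const
    · exact Filter.Eventually.of_forall fun s _ => h1 s
  refine h2.congr_fun fun n => ?_
  rw [← avg_const_mul]
  rfl

end CellAverage

section KernelToLattice

/-- Bounded solutions of the hopping equation on the noncentral sites. -/
structure IsSol (κ α : ℂ) (w : ℤ × ℤ → ℂ) : Prop where
  eq_zero : ∀ n, eps n = 0 → w n = 0
  bdd : ∃ C, ∀ n, ‖w n‖ ≤ C
  eqn : ∀ n, eps n ≠ 0 → (emb n + κ) * w n = I * α * hop w n

lemma IsSol.eq_zero_of_vanishing {κ α : ℂ} {w : ℤ × ℤ → ℂ} (h : IsSol κ α w)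
    (h0 : ∀ n, ‖emb n‖ ≤ ‖κ‖ + 6 * ‖α‖ + 1 → w n = 0) (n : ℤ × ℤ) : w n = 0 := by
  obtain ⟨C, hC⟩ := h.bdd
  have h1 : ∀ j : ℕ, ∀ n, ‖w n‖ ≤ C / 2 ^ j := by
    intro j
    induction j with
    | zero => simpa using hC
    | succ j ih =>
      intro n
      have hC0 : 0 ≤ C / 2 ^ j := (norm_nonneg _).trans (ih 0)
      by_cases hn : ‖emb n‖ ≤ ‖κ‖ + 6 * ‖α‖ + 1
      · rw [h0 n hn, norm_zero, pow_succ, ← div_div]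
        positivity
      by_cases he : eps n = 0
      · rw [h.eq_zero n he, norm_zero, pow_succ, ← div_div]
        positivity
      have h2 : ‖emb n + κ‖ * ‖w n‖ ≤ ‖α‖ * (3 * (C / 2 ^ j)) := by
        rw [← norm_mul, h.eqn n he, norm_mul, norm_mul, norm_I, one_mul]
        gcongr
        exact norm_hop_le fun l => ih _
      have h3 : 6 * ‖α‖ + 1 ≤ ‖emb n + κ‖ := by
        have := norm_sub_le (emb n + κ) κ
        rw [add_sub_cancel_right] at this
        linarith
      have h4 : (6 * ‖α‖ + 1) * ‖w n‖ ≤ (6 * ‖α‖ + 1) * (C / 2 ^ j / 2) :=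
        (mul_le_mul_of_nonneg_right h3 (norm_nonneg _)).trans (h2.trans (by nlinarith [norm_nonneg α]))
      rw [pow_succ, ← div_div]
      exact le_of_mul_le_mul_left h4 (by positivity)
  have h2 : Filter.Tendsto (fun j : ℕ => C / 2 ^ j) Filter.atTop (nhds 0) := by
    have := (tendsto_pow_atTop_nhds_zero_of_lt_one (r := (1 / 2 : ℝ)) (by norm_num)
      (by norm_num)).const_mul C
    simpa [div_eq_mul_inv] using this
  exact norm_le_zero_iff.1 (ge_of_tendsto' h2 fun j => h1 j n)

lemma avg_recurrence {f g V : ℂ → ℂ} {k α : ℂ} {d : ℕ → ℤ × ℤ} (hf : ContDiff ℝ 1 f)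
    (hg : Continuous g) (heq : ∀ z, Dbar f z + k * f z + α * V z * g z = 0)
    (hV : ∀ z, V z = -K * I * ∑ l ∈ Finset.range 3, ω ^ l * wave (d l) z) (n : ℤ × ℤ)
    (hper : LPeriodic fun z => f z * wave (-n) z) :
    (K * emb n + k) * avg (fun z => f z * wave (-n) z) =
      I * α * K * ∑ l ∈ Finset.range 3, ω ^ l * avg fun z => g z * wave (-(n - d l)) z := by
  have hc := hf.continuous
  have hw := continuous_wave
  have h1 := avg_Dbar (hf.mul (contDiff_wave (-n))) hper
  have h2 : Dbar (fun z => f z * wave (-n) z) = fun z =>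
      (-(K * emb n + k)) * (f z * wave (-n) z) + (I * α * K) *
        ∑ l ∈ Finset.range 3, ω ^ l * (g z * wave (-(n - d l)) z) := by
    funext z
    rw [Dbar_mul (hf.differentiable one_ne_zero z) (differentiable_wave _ z), Dbar_wave, emb_neg]
    have h3 : ∀ l, wave (-(n - d l)) z = wave (d l) z * wave (-n) z := fun l => by
      rw [← wave_add]; congr 1; abel
    have h4 : ∑ l ∈ Finset.range 3, ω ^ l * (g z * wave (-(n - d l)) z) =
        (∑ l ∈ Finset.range 3, ω ^ l * wave (d l) z) * (g z * wave (-n) z) := by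
      rw [Finset.sum_mul]
      exact Finset.sum_congr rfl fun l _ => by rw [h3]; ring
    rw [h4]
    have h5 := heq z
    rw [hV] at h5
    linear_combination wave (-n) z * h5
  rw [h2, avg_add (by fun_prop) (by fun_prop), avg_const_mul, avg_const_mul,
    avg_sum _ fun l _ => by fun_prop] at h1
  simp only [avg_const_mul] at h1
  linear_combination -h1

/-- The plane-wave amplitudes of a pair of quasi-periodic functions. -/
def coef (u : ℂ → ℂ × ℂ) (n : ℤ × ℤ) : ℂ :=
  if eps n = -1 then avg (fun z => (u z).1 * wave (-n) z)
  else if eps n = 1 then avg (fun z => (u z).2 * wave (-n) z) else 0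

section

variable {α k : ℂ} {u : ℂ → ℂ × ℂ}

lemma InKer.contDiff_fst {Up Um : ℂ → ℂ} (h : InKer Up Um α k u) {N : ℕ∞} :
    ContDiff ℝ N fun z => (u z).1 := (_root_.contDiff_fst.comp h.1).of_le (by exact_mod_cast le_top)

lemma InKer.contDiff_snd {Up Um : ℂ → ℂ} (h : InKer Up Um α k u) {N : ℕ∞} :
    ContDiff ℝ N fun z => (u z).2 := (_root_.contDiff_snd.comp h.1).of_le (by exact_mod_cast le_top)

lemma InKer.lPeriodic_fst {Up Um : ℂ → ℂ} (h : InKer Up Um α k u) {n : ℤ × ℤ}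
    (hn : eps n = -1) : LPeriodic fun z => (u z).1 * wave (-n) z := fun γ hγ z => by
  beta_reduce
  rw [h.2.2.2.1 γ hγ, wave_add_arg, wave_lattice _ hγ, eps_neg, hn]
  calc _ = (Complex.exp (-I * (pair γ K : ℂ)) * Complex.exp (((-(-1 : ℤ) : ℤ) : ℂ) *
        (I * (pair γ K : ℂ)))) * ((u z).1 * wave (-n) z) := by ring
    _ = _ := by
      rw [← Complex.exp_add]
      norm_num

lemma InKer.lPeriodic_snd {Up Um : ℂ → ℂ} (h : InKer Up Um α k u) {n : ℤ × ℤ}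
    (hn : eps n = 1) : LPeriodic fun z => (u z).2 * wave (-n) z := fun γ hγ z => by
  beta_reduce
  rw [h.2.2.2.2 γ hγ, wave_add_arg, wave_lattice _ hγ, eps_neg, hn]
  calc _ = (Complex.exp (I * (pair γ K : ℂ)) * Complex.exp (((-1 : ℤ) : ℂ) *
        (I * (pair γ K : ℂ)))) * ((u z).2 * wave (-n) z) := by ring
    _ = _ := by
      rw [← Complex.exp_add]
      norm_num

lemma exists_norm_avg_mul_wave_le {f : ℂ → ℂ} (hf : Continuous f) :
    ∃ C, ∀ n, ‖avg fun z => f z * wave n z‖ ≤ C := by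
  obtain ⟨C, hC⟩ := ((isCompact_Icc (a := (0 : ℝ)) (b := 1)).prod
    (isCompact_Icc (a := (0 : ℝ)) (b := 1))).exists_bound_of_continuousOn
    (f := fun p : ℝ × ℝ => f (p.1 + p.2 * ω)) (by fun_prop)
  refine ⟨C, fun n => ?_⟩
  have h1 : ∀ s ∈ Set.uIoc (0 : ℝ) 1, ‖∫ t in (0 : ℝ)..1, f (s + t * ω) * wave n (s + t * ω)‖ ≤ C :=
    fun s hs => by
      rw [Set.uIoc_of_le zero_le_one] at hs
      have := intervalIntegral.norm_integral_le_of_norm_le_const (a := (0 : ℝ)) (b := 1)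
        (f := fun t : ℝ => f (s + t * ω) * wave n (s + t * ω)) (C := C) fun t ht => by
          rw [Set.uIoc_of_le zero_le_one] at ht
          rw [norm_mul, norm_wave, mul_one]
          exact hC (s, t) ⟨⟨hs.1.le, hs.2⟩, ⟨ht.1.le, ht.2⟩⟩
      simpa using this
  simpa [avg] using intervalIntegral.norm_integral_le_of_norm_le_const (a := (0 : ℝ)) (b := 1) h1

lemma InKer.isSol (h : InKer UBM (fun z => UBM (-z)) α k u) : IsSol (k / K) α (coef u) := by
  have h1c : Continuous fun z => (u z).1 := (h.contDiff_fst (N := 0)).continuous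
  have h2c : Continuous fun z => (u z).2 := (h.contDiff_snd (N := 0)).continuous
  refine ⟨fun n hn => by simp [coef, hn], ?_, fun n hn => ?_⟩
  · obtain ⟨C₁, hC₁⟩ := exists_norm_avg_mul_wave_le h1c
    obtain ⟨C₂, hC₂⟩ := exists_norm_avg_mul_wave_le h2c
    have := (norm_nonneg _).trans (hC₁ 0)
    refine ⟨max C₁ C₂, fun n => ?_⟩
    unfold coef
    split_ifs
    · exact (hC₁ _).trans (le_max_left _ _)
    · exact (hC₂ _).trans (le_max_right _ _)
    · rw [norm_zero]
      exact this.trans (le_max_left _ _)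
  · have hK := K_ne_zero
    rcases eps_cases n with he | he | he
    · exact absurd he hn
    · have h3 := avg_recurrence (h.contDiff_snd (N := 1)) h1c h.2.2.1 (d := fun l => -dir l)
        UBM_neg_eq n (h.lPeriodic_snd he)
      have h4 : hop (coef u) n = ∑ l ∈ Finset.range 3,
          ω ^ l * avg fun z => (u z).1 * wave (-(n - -dir l)) z := by
        refine Finset.sum_congr rfl fun l _ => ?_
        rw [coef, eps_nbr, if_pos (by rw [he]), nbr, he, one_smul, sub_neg_eq_add]
      rw [h4, coef, if_neg (by rw [he]; norm_num), if_pos he]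
      refine mul_left_cancel₀ hK ?_
      rw [← mul_assoc, mul_add, mul_div_cancel₀ _ hK, h3]
      ring
    · have h3 := avg_recurrence (h.contDiff_fst (N := 1)) h2c h.2.1 (d := dir)
        UBM_eq n (h.lPeriodic_fst he)
      have h4 : hop (coef u) n = ∑ l ∈ Finset.range 3,
          ω ^ l * avg fun z => (u z).2 * wave (-(n - dir l)) z := by
        refine Finset.sum_congr rfl fun l _ => ?_
        rw [coef, eps_nbr, he, if_neg (by norm_num), if_pos (by norm_num), nbr, he, neg_one_zsmul,
          ← sub_eq_add_neg]
      rw [h4, coef, if_pos he]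
      refine mul_left_cancel₀ hK ?_
      rw [← mul_assoc, mul_add, mul_div_cancel₀ _ hK, h3]
      ring

lemma InKer.eq_zero_of_coef {Up Um : ℂ → ℂ} (h : InKer Up Um α k u) (h0 : ∀ n, coef u n = 0) :
    u = 0 := by
  have hw := continuous_wave
  have h1c : Continuous fun z => (u z).1 := (h.contDiff_fst (N := 0)).continuous
  have h2c : Continuous fun z => (u z).2 := (h.contDiff_snd (N := 0)).continuous
  have e1 : eps (2, 0) = -1 := by decide
  have e2 : eps (1, 0) = 1 := by decide
  have hs : ∀ (f : ℂ → ℂ) (a m : ℤ × ℤ), (fun z => f z * wave (-a) z * wave m z) =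
      fun z => f z * wave (-(-m + a)) z := fun f a m => by
    funext z
    rw [mul_assoc, ← wave_add]
    congr 2
    abel
  funext z
  refine Prod.ext ?_ ?_
  · have := eq_zero_of_avg_mul_wave (by fun_prop) (h.lPeriodic_fst e1) (fun m hm => by
      rw [hs]
      have he : eps (-m + (2, 0)) = -1 := by
        rw [eps_add_of_eps_eq_zero (by rw [eps_neg, hm, neg_zero]), e1]
      have h3 := h0 (-m + (2, 0))
      rwa [coef, if_pos he] at h3) z
    exact (mul_eq_zero.1 this).resolve_right (wave_ne_zero _ _)
  · have := eq_zero_of_avg_mul_wave (by fun_prop) (h.lPeriodic_snd e2) (fun m hm => by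
      rw [hs]
      have he : eps (-m + (1, 0)) = 1 := by
        rw [eps_add_of_eps_eq_zero (by rw [eps_neg, hm, neg_zero]), e2]
      have h3 := h0 (-m + (1, 0))
      rwa [coef, if_neg (by rw [he]; norm_num), if_pos he] at h3) z
    exact (mul_eq_zero.1 this).resolve_right (wave_ne_zero _ _)

end

/-- The kernel as a linear subspace. -/
def kerSub (Up Um : ℂ → ℂ) (α k : ℂ) : Submodule ℂ (ℂ → ℂ × ℂ) where
  carrier := kerSet Up Um α k
  zero_mem' := ⟨contDiff_const, by simp [Dbar_const], by simp [Dbar_const], by simp, by simp⟩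
  add_mem' := by
    intro u v hu hv
    refine ⟨hu.1.add hv.1, fun z => ?_, fun z => ?_, fun γ hγ z => ?_, fun γ hγ z => ?_⟩
    · have := Dbar_add ((hu.contDiff_fst (N := 1)).differentiable one_ne_zero z)
        ((hv.contDiff_fst (N := 1)).differentiable one_ne_zero z)
      simp only [Pi.add_apply, Prod.fst_add, Prod.snd_add, this]
      linear_combination hu.2.1 z + hv.2.1 z
    · have := Dbar_add ((hu.contDiff_snd (N := 1)).differentiable one_ne_zero z)
        ((hv.contDiff_snd (N := 1)).differentiable one_ne_zero z)
      simp only [Pi.add_apply, Prod.fst_add, Prod.snd_add, this]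
      linear_combination hu.2.2.1 z + hv.2.2.1 z
    · simp only [Pi.add_apply, Prod.fst_add, hu.2.2.2.1 γ hγ z, hv.2.2.2.1 γ hγ z]
      ring
    · simp only [Pi.add_apply, Prod.snd_add, hu.2.2.2.2 γ hγ z, hv.2.2.2.2 γ hγ z]
      ring
  smul_mem' := by
    intro c u hu
    refine ⟨hu.1.const_smul c, fun z => ?_, fun z => ?_, fun γ hγ z => ?_, fun γ hγ z => ?_⟩
    · have := Dbar_const_mul c ((hu.contDiff_fst (N := 1)).differentiable one_ne_zero z)
      simp only [Pi.smul_apply, Prod.smul_fst, Prod.smul_snd, smul_eq_mul, this]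
      linear_combination c * hu.2.1 z
    · have := Dbar_const_mul c ((hu.contDiff_snd (N := 1)).differentiable one_ne_zero z)
      simp only [Pi.smul_apply, Prod.smul_fst, Prod.smul_snd, smul_eq_mul, this]
      linear_combination c * hu.2.2.1 z
    · simp only [Pi.smul_apply, Prod.smul_fst, smul_eq_mul, hu.2.2.2.1 γ hγ z]
      ring
    · simp only [Pi.smul_apply, Prod.smul_snd, smul_eq_mul, hu.2.2.2.2 γ hγ z]
      ring

lemma span_kerSet (Up Um : ℂ → ℂ) (α k : ℂ) :
    Submodule.span ℂ (kerSet Up Um α k) = kerSub Up Um α k :=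
  Submodule.span_eq (kerSub Up Um α k)

/-- The amplitudes as a linear map on the kernel. -/
def coefL (Up Um : ℂ → ℂ) (α k : ℂ) : kerSub Up Um α k →ₗ[ℂ] ℤ × ℤ → ℂ where
  toFun u := coef u
  map_add' := by
    intro u v
    have hw := continuous_wave
    have hu : InKer Up Um α k u := u.2
    have hv : InKer Up Um α k v := v.2
    have h1 : Continuous fun z => (u.1 z).1 := (hu.contDiff_fst (N := 0)).continuous
    have h2 : Continuous fun z => (u.1 z).2 := (hu.contDiff_snd (N := 0)).continuous
    have h3 : Continuous fun z => (v.1 z).1 := (hv.contDiff_fst (N := 0)).continuous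
    have h4 : Continuous fun z => (v.1 z).2 := (hv.contDiff_snd (N := 0)).continuous
    funext n
    simp only [coef, Pi.add_apply, Submodule.coe_add, Prod.fst_add, Prod.snd_add, add_mul]
    split_ifs
    · exact avg_add (by fun_prop) (by fun_prop)
    · exact avg_add (by fun_prop) (by fun_prop)
    · simp
  map_smul' := by
    intro c u
    funext n
    simp only [coef, Pi.smul_apply, Submodule.coe_smul, Prod.smul_fst, Prod.smul_snd, smul_eq_mul,
      RingHom.id_apply, mul_assoc]
    split_ifs
    · exact avg_const_mul _ _
    · exact avg_const_mul _ _
    · simp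

theorem finiteDimensional_kerSub (α k : ℂ) :
    FiniteDimensional ℂ (kerSub UBM (fun z => UBM (-z)) α k) := by
  let S := {n : ℤ × ℤ | ‖emb n‖ ≤ ‖k / K‖ + 6 * ‖α‖ + 1}
  have : Finite S := finite_norm_emb_le _
  let L : kerSub UBM (fun z => UBM (-z)) α k →ₗ[ℂ] S → ℂ :=
    (LinearMap.funLeft ℂ ℂ (Subtype.val : S → ℤ × ℤ)) ∘ₗ coefL _ _ α k
  refine FiniteDimensional.of_injective L ?_
  rw [injective_iff_map_eq_zero]
  intro u hu
  have hker : InKer UBM (fun z => UBM (-z)) α k u := u.2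
  refine Subtype.ext (hker.eq_zero_of_coef (hker.isSol.eq_zero_of_vanishing fun n hn => ?_))
  exact congrFun hu ⟨n, hn⟩

end KernelToLattice

section PolynomialDecay

/-- Decay of order `p` on the lattice. -/
def PolyDecay (p : ℕ) (G : ℤ × ℤ → ℂ) : Prop := ∃ C, ∀ m, ‖G m‖ * (1 + ‖emb m‖) ^ p ≤ C

namespace PolyDecay

variable {p q : ℕ} {G H : ℤ × ℤ → ℂ}

lemma mono (h : PolyDecay q G) (hpq : p ≤ q) : PolyDecay p G := by
  obtain ⟨C, hC⟩ := h
  refine ⟨C, fun m => le_trans ?_ (hC m)⟩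
  gcongr
  linarith [norm_nonneg (emb m)]

lemma of_norm_le (h : PolyDecay p G) (D : ℝ) (hle : ∀ m, ‖H m‖ ≤ D * ‖G m‖) (hD : 0 ≤ D) :
    PolyDecay p H := by
  obtain ⟨C, hC⟩ := h
  refine ⟨D * C, fun m => ?_⟩
  calc ‖H m‖ * (1 + ‖emb m‖) ^ p ≤ D * ‖G m‖ * (1 + ‖emb m‖) ^ p := by gcongr; exact hle m
    _ = D * (‖G m‖ * (1 + ‖emb m‖) ^ p) := by ring
    _ ≤ D * C := by gcongr; exact hC m

lemma add (h : PolyDecay p G) (h' : PolyDecay p H) : PolyDecay p fun m => G m + H m := by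
  obtain ⟨C, hC⟩ := h
  obtain ⟨C', hC'⟩ := h'
  refine ⟨C + C', fun m => ?_⟩
  calc _ ≤ (‖G m‖ + ‖H m‖) * (1 + ‖emb m‖) ^ p := by gcongr; exact norm_add_le _ _
    _ ≤ _ := by linarith [hC m, hC' m]

lemma const_mul (h : PolyDecay p G) (a : ℂ) : PolyDecay p fun m => a * G m :=
  h.of_norm_le ‖a‖ (fun _ => (norm_mul _ _).le) (norm_nonneg _)

lemma zero : PolyDecay p fun _ => 0 := ⟨0, by simp⟩

lemma sum {ι : Type*} (s : Finset ι) {F : ι → ℤ × ℤ → ℂ} (h : ∀ i ∈ s, PolyDecay p (F i)) :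
    PolyDecay p fun m => ∑ i ∈ s, F i m := by
  classical
  induction s using Finset.induction_on with
  | empty => simpa using zero
  | insert i s hi ih =>
    simp only [Finset.sum_insert hi]
    exact (h i (by simp)).add (ih fun j hj => h j (by simp [hj]))

lemma comp_near (h : PolyDecay p G) {σ : ℤ × ℤ → ℤ × ℤ} {D : ℝ}
    (hσ : ∀ n, ‖emb (σ n) - emb n‖ ≤ D) : PolyDecay p fun m => G (σ m) := by
  obtain ⟨C, hC⟩ := h
  have hD : 0 ≤ D := (norm_nonneg _).trans (hσ 0)
  refine ⟨(1 + D) ^ p * C, fun m => ?_⟩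
  have h1 : 1 + ‖emb m‖ ≤ (1 + D) * (1 + ‖emb (σ m)‖) := by
    have h2 : ‖emb m‖ ≤ ‖emb (σ m)‖ + ‖emb (σ m) - emb m‖ := by
      simpa using norm_sub_le (emb (σ m)) (emb (σ m) - emb m)
    nlinarith [hσ m, norm_nonneg (emb (σ m))]
  calc _ ≤ ‖G (σ m)‖ * ((1 + D) * (1 + ‖emb (σ m)‖)) ^ p := by gcongr
    _ = (1 + D) ^ p * (‖G (σ m)‖ * (1 + ‖emb (σ m)‖) ^ p) := by rw [mul_pow]; ring
    _ ≤ _ := by gcongr; exact hC _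

lemma shift (h : PolyDecay p G) (d : ℤ × ℤ) : PolyDecay p fun m => G (m - d) :=
  h.comp_near (D := ‖emb d‖) fun n => by rw [emb_sub]; simp

lemma of_large {R C : ℝ} (h : ∀ m, R < ‖emb m‖ → ‖G m‖ * (1 + ‖emb m‖) ^ p ≤ C) :
    PolyDecay p G := by
  obtain ⟨B, hB⟩ := ((finite_norm_emb_le R).image
    fun m => ‖G m‖ * (1 + ‖emb m‖) ^ p).bddAbove
  refine ⟨max B C, fun m => ?_⟩
  rcases le_or_gt ‖emb m‖ R with hm | hm
  · exact (hB ⟨m, hm, rfl⟩).trans (le_max_left _ _)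
  · exact (h m hm).trans (le_max_right _ _)

lemma div (h : PolyDecay p H) {κ : ℂ} (hG : ∀ m, (emb m + κ) * G m = H m) :
    PolyDecay (p + 1) G := by
  obtain ⟨C, hC⟩ := h
  refine of_large (R := 2 * ‖κ‖ + 1) (C := 4 * C) fun m hm => ?_
  have h1 : 1 + ‖emb m‖ ≤ 4 * ‖emb m + κ‖ := by
    have := norm_sub_le (emb m + κ) κ
    rw [add_sub_cancel_right] at this
    linarith [norm_nonneg κ]
  have h2 := hC m
  rw [← hG, norm_mul] at h2
  calc ‖G m‖ * (1 + ‖emb m‖) ^ (p + 1) = (1 + ‖emb m‖) * (‖G m‖ * (1 + ‖emb m‖) ^ p) := by ring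
    _ ≤ 4 * ‖emb m + κ‖ * (‖G m‖ * (1 + ‖emb m‖) ^ p) := by gcongr
    _ = 4 * (‖emb m + κ‖ * ‖G m‖ * (1 + ‖emb m‖) ^ p) := by ring
    _ ≤ _ := by gcongr

lemma summable_pow {k : ℕ} (h : PolyDecay (3 + k) G) :
    Summable fun m => ‖G m‖ * ‖emb m‖ ^ k := by
  obtain ⟨C, hC⟩ := h
  refine Summable.of_norm_bounded_eventually
    ((summable_norm_emb_rpow (s := 3) (by norm_num)).mul_left C) ?_
  filter_upwards [(Set.finite_singleton (0 : ℤ × ℤ)).compl_mem_cofinite] with m hm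
  have h0 : 0 < ‖emb m‖ := norm_pos_iff.2 (emb_ne_zero hm)
  rw [Real.norm_of_nonneg (by positivity), Real.rpow_neg h0.le, ← div_eq_mul_inv,
    le_div_iff₀ (by positivity)]
  have h3 : ‖emb m‖ ^ (3 : ℝ) = ‖emb m‖ ^ 3 := by exact_mod_cast Real.rpow_natCast ‖emb m‖ 3
  rw [h3]
  calc _ = ‖G m‖ * ‖emb m‖ ^ (3 + k) := by ring
    _ ≤ ‖G m‖ * (1 + ‖emb m‖) ^ (3 + k) := by gcongr; linarith
    _ ≤ C := hC m

lemma summable (h : PolyDecay 3 G) : Summable fun m => ‖G m‖ := by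
  simpa using summable_pow (k := 0) h

end PolyDecay

lemma IsSol.polyDecay {κ α : ℂ} {w : ℤ × ℤ → ℂ} (h : IsSol κ α w) (p : ℕ) : PolyDecay p w := by
  induction p with
  | zero => simpa [PolyDecay] using h.bdd
  | succ p ih =>
    refine PolyDecay.div (κ := κ) (H := fun n => (emb n + κ) * w n) ?_ fun n => rfl
    have h1 : PolyDecay p (hop w) := PolyDecay.sum _ fun l _ =>
      (ih.comp_near (σ := fun n => nbr n l) fun n => norm_emb_nbr_sub_le n l).const_mul (ω ^ l)
    refine h1.of_norm_le ‖α‖ (fun n => ?_) (norm_nonneg _)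
    by_cases he : eps n = 0
    · rw [h.eq_zero n he, mul_zero, norm_zero]
      positivity
    · rw [h.eqn n he, norm_mul, norm_mul, norm_I, one_mul]

end PolynomialDecay

section Synthesis

lemma hasSum_synth {a : ℤ × ℤ → ℂ} (ha : Summable fun n => ‖a n‖) (z : ℂ) :
    HasSum (fun n => a n * wave n z) (synth a z) := (summable_mul_wave ha z).hasSum

lemma wave_mul_synth (a : ℤ × ℤ → ℂ) (d : ℤ × ℤ) (z : ℂ) :
    wave d z * synth a z = synth (fun n => a (n - d)) z := by
  rw [synth, synth, ← tsum_mul_left, ← (Equiv.addRight d).tsum_eq fun n => a (n - d) * wave n z]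
  refine tsum_congr fun n => ?_
  rw [Equiv.coe_addRight]
  beta_reduce
  rw [add_sub_cancel_right, wave_add]
  ring

lemma iteratedDeriv_cexp_mul_I (k : ℕ) :
    iteratedDeriv k (fun t : ℝ => Complex.exp (t * I)) = fun t : ℝ => I ^ k * Complex.exp (t * I) := by
  induction k with
  | zero => simp
  | succ k ih =>
    rw [iteratedDeriv_succ, ih]
    funext t
    have h : HasDerivAt (fun t : ℝ => Complex.exp (t * I)) (Complex.exp (t * I) * I) t := by
      simpa using (((hasDerivAt_id t).ofReal_comp).mul_const I).cexp
    rw [(h.const_mul (I ^ k)).deriv]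
    ring

lemma norm_iteratedFDeriv_wave_le (n : ℤ × ℤ) (k : ℕ) (z : ℂ) :
    ‖iteratedFDeriv ℝ k (wave n) z‖ ≤ (4 * Real.pi / 3 * ‖emb n‖) ^ k := by
  have hs : ContDiff ℝ k fun t : ℝ => Complex.exp (t * I) :=
    (ofRealCLM.contDiff.mul contDiff_const).cexp
  have h : wave n = (fun t : ℝ => Complex.exp (t * I)) ∘ phaseL (emb n) := rfl
  rw [h, ContinuousLinearMap.iteratedFDeriv_comp_right _ hs z le_rfl]
  refine (ContinuousMultilinearMap.norm_compContinuousLinearMap_le _ _).trans ?_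
  rw [norm_iteratedFDeriv_eq_norm_iteratedDeriv, iteratedDeriv_cexp_mul_I, norm_mul, norm_pow,
    norm_I, one_pow, norm_exp_ofReal_mul_I, one_mul, one_mul, Finset.prod_const, Finset.card_univ,
    Fintype.card_fin]
  gcongr
  exact norm_phaseL_le _

lemma contDiff_synth {a : ℤ × ℤ → ℂ} {N : ℕ∞} (ha : ∀ k : ℕ, k ≤ N → PolyDecay (3 + k) a) :
    ContDiff ℝ N (synth a) := by
  refine contDiff_tsum (v := fun k n => ‖a n‖ * (4 * Real.pi / 3 * ‖emb n‖) ^ k)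
    (fun n => contDiff_const.mul (contDiff_wave n)) (fun k hk => ?_) fun k n z _ => ?_
  · refine ((ha k hk).summable_pow.mul_left ((4 * Real.pi / 3) ^ k)).congr fun n => ?_
    rw [mul_pow]
    ring
  · have : (fun z => a n * wave n z) = a n • wave n := rfl
    rw [this, iteratedFDeriv_const_smul_apply (contDiff_wave n).contDiffAt, norm_smul]
    gcongr
    exact norm_iteratedFDeriv_wave_le n k z

lemma Dbar_synth {a : ℤ × ℤ → ℂ} (ha : PolyDecay 4 a) (z : ℂ) :
    Dbar (synth a) z = K * synth (fun n => emb n * a n) z := by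
  have hw := differentiable_wave
  have hb : ∀ n z, ‖fderiv ℝ (fun y => a n * wave n y) z‖ ≤
      4 * Real.pi / 3 * (‖a n‖ * ‖emb n‖ ^ 1) := fun n z => by
    rw [fderiv_const_mul (hw n z), norm_smul]
    calc _ ≤ ‖a n‖ * (4 * Real.pi / 3 * ‖emb n‖) := by gcongr; exact norm_fderiv_wave_le n z
      _ = _ := by ring
  have hs : Summable fun n => 4 * Real.pi / 3 * (‖a n‖ * ‖emb n‖ ^ 1) :=
    (PolyDecay.summable_pow (k := 1) ha).mul_left _
  have h1 : fderiv ℝ (synth a) z = ∑' n, fderiv ℝ (fun y => a n * wave n y) z :=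
    fderiv_tsum_apply (x₀ := z) hs (fun n => (hw n).const_mul _) hb
      (summable_mul_wave (ha.mono (by norm_num)).summable z) z
  have h2 : Summable fun n => fderiv ℝ (fun y => a n * wave n y) z :=
    Summable.of_norm_bounded hs fun n => hb n z
  have h3 : ∀ v, HasSum (fun n => fderiv ℝ (fun y => a n * wave n y) z v)
      (fderiv ℝ (synth a) z v) := fun v => by
    rw [h1]
    exact h2.hasSum.mapL (ContinuousLinearMap.apply ℝ ℂ v)
  have h4 := ((h3 1).add ((h3 I).mul_left I)).mul_left (1 / I)
  have h5 : ∀ n, 1 / I * (fderiv ℝ (fun y => a n * wave n y) z 1 +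
      I * fderiv ℝ (fun y => a n * wave n y) z I) = K * (emb n * a n * wave n z) := fun n => by
    have := Dbar_const_mul (a n) (hw n z)
    rw [Dbar_wave] at this
    rw [Dbar] at this
    rw [this]
    ring
  simp only [h5] at h4
  rw [synth, ← tsum_mul_left]
  exact h4.tsum_eq.symm

lemma synth_equation {a b : ℤ × ℤ → ℂ} {V : ℂ → ℂ} {α κ : ℂ} {d : ℕ → ℤ × ℤ}
    (ha : PolyDecay 4 a) (hb : PolyDecay 4 b)
    (hV : ∀ z, V z = -K * I * ∑ l ∈ Finset.range 3, ω ^ l * wave (d l) z)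
    (h : ∀ n, (emb n + κ) * a n = I * α * ∑ l ∈ Finset.range 3, ω ^ l * b (n - d l)) (z : ℂ) :
    Dbar (synth a) z + K * κ * synth a z + α * V z * synth b z = 0 := by
  have h0 := ha.mono (show 3 ≤ 4 by norm_num)
  have h1 : Summable fun n => ‖emb n * a n‖ := by
    simpa [mul_comm] using PolyDecay.summable_pow (k := 1) ha
  have h2 : ∀ l, HasSum (fun n => b (n - d l) * wave n z) (wave (d l) z * synth b z) := fun l => by
    rw [wave_mul_synth]
    exact hasSum_synth ((hb.mono (by norm_num)).shift _).summable z
  have h3 := (((hasSum_synth h1 z).mul_left K).add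
    ((hasSum_synth h0.summable z).mul_left (K * κ))).add
    ((hasSum_sum (s := Finset.range 3) fun l _ => (h2 l).mul_left (ω ^ l)).mul_left (α * (-K * I)))
  have h4 : Dbar (synth a) z + K * κ * synth a z + α * V z * synth b z =
      K * synth (fun n => emb n * a n) z + K * κ * synth a z +
        α * (-K * I) * ∑ l ∈ Finset.range 3, ω ^ l * (wave (d l) z * synth b z) := by
    rw [Dbar_synth ha, hV]
    have : ∑ l ∈ Finset.range 3, ω ^ l * (wave (d l) z * synth b z) =
        (∑ l ∈ Finset.range 3, ω ^ l * wave (d l) z) * synth b z := by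
      rw [Finset.sum_mul]
      exact Finset.sum_congr rfl fun l _ => by ring
    rw [this]
    ring
  rw [h4]
  refine (h3.congr_fun fun n => ?_).unique hasSum_zero |>.symm ▸ rfl
  have h5 : ∑ l ∈ Finset.range 3, ω ^ l * (b (n - d l) * wave n z) =
      (∑ l ∈ Finset.range 3, ω ^ l * b (n - d l)) * wave n z := by
    rw [Finset.sum_mul]
    exact Finset.sum_congr rfl fun l _ => by ring
  rw [h5]
  linear_combination -K * wave n z * h n

lemma synth_add_lattice {a : ℤ × ℤ → ℂ} {c : ℤ} (ha : ∀ n, eps n ≠ c → a n = 0) {γ : ℂ}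
    (hγ : γ ∈ Λ) (z : ℂ) :
    synth a (z + γ) = Complex.exp (c * (I * (pair γ K : ℂ))) * synth a z := by
  rw [synth, synth, ← tsum_mul_left]
  refine tsum_congr fun n => ?_
  by_cases he : eps n = c
  · rw [wave_add_arg, wave_lattice n hγ, he]
    ring
  · simp [ha n he]

/-- The restriction of a lattice function to the sites of a given class. -/
def part (c : ℤ) (w : ℤ × ℤ → ℂ) (n : ℤ × ℤ) : ℂ := if eps n = c then w n else 0

lemma norm_part_le (c : ℤ) (w : ℤ × ℤ → ℂ) (n : ℤ × ℤ) : ‖part c w n‖ ≤ ‖w n‖ := by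
  unfold part
  split_ifs <;> simp

lemma PolyDecay.part {p : ℕ} {w : ℤ × ℤ → ℂ} (h : PolyDecay p w) (c : ℤ) :
    PolyDecay p (part c w) :=
  h.of_norm_le 1 (fun m => by rw [one_mul]; exact norm_part_le c w m) zero_le_one

/-- The pair of quasi-periodic functions with given amplitudes. -/
def synthPair (w : ℤ × ℤ → ℂ) (z : ℂ) : ℂ × ℂ := (synth (part (-1) w) z, synth (part 1 w) z)

theorem IsSol.inKer {κ α : ℂ} {w : ℤ × ℤ → ℂ} (h : IsSol κ α w) :
    InKer UBM (fun z => UBM (-z)) α (K * κ) (synthPair w) := by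
  have hd : ∀ c p, PolyDecay p (part c w) := fun c p => (h.polyDecay p).part c
  have hc : ∀ c n, eps n ≠ c → part c w n = 0 := fun c n hn => if_neg hn
  refine ⟨(contDiff_synth fun k _ => hd _ _).prodMk (contDiff_synth fun k _ => hd _ _),
    synth_equation (hd _ _) (hd _ _) UBM_eq fun n => ?_,
    synth_equation (d := fun l => -dir l) (hd _ _) (hd _ _) UBM_neg_eq fun n => ?_,
    fun γ hγ z => ?_, fun γ hγ z => ?_⟩
  · by_cases he : eps n = -1
    · rw [part, if_pos he, h.eqn n (by rw [he]; norm_num), hop]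
      congr 1
      refine Finset.sum_congr rfl fun l _ => ?_
      have h1 : nbr n l = n - dir l := by rw [nbr, he, neg_one_zsmul, sub_eq_add_neg]
      rw [part, ← h1, eps_nbr, he, if_pos (by norm_num)]
    · rw [hc _ _ he, mul_zero, Finset.sum_eq_zero, mul_zero]
      intro l _
      rw [hc, mul_zero]
      have := dir_sum l
      rw [ne_eq, eps_eq_one_iff, Prod.fst_sub, Prod.snd_sub]
      rw [eps_eq_neg_one_iff] at he
      omega
  · by_cases he : eps n = 1
    · rw [part, if_pos he, h.eqn n (by rw [he]; norm_num), hop]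
      congr 1
      refine Finset.sum_congr rfl fun l _ => ?_
      have h1 : nbr n l = n - -dir l := by rw [nbr, he, one_smul, sub_neg_eq_add]
      rw [part, ← h1, eps_nbr, he, if_pos rfl]
    · rw [hc _ _ he, mul_zero, Finset.sum_eq_zero, mul_zero]
      intro l _
      rw [hc, mul_zero]
      have := dir_sum l
      rw [ne_eq, eps_eq_neg_one_iff, sub_neg_eq_add, Prod.fst_add, Prod.snd_add]
      rw [eps_eq_one_iff] at he
      omega
  · have := synth_add_lattice (hc (-1)) hγ z
    simpa [synthPair] using this
  · have := synth_add_lattice (hc 1) hγ z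
    simpa [synthPair] using this

end Synthesis

section Convolution

lemma eps_sub_eq_zero_iff (n j : ℤ × ℤ) : eps (n - j) = 0 ↔ eps n = eps j := by
  unfold eps
  simp only [Prod.fst_sub, Prod.snd_sub]
  split_ifs <;> norm_num <;> omega

/-- The character of the lattice of sites which distinguishes its three rotation centres. -/
def ch (n : ℤ × ℤ) : ℂ := ω ^ n.2

lemma ch_add (m n : ℤ × ℤ) : ch (m + n) = ch m * ch n := zpow_add₀ omega_ne_zero _ _

lemma ch_ne_zero (m : ℤ × ℤ) : ch m ≠ 0 := zpow_ne_zero _ omega_ne_zero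

lemma ch_zero : ch 0 = 1 := by simp [ch]

lemma ch_neg (m : ℤ × ℤ) : ch (-m) = (ch m)⁻¹ := by simp [ch]

lemma norm_ch (m : ℤ × ℤ) : ‖ch m‖ = 1 := by rw [ch, norm_zpow, norm_omega, one_zpow]

lemma ch_rot (j : ℤ × ℤ) : ch (rot j) = ω ^ eps j * ch j := by
  obtain ⟨k, hk⟩ : ∃ k, j.1 + j.2 = 3 * k + eps j := by
    refine ⟨(j.1 + j.2 - eps j) / 3, ?_⟩
    unfold eps
    split_ifs <;> omega
  have h1 : (rot j).2 = eps j + j.2 + 3 * (k - j.2) := by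
    simp only [rot]
    omega
  rw [ch, h1, zpow_add₀ omega_ne_zero, zpow_add₀ omega_ne_zero, zpow_mul]
  have h2 : ω ^ (3 : ℤ) = 1 := by exact_mod_cast omega_pow_three
  rw [h2, one_zpow, mul_one, ch]

/-- The rotation of the sites as a permutation. -/
def rotEquiv : ℤ × ℤ ≃ ℤ × ℤ where
  toFun := rot
  invFun n := rot (rot n)
  left_inv := rot_rot_rot
  right_inv := rot_rot_rot

lemma omega_zpow_ne_one {c : ℤ} (hc : c = 1 ∨ c = -1) : ω ^ c ≠ 1 := by
  rcases hc with rfl | rfl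
  · simpa using omega_ne_one
  · simpa using omega_ne_one

lemma tsum_part_mul_eq_zero {w f : ℤ × ℤ → ℂ} (hrot : ∀ n, w (rot n) = w n) {c : ℤ} {a : ℂ}
    (ha : a ≠ 1) (hf : ∀ j, eps j = c → f (rot j) = a * f j) : ∑' j, part c w j * f j = 0 := by
  have h : ∑' j, part c w j * f j = a * ∑' j, part c w j * f j := by
    rw [← tsum_mul_left]
    conv_lhs => rw [← rotEquiv.tsum_eq]
    refine tsum_congr fun j => ?_
    change part c w (rot j) * f (rot j) = _
    unfold part
    rw [eps_rot, hrot]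
    split_ifs with hj
    · rw [hf j hj]
      ring
    · simp
  have h2 : (a - 1) * ∑' j, part c w j * f j = 0 := by linear_combination -h
  exact (mul_eq_zero.1 h2).resolve_left (sub_ne_zero.2 ha)

lemma tsum_part_mul_ch {w : ℤ × ℤ → ℂ} (hrot : ∀ n, w (rot n) = w n) {c : ℤ}
    (hc : c = 1 ∨ c = -1) : ∑' j, part c w j * ch j = 0 :=
  tsum_part_mul_eq_zero hrot (omega_zpow_ne_one hc) fun j hj => by rw [ch_rot, hj]

lemma tsum_part_mul_ch_neg {w : ℤ × ℤ → ℂ} (hrot : ∀ n, w (rot n) = w n) {c : ℤ}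
    (hc : c = 1 ∨ c = -1) : ∑' j, part c w j * ch (-j) = 0 :=
  tsum_part_mul_eq_zero hrot (a := (ω ^ c)⁻¹) (by simpa using omega_zpow_ne_one hc) fun j hj => by
    rw [ch_neg, ch_rot, hj, ch_neg, mul_inv]

/-- Convolution of lattice functions. -/
def conv (a b : ℤ × ℤ → ℂ) (n : ℤ × ℤ) : ℂ := ∑' j, a j * b (n - j)

/-- Bounded lattice functions on the central sites whose product with the shifted coordinate is a
combination of the two nontrivial characters. -/
structure IsGreen (κ : ℂ) (G : ℤ × ℤ → ℂ) : Prop where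
  eq_zero : ∀ m, eps m ≠ 0 → G m = 0
  bdd : ∃ C, ∀ m, ‖G m‖ ≤ C
  eqn : ∃ c d : ℂ, ∀ m, eps m = 0 → (emb m + κ) * G m = c * ch m + d * ch (-m)

lemma summable_conv {a b : ℤ × ℤ → ℂ} (ha : Summable fun n => ‖a n‖)
    (hb : ∃ C, ∀ m, ‖b m‖ ≤ C) (σ : ℤ × ℤ → ℤ × ℤ) : Summable fun j => a j * b (σ j) := by
  obtain ⟨C, hC⟩ := hb
  refine Summable.of_norm_bounded (ha.mul_right C) fun j => ?_
  rw [norm_mul]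
  gcongr
  exact hC _

theorem IsSol.conv {κ α : ℂ} {w G : ℤ × ℤ → ℂ} (hw : IsSol 0 α w)
    (hrot : ∀ n, w (rot n) = w n) (hG : IsGreen κ G) : IsSol κ α (conv w G) := by
  have hws := (hw.polyDecay 3).summable
  refine ⟨fun n hn => ?_, ?_, fun n hn => ?_⟩
  · rw [TBG.conv, ← tsum_zero (α := ℂ) (β := ℤ × ℤ)]
    refine tsum_congr fun j => ?_
    by_cases hj : eps j = 0
    · rw [hw.eq_zero j hj, zero_mul]
    · rw [hG.eq_zero, mul_zero]
      rw [ne_eq, eps_sub_eq_zero_iff, hn]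
      exact fun h => hj h.symm
  · obtain ⟨C, hC⟩ := hG.bdd
    refine ⟨∑' j, ‖w j‖ * C, fun n => tsum_of_norm_bounded (hws.mul_right C).hasSum fun j => ?_⟩
    rw [norm_mul]
    gcongr
    exact hC _
  · have hc : eps n = 1 ∨ eps n = -1 := (eps_cases n).resolve_left hn
    obtain ⟨c, d, hcd⟩ := hG.eqn
    have hs1 := summable_conv hws hG.bdd
    have hps : Summable fun j => ‖part (eps n) w j‖ := ((hw.polyDecay 3).part _).summable
    have hch : ∀ σ : ℤ × ℤ → ℤ × ℤ, Summable fun j => part (eps n) w j * ch (σ j) :=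
      summable_conv hps ⟨1, fun m => (norm_ch m).le⟩
    have h1 : ∀ j, (emb n + κ) * (w j * G (n - j)) = I * α * (∑ l ∈ Finset.range 3,
        ω ^ l * (w (j + eps n • dir l) * G (n - j))) + (c * ch n * (part (eps n) w j * ch (-j)) +
          d * ch (-n) * (part (eps n) w j * ch j)) := fun j => by
      by_cases hj : eps j = eps n
      · have h2 := hcd (n - j) ((eps_sub_eq_zero_iff _ _).2 hj.symm)
        have h3 := hw.eqn j (by rw [hj]; exact hn)
        have h4 : hop w j = ∑ l ∈ Finset.range 3, ω ^ l * w (j + eps n • dir l) := by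
          simp only [hop, nbr, hj]
        have h5 : ∑ l ∈ Finset.range 3, ω ^ l * (w (j + eps n • dir l) * G (n - j)) =
            hop w j * G (n - j) := by
          rw [h4, Finset.sum_mul]
          exact Finset.sum_congr rfl fun l _ => by ring
        rw [emb_sub, sub_eq_add_neg n j, ch_add, neg_add, neg_neg, ch_add, ← sub_eq_add_neg] at h2
        rw [h5, part, if_pos hj]
        linear_combination w j * h2 + G (n - j) * h3
      · have h2 : G (n - j) = 0 := hG.eq_zero _ (by
          rw [ne_eq, eps_sub_eq_zero_iff]
          exact fun h => hj h.symm)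
        simp [h2, part, hj]
    have h2 : ∀ l, HasSum (fun j => w (j + eps n • dir l) * G (n - j)) (TBG.conv w G (nbr n l)) := by
      intro l
      have := (hs1 fun j => nbr n l - j).hasSum
      rw [← (Equiv.addRight (eps n • dir l)).hasSum_iff] at this
      refine this.congr_fun fun j => ?_
      change _ = w (j + eps n • dir l) * G (n + eps n • dir l - (j + eps n • dir l))
      rw [add_sub_add_right_eq_sub]
    have h3 := ((hasSum_sum (s := Finset.range 3) fun l _ => (h2 l).mul_left (ω ^ l)).mul_left
      (I * α)).add (((hch fun j => -j).hasSum.mul_left (c * ch n)).add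
        ((hch fun j => j).hasSum.mul_left (d * ch (-n))))
    rw [tsum_part_mul_ch hrot hc, tsum_part_mul_ch_neg hrot hc, mul_zero, mul_zero, add_zero,
      add_zero] at h3
    exact (((hs1 fun j => n - j).hasSum.mul_left (emb n + κ)).congr_fun fun j => (h1 j).symm).unique
      h3

end Convolution

section DiscreteLaplacian

/-- Support of the discrete Laplacian. -/
def lapSupp : Finset (ℤ × ℤ) := {0, (3, 0), (-3, 0), (0, 3), (0, -3)}

/-- Convolution with a function supported on `lapSupp`. -/
def fop (c G : ℤ × ℤ → ℂ) (m : ℤ × ℤ) : ℂ := ∑ d ∈ lapSupp, c d * G (m - d)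

/-- The coefficients of the discrete Laplacian. -/
def lapCoef (d : ℤ × ℤ) : ℂ := if d = 0 then 4 else -1

/-- The coefficients of the discrete Laplacian, weighted with the coordinate. -/
def lapCoefEmb (d : ℤ × ℤ) : ℂ := emb d * lapCoef d

lemma sum_lapSupp (f : ℤ × ℤ → ℂ) :
    ∑ d ∈ lapSupp, f d = f 0 + (f (3, 0) + (f (-3, 0) + (f (0, 3) + f (0, -3)))) := by
  rw [lapSupp, Finset.sum_insert (by decide), Finset.sum_insert (by decide),
    Finset.sum_insert (by decide), Finset.sum_insert (by decide), Finset.sum_singleton]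

lemma lapCoef_zero : lapCoef 0 = 4 := if_pos rfl

lemma lapCoef_of_ne {d : ℤ × ℤ} (h : d ≠ 0) : lapCoef d = -1 := if_neg h

lemma sum_lapCoef : ∑ d ∈ lapSupp, lapCoef d = 0 := by
  rw [sum_lapSupp, lapCoef_zero, lapCoef_of_ne (by decide), lapCoef_of_ne (by decide),
    lapCoef_of_ne (by decide), lapCoef_of_ne (by decide)]
  norm_num

lemma sum_lapCoefEmb : ∑ d ∈ lapSupp, lapCoefEmb d = 0 := by
  simp only [lapCoefEmb]
  rw [sum_lapSupp, lapCoef_zero, lapCoef_of_ne (by decide), lapCoef_of_ne (by decide),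
    lapCoef_of_ne (by decide), lapCoef_of_ne (by decide)]
  simp [emb]

lemma eps_of_mem_lapSupp {d : ℤ × ℤ} (hd : d ∈ lapSupp) : eps d = 0 := by
  revert d; decide

lemma ch_of_mem_lapSupp {d : ℤ × ℤ} (hd : d ∈ lapSupp) : ch d = 1 := by
  have h2 : ω ^ (3 : ℤ) = 1 := by exact_mod_cast omega_pow_three
  simp only [lapSupp, Finset.mem_insert, Finset.mem_singleton] at hd
  rcases hd with rfl | rfl | rfl | rfl | rfl
  · simp [ch]
  · simp [ch]
  · simp [ch]
  · exact h2
  · rw [ch, zpow_neg, h2, inv_one]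

lemma fop_comm (c c' G : ℤ × ℤ → ℂ) : fop c (fop c' G) = fop c' (fop c G) := by
  funext m
  simp only [fop, Finset.mul_sum]
  rw [Finset.sum_comm]
  refine Finset.sum_congr rfl fun d _ => Finset.sum_congr rfl fun e _ => ?_
  rw [sub_right_comm]
  ring

lemma emb_mul_fop {κ : ℂ} {c G H : ℤ × ℤ → ℂ} (h : ∀ m, (emb m + κ) * G m = H m) (m : ℤ × ℤ) :
    (emb m + κ) * fop c G m = fop (fun d => emb d * c d) G m + fop c H m := by
  rw [fop, fop, fop, Finset.mul_sum, ← Finset.sum_add_distrib]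
  refine Finset.sum_congr rfl fun d _ => ?_
  rw [← h, emb_sub]
  ring

lemma PolyDecay.fop {p : ℕ} {G : ℤ × ℤ → ℂ} (h : PolyDecay p G) (c : ℤ × ℤ → ℂ) :
    PolyDecay p (fop c G) := PolyDecay.sum _ fun d _ => (h.shift d).const_mul _

lemma fop_eq_zero_of_eps {c G : ℤ × ℤ → ℂ} (h : ∀ m, eps m ≠ 0 → G m = 0) (m : ℤ × ℤ)
    (hm : eps m ≠ 0) : fop c G m = 0 := by
  refine Finset.sum_eq_zero fun d hd => ?_
  rw [h, mul_zero]
  rwa [ne_eq, eps_sub_eq_zero_iff, eps_of_mem_lapSupp hd]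

lemma fop_eq_zero_of_invariant {c E : ℤ × ℤ → ℂ} (hc : ∑ d ∈ lapSupp, c d = 0)
    (hE : ∀ m, ∀ d ∈ lapSupp, E (m - d) = E m) (m : ℤ × ℤ) : fop c E m = 0 := by
  rw [fop, Finset.sum_congr rfl fun d hd => by rw [hE m d hd], ← Finset.sum_mul, hc, zero_mul]

/-- A decaying function annihilated by the discrete Laplacian vanishes. -/
lemma eq_zero_of_fop_lapCoef {H : ℤ × ℤ → ℂ} (h : PolyDecay 1 H) (h0 : ∀ m, fop lapCoef H m = 0)
    (m : ℤ × ℤ) : H m = 0 := by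
  obtain ⟨C, hC⟩ := h
  simp only [pow_one] at hC
  by_contra hm
  have hpos : 0 < ‖H m‖ := norm_pos_iff.2 hm
  have hfin : ∀ ε : ℝ, 0 < ε → {n | ε ≤ ‖H n‖}.Finite := fun ε hε => by
    refine (finite_norm_emb_le (C / ε)).subset fun n hn => ?_
    rw [Set.mem_ofPred_eq, le_div_iff₀ hε]
    have := hC n
    rw [Set.mem_ofPred_eq] at hn
    nlinarith [norm_nonneg (emb n), norm_nonneg (H n)]
  obtain ⟨x, hx, hmax⟩ := (hfin _ hpos).exists_maximalFor (fun n => ‖H n‖) _ ⟨m, le_refl ‖H m‖⟩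
  have hle : ∀ n, ‖H n‖ ≤ ‖H x‖ := fun n => by
    by_contra hn
    push Not at hn
    exact absurd (hmax (j := n) (le_trans hx hn.le) hn.le) (not_le.2 hn)
  have hstep : ∀ n, ‖H n‖ = ‖H x‖ → ‖H (n - (3, 0))‖ = ‖H x‖ := fun n hn => by
    have h1 := h0 n
    rw [fop, sum_lapSupp, lapCoef_zero, lapCoef_of_ne (by decide), lapCoef_of_ne (by decide),
      lapCoef_of_ne (by decide), lapCoef_of_ne (by decide), sub_zero] at h1
    have h2 : 4 * H n = H (n - (3, 0)) + (H (n - (-3, 0)) + (H (n - (0, 3)) + H (n - (0, -3)))) := by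
      linear_combination h1
    have h3 : 4 * ‖H n‖ ≤ ‖H (n - (3, 0))‖ + (‖H (n - (-3, 0))‖ + (‖H (n - (0, 3))‖ +
        ‖H (n - (0, -3))‖)) := by
      have : ‖(4 : ℂ) * H n‖ = 4 * ‖H n‖ := by rw [norm_mul]; norm_num
      rw [← this, h2]
      refine (norm_add_le _ _).trans (add_le_add le_rfl ((norm_add_le _ _).trans
        (add_le_add le_rfl (norm_add_le _ _))))
    refine le_antisymm (hle _) ?_
    linarith [hle (n - (-3, 0)), hle (n - (0, 3)), hle (n - (0, -3))]
  have hall : ∀ k : ℕ, ‖H (x - k • (3, 0))‖ = ‖H x‖ := fun k => by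
    induction k with
    | zero => simp
    | succ k ih =>
      rw [succ_nsmul, ← sub_sub]
      exact hstep _ ih
  refine Set.infinite_of_injective_forall_mem (f := fun k : ℕ => x - k • ((3, 0) : ℤ × ℤ))
    (fun a b hab => ?_) (fun k => ?_) (hfin _ hpos)
  · have := congrArg Prod.fst hab
    simp at this
    exact this
  · rw [Set.mem_ofPred_eq, hall k]
    exact hx

section

variable {κ : ℂ} {G : ℤ × ℤ → ℂ}

lemma exists_green_rhs (h0 : ∀ m, eps m ≠ 0 → G m = 0)
    (h : ∃ c d : ℂ, ∀ m, eps m = 0 → (emb m + κ) * G m = c * ch m + d * ch (-m)) :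
    ∃ E : ℤ × ℤ → ℂ, PolyDecay 0 E ∧ (∀ m, ∀ d ∈ lapSupp, E (m - d) = E m) ∧
      ∀ m, (emb m + κ) * G m = E m := by
  obtain ⟨c, d, hcd⟩ := h
  refine ⟨part 0 fun m => c * ch m + d * ch (-m), ⟨‖c‖ + ‖d‖, fun m => ?_⟩, fun m e he => ?_,
    fun m => ?_⟩
  · rw [pow_zero, mul_one]
    refine (norm_part_le _ _ _).trans ((norm_add_le _ _).trans ?_)
    rw [norm_mul, norm_mul, norm_ch, norm_ch, mul_one, mul_one]
  · have h1 : eps (m - e) = eps m := by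
      rw [sub_eq_neg_add, eps_add_of_eps_eq_zero]
      rw [eps_neg, eps_of_mem_lapSupp he, neg_zero]
    rw [part, part, h1, sub_eq_add_neg, neg_add, neg_neg, ch_add, ch_add, ch_neg e,
      ch_of_mem_lapSupp he, inv_one, mul_one, mul_one]
  · unfold part
    split_ifs with hm
    · exact hcd m hm
    · rw [h0 m hm, mul_zero]

lemma IsGreen.of_eqn (h0 : ∀ m, eps m ≠ 0 → G m = 0)
    (h : ∃ c d : ℂ, ∀ m, eps m = 0 → (emb m + κ) * G m = c * ch m + d * ch (-m)) :
    IsGreen κ G := by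
  obtain ⟨E, hE, -, hG⟩ := exists_green_rhs h0 h
  refine ⟨h0, ?_, h⟩
  simpa [PolyDecay] using (hE.div hG).mono (zero_le_one)

lemma IsGreen.polyDecay (h : IsGreen κ G) : PolyDecay 1 G := by
  obtain ⟨E, hE, -, hG⟩ := exists_green_rhs h.eq_zero h.eqn
  exact hE.div hG

lemma IsGreen.emb_mul_fop (h : IsGreen κ G) {c : ℤ × ℤ → ℂ} (hc : ∑ d ∈ lapSupp, c d = 0)
    (m : ℤ × ℤ) : (emb m + κ) * fop c G m = fop (fun d => emb d * c d) G m := by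
  obtain ⟨E, -, hE, hG⟩ := exists_green_rhs h.eq_zero h.eqn
  rw [TBG.emb_mul_fop hG, fop_eq_zero_of_invariant hc hE, add_zero]

lemma IsGreen.polyDecay_fop (h : IsGreen κ G) : PolyDecay 3 (fop lapCoef G) := by
  have h1 : PolyDecay 2 (fop lapCoefEmb G) :=
    (h.polyDecay.fop _).div (h.emb_mul_fop sum_lapCoefEmb)
  exact h1.div (h.emb_mul_fop sum_lapCoef)

lemma IsGreen.emb_mul_fop_fop (h : IsGreen κ G) (m : ℤ × ℤ) :
    (emb m + κ) * fop lapCoef (fop lapCoef G) m = 2 * fop lapCoefEmb (fop lapCoef G) m := by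
  rw [TBG.emb_mul_fop (H := fop lapCoefEmb G) (h.emb_mul_fop sum_lapCoef), fop_comm lapCoef]
  exact (two_mul _).symm

lemma IsGreen.polyDecay_fop_fop (h : IsGreen κ G) :
    PolyDecay 4 (fop lapCoef (fop lapCoef G)) :=
  ((h.polyDecay_fop.fop lapCoefEmb).const_mul 2).div h.emb_mul_fop_fop

end

/-- The trigonometric polynomial with coefficients supported on `lapSupp`. -/
def symb (c : ℤ × ℤ → ℂ) (z : ℂ) : ℂ := ∑ d ∈ lapSupp, c d * wave d z

lemma synth_fop {G : ℤ × ℤ → ℂ} (h : PolyDecay 3 G) (c : ℤ × ℤ → ℂ) (z : ℂ) :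
    synth (fop c G) z = symb c z * synth G z := by
  have h1 : ∀ d, HasSum (fun n => G (n - d) * wave n z) (wave d z * synth G z) := fun d => by
    rw [wave_mul_synth]
    exact hasSum_synth (h.shift d).summable z
  have h2 := hasSum_sum (s := lapSupp) fun d _ => (h1 d).mul_left (c d)
  rw [symb, Finset.sum_mul]
  have h3 : ∑ d ∈ lapSupp, c d * wave d z * synth G z =
      ∑ d ∈ lapSupp, c d * (wave d z * synth G z) :=
    Finset.sum_congr rfl fun d _ => by ring
  rw [h3, ← h2.tsum_eq, synth]
  refine tsum_congr fun n => ?_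
  rw [fop, Finset.sum_mul]
  exact Finset.sum_congr rfl fun d _ => by ring

lemma contDiff_symb (c : ℤ × ℤ → ℂ) : ContDiff ℝ 1 (symb c) :=
  ContDiff.sum fun d _ => contDiff_const.mul (contDiff_wave d)

lemma Dbar_symb (c : ℤ × ℤ → ℂ) (z : ℂ) :
    Dbar (symb c) z = K * symb (fun d => emb d * c d) z := by
  have h1 := fun d => (differentiable_wave d z).const_mul (c d)
  have h2 : fderiv ℝ (symb c) z = ∑ d ∈ lapSupp, fderiv ℝ (fun w => c d * wave d w) z :=
    fderiv_fun_sum fun d _ => h1 d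
  have h3 : Dbar (symb c) z = ∑ d ∈ lapSupp, Dbar (fun w => c d * wave d w) z := by
    rw [Dbar, h2]
    simp only [Dbar, _root_.sum_apply, Finset.mul_sum, mul_add, Finset.sum_add_distrib]
  rw [h3, symb, Finset.mul_sum]
  refine Finset.sum_congr rfl fun d _ => ?_
  rw [Dbar_const_mul _ (differentiable_wave d z), Dbar_wave]
  ring

end DiscreteLaplacian

section SynthesisProduct

lemma conv_fop {a G : ℤ × ℤ → ℂ} (ha : Summable fun n => ‖a n‖) (hG : ∃ C, ∀ m, ‖G m‖ ≤ C)
    (c : ℤ × ℤ → ℂ) : conv a (fop c G) = fop c (conv a G) := by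
  funext n
  have h := hasSum_sum (s := lapSupp) fun d _ =>
    (summable_conv ha hG fun j => n - d - j).hasSum.mul_left (c d)
  rw [fop, conv]
  refine Eq.trans (tsum_congr fun j => ?_) h.tsum_eq
  rw [fop, Finset.mul_sum]
  refine Finset.sum_congr rfl fun d _ => ?_
  rw [sub_right_comm]
  ring

lemma synth_conv {a b : ℤ × ℤ → ℂ} (ha : Summable fun n => ‖a n‖) (hb : Summable fun n => ‖b n‖)
    (z : ℂ) : synth (conv a b) z = synth a z * synth b z := by
  have h1 : Summable fun p : (ℤ × ℤ) × (ℤ × ℤ) => (a p.1 * wave p.1 z) * (b p.2 * wave p.2 z) :=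
    summable_mul_of_summable_norm (f := fun n => a n * wave n z) (g := fun n => b n * wave n z)
      (by simpa [norm_wave] using ha) (by simpa [norm_wave] using hb)
  have h2 : synth a z * synth b z = ∑' p : (ℤ × ℤ) × (ℤ × ℤ),
      (a p.1 * wave p.1 z) * (b p.2 * wave p.2 z) :=
    (summable_mul_wave ha z).tsum_mul_tsum (summable_mul_wave hb z) h1
  let e : (ℤ × ℤ) × (ℤ × ℤ) ≃ (ℤ × ℤ) × (ℤ × ℤ) :=
    { toFun := fun p => (p.2, p.1 - p.2)
      invFun := fun p => (p.1 + p.2, p.1)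
      left_inv := fun p => by ext <;> simp
      right_inv := fun p => by ext <;> simp }
  have h3 : ∀ p, (a (e p).1 * wave (e p).1 z) * (b (e p).2 * wave (e p).2 z) =
      a p.2 * b (p.1 - p.2) * wave p.1 z := fun p => by
    have : wave p.1 z = wave p.2 z * wave (p.1 - p.2) z := by rw [← wave_add, add_sub_cancel]
    rw [this]
    change (a p.2 * wave p.2 z) * (b (p.1 - p.2) * wave (p.1 - p.2) z) = _
    ring
  have h4 := (e.summable_iff).2 h1
  rw [h2, ← e.tsum_eq, tsum_congr h3]
  have h5 : Summable fun p : (ℤ × ℤ) × (ℤ × ℤ) => a p.2 * b (p.1 - p.2) * wave p.1 z :=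
    h4.congr fun p => h3 p
  rw [h5.tsum_prod, synth]
  refine tsum_congr fun n => ?_
  rw [conv, ← tsum_mul_right]

lemma eq_zero_of_synth_eq_zero {a : ℤ × ℤ → ℂ} (ha : Summable fun n => ‖a n‖) {c : ℤ}
    (hc : ∀ n, eps n ≠ c → a n = 0) (h : ∀ z, synth a z = 0) (n : ℤ × ℤ) : a n = 0 := by
  by_cases hn : eps n = c
  · have hs : Summable fun m => ‖a (m - -n)‖ := by
      simpa [Function.comp_def] using (Equiv.addRight n).summable_iff.2 ha
    have h1 : synth (fun m => a (m - -n)) = fun _ => 0 := by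
      funext z
      rw [← wave_mul_synth, h, mul_zero]
    have h2 := hasSum_avg_synth hs
    rw [h1, avg_zero] at h2
    have h3 : HasSum (fun m => a (m - -n) * avg (wave m)) (a (0 - -n) * avg (wave 0)) := by
      refine hasSum_single 0 fun m hm => ?_
      by_cases he : eps m = 0
      · rw [avg_wave he hm, mul_zero]
      · rw [hc, zero_mul]
        rw [sub_neg_eq_add, ← hn]
        intro h5
        rw [← eps_sub_eq_zero_iff, add_sub_cancel_right] at h5
        exact he h5
    have h4 : wave 0 = fun _ => 1 := funext wave_zero
    rw [h4, avg_one, mul_one, zero_sub, neg_neg] at h3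
    exact h3.unique h2
  · exact hc n hn

end SynthesisProduct

section Holomorphic

lemma re_wave (n : ℤ × ℤ) (z : ℂ) : (wave n z).re = Real.cos (4 * Real.pi / 3 * pair z (emb n)) := by
  rw [wave, phaseL_apply, exp_ofReal_mul_I_re]

lemma countable_zeros_symb : {z : ℂ | symb lapCoef z = 0}.Countable := by
  have h3 : (0 : ℝ) < Real.sqrt 3 := Real.sqrt_pos.2 (by norm_num)
  refine (Set.countable_range fun x : ℤ × ℤ =>
    (⟨x.1 / 2, (x.2 + x.1 / 2) / Real.sqrt 3⟩ : ℂ)).mono fun z hz => ?_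
  have h : (symb lapCoef z).re = 0 := by rw [show symb lapCoef z = 0 from hz, zero_re]
  rw [symb, sum_lapSupp, lapCoef_zero, lapCoef_of_ne (by decide), lapCoef_of_ne (by decide),
    lapCoef_of_ne (by decide), lapCoef_of_ne (by decide), wave_zero] at h
  simp only [add_re, neg_mul, one_mul, neg_re, re_wave, mul_one] at h
  have e1 : pair z (emb (3, 0)) = 3 * z.re := by simp [pair_eq, emb]; ring
  have e2 : pair z (emb (-3, 0)) = -(3 * z.re) := by simp [pair_eq, emb]; ring
  have e3 : pair z (emb (0, 3)) = 3 * (-z.re / 2 + Real.sqrt 3 / 2 * z.im) := by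
    simp [pair_eq, emb, omega_re, omega_im]; ring
  have e4 : pair z (emb (0, -3)) = -(3 * (-z.re / 2 + Real.sqrt 3 / 2 * z.im)) := by
    simp [pair_eq, emb, omega_re, omega_im]; ring
  rw [e1, e2, e3, e4, mul_neg, mul_neg, Real.cos_neg, Real.cos_neg] at h
  have h4 : (4 : ℂ).re = 4 := by norm_num
  rw [h4] at h
  obtain ⟨n, hn⟩ := (Real.cos_eq_one_iff (4 * Real.pi / 3 * (3 * z.re))).1
    (by linarith [Real.cos_le_one (4 * Real.pi / 3 * (3 * z.re)),
      Real.cos_le_one (4 * Real.pi / 3 * (3 * (-z.re / 2 + Real.sqrt 3 / 2 * z.im)))])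
  obtain ⟨m, hm⟩ :=
    (Real.cos_eq_one_iff (4 * Real.pi / 3 * (3 * (-z.re / 2 + Real.sqrt 3 / 2 * z.im)))).1
    (by linarith [Real.cos_le_one (4 * Real.pi / 3 * (3 * z.re)),
      Real.cos_le_one (4 * Real.pi / 3 * (3 * (-z.re / 2 + Real.sqrt 3 / 2 * z.im)))])
  have hπ := Real.pi_ne_zero
  have hre : z.re = n / 2 := by
    have : Real.pi * (2 * z.re) = Real.pi * n := by linarith
    linarith [mul_left_cancel₀ hπ this]
  have him : Real.sqrt 3 * z.im = m + n / 2 := by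
    have : Real.pi * (-z.re + Real.sqrt 3 * z.im) = Real.pi * m := by linarith
    linarith [mul_left_cancel₀ hπ this]
  refine ⟨(n, m), Complex.ext hre.symm ?_⟩
  change ((m : ℝ) + n / 2) / Real.sqrt 3 = z.im
  rw [← him]
  exact mul_div_cancel_left₀ _ h3.ne'

lemma hasFDerivAt_exp_conj (c z : ℂ) :
    HasFDerivAt (fun w => Complex.exp (c * (starRingEnd ℂ) w))
      ((Complex.exp (c * (starRingEnd ℂ) z) * c) • (conjCLE : ℂ →L[ℝ] ℂ)) z := by
  have h := ((conjCLE : ℂ →L[ℝ] ℂ).hasFDerivAt (x := z)).const_mul c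
  refine h.cexp.congr_fderiv ?_
  ext v
  simp [mul_assoc]

lemma Dbar_exp_conj (c z : ℂ) : Dbar (fun w => Complex.exp (c * (starRingEnd ℂ) w)) z =
    -2 * I * c * Complex.exp (c * (starRingEnd ℂ) z) := by
  rw [Dbar, (hasFDerivAt_exp_conj c z).fderiv]
  simp
  linear_combination (-I * c * Complex.exp (c * (starRingEnd ℂ) z)) * I_sq

lemma differentiableAt_of_Dbar_eq_zero {h : ℂ → ℂ} {z : ℂ} (hd : DifferentiableAt ℝ h z)
    (h0 : Dbar h z = 0) : DifferentiableAt ℂ h z := by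
  rw [differentiableAt_complex_iff_differentiableAt_real]
  refine ⟨hd, ?_⟩
  have h1 : fderiv ℝ h z 1 + I * fderiv ℝ h z I = 0 :=
    (mul_eq_zero.1 h0).resolve_left (by simp)
  rw [smul_eq_mul]
  linear_combination (-I) * h1 + fderiv ℝ h z I * I_sq

lemma Dbar_inv {p : ℂ → ℂ} {z : ℂ} (hp : DifferentiableAt ℝ p z) (h0 : p z ≠ 0) :
    Dbar (fun w => (p w)⁻¹) z = -Dbar p z * ((p z)⁻¹ * (p z)⁻¹) := by
  have h1 : (fun w => p w * (p w)⁻¹) =ᶠ[nhds z] fun _ => 1 := by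
    filter_upwards [hp.continuousAt.eventually_ne h0] with w hw using mul_inv_cancel₀ hw
  have h2 : Dbar (fun w => p w * (p w)⁻¹) z = 0 := by
    rw [Dbar, h1.fderiv_eq]
    simp
  have hi : DifferentiableAt ℝ (fun w => (p w)⁻¹) z := hp.inv h0
  rw [Dbar_mul hp hi] at h2
  have h3 := mul_inv_cancel₀ h0
  linear_combination (p z)⁻¹ * h2 - Dbar (fun w => (p w)⁻¹) z * h3

/-- Unique continuation for solutions of a Cauchy–Riemann system that is singular on a countable
set. -/
lemma eq_zero_of_Dbar_eq {f g p q u : ℂ → ℂ} {a c z₀ : ℂ} (hf : ContDiff ℝ 1 f)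
    (hp : ContDiff ℝ 1 p) (hfg : ∀ z, f z = p z * g z) (hDp : ∀ z, Dbar p z = a * q z)
    (hDf : ∀ z, Dbar f z = 2 * a * q z * g z + c * f z) (hpc : {z | p z = 0}.Countable)
    (hu : Continuous u) (hu0 : u z₀ ≠ 0) (huf : ∀ z, u z * f z = 0) (z : ℂ) : f z = 0 := by
  have hfd := hf.differentiable one_ne_zero
  have hpd := hp.differentiable one_ne_zero
  set E : ℂ → ℂ := fun w => Complex.exp (-I * c / 2 * (starRingEnd ℂ) w) with hE
  have hEd : Differentiable ℝ E := fun w => (hasFDerivAt_exp_conj _ w).differentiableAt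
  set U : Set ℂ := {z | p z = 0}ᶜ with hU
  have hUo : IsOpen U := (isClosed_eq hp.continuous continuous_const).isOpen_compl
  have hUc : IsPreconnected U :=
    (hpc.isPathConnected_compl_of_one_lt_rank (by simp [rank_real_complex])).isConnected.isPreconnected
  have hUd : Dense U := hpc.dense_compl ℝ
  set h : ℂ → ℂ := fun w => f w * ((p w)⁻¹ * (p w)⁻¹ * E w) with hh
  have hhol : DifferentiableOn ℂ h U := fun w hw => by
    have hw' : p w ≠ 0 := hw
    have d1 := hfd w
    have d2 : DifferentiableAt ℝ (fun w => (p w)⁻¹) w := (hpd w).inv hw'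
    have d3 := hEd w
    have d4 : DifferentiableAt ℝ (fun w => (p w)⁻¹ * (p w)⁻¹) w := d2.mul d2
    have d5 : DifferentiableAt ℝ (fun w => (p w)⁻¹ * (p w)⁻¹ * E w) w := d4.mul d3
    have d6 : DifferentiableAt ℝ h w := d1.mul d5
    refine (differentiableAt_of_Dbar_eq_zero d6 ?_).differentiableWithinAt
    rw [hh, Dbar_mul d1 d5, Dbar_mul d4 d3, Dbar_mul d2 d2,
      Dbar_inv (hpd w) hw', hE, Dbar_exp_conj, hDf, hDp, hfg]
    have h3 := mul_inv_cancel₀ hw'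
    field_simp
    linear_combination
      (g w * c * p w * Complex.exp (-(c * I * (starRingEnd ℂ) w / 2))) * I_sq
  have hne : ∀ w ∈ U, h w = 0 → f w = 0 := fun w hw h0 => by
    refine (mul_eq_zero.1 h0).resolve_right ?_
    have hw' : (p w)⁻¹ ≠ 0 := inv_ne_zero hw
    exact mul_ne_zero (mul_ne_zero hw' hw') (exp_ne_zero _)
  obtain ⟨w, hw, hwU⟩ :=
    hUd.inter_open_nonempty _ (isOpen_ne_fun hu continuous_const) ⟨z₀, hu0⟩
  have hloc : h =ᶠ[nhds w] 0 := by
    filter_upwards [hu.continuousAt.eventually_ne (show u w ≠ 0 from hw)] with y hy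
    simp [hh, (mul_eq_zero.1 (huf y)).resolve_left hy]
  have hz := (hhol.analyticOnNhd hUo).eqOn_zero_of_preconnected_of_eventuallyEq_zero hUc hwU hloc
  exact congrFun (hf.continuous.ext_on hUd continuous_const fun y hy => hne y hy (hz hy)) z

end Holomorphic

section DegenerateKernel

lemma synth_linear {a b : ℤ × ℤ → ℂ} (ha : Summable fun n => ‖a n‖) (hb : Summable fun n => ‖b n‖)
    (x y z : ℂ) : synth (fun n => x * a n + y * b n) z = x * synth a z + y * synth b z := by
  have h := ((hasSum_synth ha z).mul_left x).add ((hasSum_synth hb z).mul_left y)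
  exact (h.congr_fun fun n => by ring).tsum_eq

lemma part_conv {w G : ℤ × ℤ → ℂ} (hG : ∀ m, eps m ≠ 0 → G m = 0) (c : ℤ) :
    conv (part c w) G = part c (conv w G) := by
  funext n
  by_cases hn : eps n = c
  · rw [part, if_pos hn]
    refine tsum_congr fun j => ?_
    by_cases hj : eps n = eps j
    · rw [part, if_pos (hj ▸ hn)]
    · rw [hG _ (mt (eps_sub_eq_zero_iff n j).1 hj), mul_zero, mul_zero]
  · rw [part, if_neg hn, conv, ← tsum_zero (α := ℂ) (β := ℤ × ℤ)]
    refine tsum_congr fun j => ?_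
    by_cases hj : eps n = eps j
    · rw [part, if_neg (hj ▸ hn), zero_mul]
    · rw [hG _ (mt (eps_sub_eq_zero_iff n j).1 hj), mul_zero]

lemma IsGreen.synth_fop_fop_eq_zero {κ z₀ : ℂ} {G : ℤ × ℤ → ℂ} (hG : IsGreen κ G) {u : ℂ → ℂ}
    (hu : Continuous u) (hu0 : u z₀ ≠ 0)
    (h : ∀ z, u z * synth (fop lapCoef (fop lapCoef G)) z = 0) (z : ℂ) :
    synth (fop lapCoef (fop lapCoef G)) z = 0 := by
  have hP := hG.polyDecay_fop
  have hPP := hG.polyDecay_fop_fop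
  have hf : ContDiff ℝ 1 (synth (fop lapCoef (fop lapCoef G))) :=
    contDiff_synth (N := 1) fun k hk =>
      hPP.mono (by have : k ≤ 1 := by exact_mod_cast hk
                   omega)
  refine eq_zero_of_Dbar_eq (g := synth (fop lapCoef G)) (q := symb lapCoefEmb) (a := K)
    (c := -(K * κ)) hf (contDiff_symb lapCoef) (synth_fop hP lapCoef) (Dbar_symb lapCoef)
    (fun y => ?_) countable_zeros_symb hu hu0 h z
  have h1 : (fun n => emb n * fop lapCoef (fop lapCoef G) n) =
      fun n => 2 * fop lapCoefEmb (fop lapCoef G) n + -κ * fop lapCoef (fop lapCoef G) n := by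
    funext n
    linear_combination hG.emb_mul_fop_fop n
  rw [Dbar_synth hPP, h1, synth_linear (hP.fop _).summable (hP.fop _).summable, synth_fop hP]
  ring

/-- Convolution of a nonzero rotation invariant solution with Green functions is injective. -/
lemma IsSol.eq_zero_of_conv {κ α : ℂ} {w G : ℤ × ℤ → ℂ} (hw : IsSol 0 α w) (hw0 : w ≠ 0)
    (hrot : ∀ n, w (rot n) = w n) (hG : IsGreen κ G)
    (h : ∀ z, synthPair (TBG.conv w G) z = 0) (m : ℤ × ℤ) : G m = 0 := by
  obtain ⟨n, hn⟩ := Function.ne_iff.1 hw0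
  have hn0 : eps n ≠ 0 := fun h0 => hn (hw.eq_zero n h0)
  have hs : ∀ z, synth (part (eps n) (TBG.conv w G)) z = 0 := fun z => by
    rcases eps_cases n with h0 | h1 | h1
    · exact absurd h0 hn0
    · rw [h1]; exact congrArg Prod.snd (h z)
    · rw [h1]; exact congrArg Prod.fst (h z)
  have ha : Summable fun j => ‖part (eps n) w j‖ := ((hw.polyDecay 3).part _).summable
  obtain ⟨z₀, hz₀⟩ : ∃ z, synth (part (eps n) w) z ≠ 0 := by
    by_contra! hc
    have := eq_zero_of_synth_eq_zero ha (fun j hj => if_neg hj) hc n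
    rw [part, if_pos rfl] at this
    exact hn this
  have hd : PolyDecay 3 (TBG.conv (part (eps n) w) G) := by
    rw [part_conv hG.eq_zero]
    exact ((hw.conv hrot hG).polyDecay 3).part _
  have hprod : ∀ z, synth (part (eps n) w) z * synth (fop lapCoef (fop lapCoef G)) z = 0 := by
    intro z
    have hb1 : ∃ C, ∀ j, ‖fop lapCoef G j‖ ≤ C := by
      simpa [PolyDecay] using hG.polyDecay_fop.mono (Nat.zero_le 3)
    rw [← synth_conv ha (hG.polyDecay_fop.fop _).summable, conv_fop ha hb1, conv_fop ha hG.bdd,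
      synth_fop (hd.fop _), synth_fop hd, part_conv hG.eq_zero, hs]
    simp
  have hz := hG.synth_fop_fop_eq_zero (continuous_synth ha) hz₀ hprod
  have h1 := eq_zero_of_synth_eq_zero (hG.polyDecay_fop.fop _).summable
    (fop_eq_zero_of_eps (fop_eq_zero_of_eps hG.eq_zero)) hz
  have h2 := eq_zero_of_fop_lapCoef (hG.polyDecay_fop.mono (by norm_num)) h1
  exact eq_zero_of_fop_lapCoef hG.polyDecay h2 m

lemma omega_inv_sub_ne_zero : ω⁻¹ - ω ≠ 0 := by
  intro h
  have h1 : ω ^ 2 = 1 := by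
    have := mul_inv_cancel₀ omega_ne_zero
    linear_combination this - ω * h
  exact omega_ne_one (by linear_combination omega_pow_three - ω * h1)

lemma ch_one_neg_one : ch (1, -1) = ω⁻¹ := by simp [ch]

/-- The Green functions at any quasimomentum span a space of dimension at least two. -/
lemma exists_isGreen_pair (κ : ℂ) : ∃ G₁ G₂ : ℤ × ℤ → ℂ, IsGreen κ G₁ ∧ IsGreen κ G₂ ∧
    ∀ a b : ℂ, (∀ m, a * G₁ m + b * G₂ m = 0) → a = 0 ∧ b = 0 := by
  have hp : ∀ g : ℤ × ℤ → ℂ, ∀ m, eps m ≠ 0 → part 0 g m = 0 := fun g m hm => if_neg hm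
  have hp' : ∀ g : ℤ × ℤ → ℂ, ∀ m, eps m = 0 → part 0 g m = g m := fun g m hm => if_pos hm
  have he0 : eps 0 = 0 := by decide
  have he1 : eps (1, -1) = 0 := by decide
  by_cases h : ∀ m, eps m = 0 → emb m + κ ≠ 0
  · refine ⟨part 0 fun m => ch m / (emb m + κ), part 0 fun m => ch (-m) / (emb m + κ),
      IsGreen.of_eqn (hp _) ⟨1, 0, fun m hm => ?_⟩, IsGreen.of_eqn (hp _) ⟨0, 1, fun m hm => ?_⟩,
      fun a b hab => ?_⟩
    · rw [hp' _ m hm, mul_div_cancel₀ _ (h m hm)]; ring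
    · rw [hp' _ m hm, mul_div_cancel₀ _ (h m hm)]; ring
    · have h0 := hab 0
      have h1 := hab (1, -1)
      rw [hp' _ _ he0, hp' _ _ he0, neg_zero, ch_zero] at h0
      rw [hp' _ _ he1, hp' _ _ he1, ch_neg, ch_one_neg_one, inv_inv] at h1
      have n0 := h 0 he0
      have n1 := h _ he1
      field_simp at h0
      have h1' : a * ω⁻¹ + b * ω = 0 := by
        have : (a * ω⁻¹ + b * ω) / (emb (1, -1) + κ) = 0 := by rw [← h1]; ring
        exact (div_eq_zero_iff.1 this).resolve_right n1
      have h2 : a * (ω⁻¹ - ω) = 0 := by linear_combination h1' - ω * h0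
      have ha := (mul_eq_zero.1 h2).resolve_right omega_inv_sub_ne_zero
      exact ⟨ha, by linear_combination h0 - ha⟩
  · push Not at h
    obtain ⟨p, hp0, hpκ⟩ := h
    have hne : ∀ m, m ≠ p → emb m + κ ≠ 0 := fun m hm h0 =>
      hm (emb_injective (by linear_combination h0 - hpκ))
    have hcp := mul_inv_cancel₀ (ch_ne_zero p)
    refine ⟨Pi.single p 1, part 0 fun m => (ch m - ch p ^ 2 * ch (-m)) / (emb m + κ),
      IsGreen.of_eqn (fun m hm => ?_) ⟨0, 0, fun m hm => ?_⟩,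
      IsGreen.of_eqn (hp _) ⟨1, -ch p ^ 2, fun m hm => ?_⟩, fun a b hab => ?_⟩
    · exact Pi.single_eq_of_ne (by rintro rfl; exact hm hp0) _
    · by_cases hmp : m = p
      · rw [hmp, hpκ]; ring
      · rw [Pi.single_eq_of_ne hmp]; ring
    · by_cases hmp : m = p
      · rw [hmp, hpκ, ch_neg]
        linear_combination ch p * hcp
      · rw [hp' _ m hm, mul_div_cancel₀ _ (hne m hmp)]; ring
    · have h0 := hab p
      rw [hp' _ p hp0, hpκ, div_zero, Pi.single_eq_same] at h0
      have ha : a = 0 := by linear_combination h0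
      have hq : p + (1, -1) ≠ p := by simp
      have hq0 : eps (p + (1, -1)) = 0 := by
        rw [eps_add_of_eps_eq_zero hp0, he1]
      have h1 := hab (p + (1, -1))
      rw [hp' _ _ hq0, ha, zero_mul, zero_add, ch_neg, ch_add, ch_one_neg_one] at h1
      refine ⟨ha, (mul_eq_zero.1 h1).resolve_right (div_ne_zero ?_ (hne _ hq))⟩
      have h2 : ch p * ω⁻¹ - ch p ^ 2 * (ch p * ω⁻¹)⁻¹ = ch p * (ω⁻¹ - ω) := by
        rw [mul_inv, inv_inv]
        linear_combination (-ch p * ω) * hcp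
      rw [h2]
      exact mul_ne_zero (ch_ne_zero p) omega_inv_sub_ne_zero

lemma IsGreen.linear {κ : ℂ} {G₁ G₂ : ℤ × ℤ → ℂ} (h₁ : IsGreen κ G₁) (h₂ : IsGreen κ G₂)
    (a b : ℂ) : IsGreen κ fun m => a * G₁ m + b * G₂ m := by
  obtain ⟨c, d, h⟩ := h₁.eqn
  obtain ⟨c', d', h'⟩ := h₂.eqn
  refine IsGreen.of_eqn (fun m hm => ?_) ⟨a * c + b * c', a * d + b * d', fun m hm => ?_⟩
  · rw [h₁.eq_zero m hm, h₂.eq_zero m hm, mul_zero, mul_zero, add_zero]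
  · linear_combination a * h m hm + b * h' m hm

lemma conv_linear {w G₁ G₂ : ℤ × ℤ → ℂ} (hw : Summable fun n => ‖w n‖)
    (h₁ : ∃ C, ∀ m, ‖G₁ m‖ ≤ C) (h₂ : ∃ C, ∀ m, ‖G₂ m‖ ≤ C) (a b : ℂ) (n : ℤ × ℤ) :
    conv w (fun m => a * G₁ m + b * G₂ m) n = a * conv w G₁ n + b * conv w G₂ n := by
  have h := ((summable_conv hw h₁ fun j => n - j).hasSum.mul_left a).add
    ((summable_conv hw h₂ fun j => n - j).hasSum.mul_left b)
  exact (h.congr_fun fun n => by ring).tsum_eq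

lemma synthPair_linear {κ α : ℂ} {v w : ℤ × ℤ → ℂ} (hv : IsSol κ α v) (hw : IsSol κ α w)
    (a b z : ℂ) : synthPair (fun n => a * v n + b * w n) z =
      a • synthPair v z + b • synthPair w z := by
  have h : ∀ c, part c (fun n => a * v n + b * w n) =
      fun n => a * part c v n + b * part c w n := fun c => by
    funext n
    unfold part
    split_ifs <;> simp
  have hs : ∀ c, synth (part c fun n => a * v n + b * w n) z =
      a * synth (part c v) z + b * synth (part c w) z := fun c => by
    rw [h]
    exact synth_linear ((hv.polyDecay 3).part c).summable ((hw.polyDecay 3).part c).summable a b z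
  exact Prod.ext (hs _) (hs _)

/-- A nonzero rotation invariant protected state forces a degenerate flat band. -/
theorem two_le_kerDim_of_isSol {α : ℂ} {w : ℤ × ℤ → ℂ} (hw : IsSol 0 α w) (hw0 : w ≠ 0)
    (hrot : ∀ n, w (rot n) = w n) (k : ℂ) : 2 ≤ kerDim UBM (fun z => UBM (-z)) α k := by
  obtain ⟨G₁, G₂, h₁, h₂, hind⟩ := exists_isGreen_pair (k / K)
  have hk : K * (k / K) = k := mul_div_cancel₀ k K_ne_zero
  have hS := (hw.polyDecay 3).summable
  have s₁ := hw.conv hrot h₁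
  have s₂ := hw.conv hrot h₂
  have i₁ := s₁.inKer
  have i₂ := s₂.inKer
  rw [hk] at i₁ i₂
  have := finiteDimensional_kerSub α k
  rw [kerDim, span_kerSet]
  let u₁ : kerSub UBM (fun z => UBM (-z)) α k := ⟨synthPair (conv w G₁), i₁⟩
  let u₂ : kerSub UBM (fun z => UBM (-z)) α k := ⟨synthPair (conv w G₂), i₂⟩
  have hli : LinearIndependent ℂ ![u₁, u₂] := by
    rw [LinearIndependent.pair_iff]
    intro a b hab
    refine hind a b fun m => hw.eq_zero_of_conv hw0 hrot (h₁.linear h₂ a b) (fun z => ?_) m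
    have hc : conv w (fun m => a * G₁ m + b * G₂ m) =
        fun n => a * conv w G₁ n + b * conv w G₂ n :=
      funext (conv_linear hS h₁.bdd h₂.bdd a b)
    rw [hc, synthPair_linear s₁ s₂]
    exact congrFun (congrArg Subtype.val hab) z
  simpa using hli.fintype_card_le_finrank

end DegenerateKernel

/-- **infinitely many degenerate magic angles for the BM potential.**
The set of non-simple magic parameters, `{α : dim Ker(α,k) ≥ 2 for every k}`, is infinite. -/
theorem infinitely_many_degenerate_BM :
    {α : ℂ | ∀ k : ℂ, 2 ≤ kerDim UBM (fun z => UBM (-z)) α k}.Infinite := by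
  intro hfin
  refine infinite_zeros_bsDet ((hfin.image fun α => α ^ 4).subset fun z hz => ?_)
  obtain ⟨α, hα, w, hw0, hbdd, hrot, heps, heq⟩ := exists_solution_of_bsDet_zero hz
  exact ⟨α, two_le_kerDim_of_isSol
    ⟨heps, hbdd, fun n hn => by rw [add_zero]; exact heq n hn⟩ hw0 hrot, hα⟩

end TBG
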